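/- Let k be a number field with ring of integers 𝒪_k, let n ≥ 2 be an integer and let f ∈ k[X] be squarefree in k[X] with deg f ≥ 3. Suppose that for every nonzero prime ideal 𝔭 of 𝒪_k there exist x, y in the 𝔭-adic completion k_𝔭 with y^n = f(x), and that for every real embedding σ : k → ℝ there exist x, y ∈ ℝ with y^n = (σf)(x), where σf is the polynomial obtained by applying σ to the coefficients of f. Then there exist c > 0 and X₀ such that for all real X ≥ X₀, the number of nonzero prime ideals 𝔭 of 𝒪_k of absolute norm at most X that admit a totally positive generator π (i.e. 𝔭 = π𝒪_k and σ(π) > 0 for every real embedding σ) for which the twist C_π : π·y^n = f(x) satisfies: for every nonzero prime ideal 𝔮 of 𝒪_k there exist x, y ∈ k_𝔮 with π·y^n = f(x), and for every real embedding σ there exist x, y ∈ ℝ with σ(π)·y^n = (σf)(x), is at least c·X/log X. -/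

import Mathlib

open Polynomial

/-- The radical of an integer: the product of its distinct prime factors. -/
def IntRadical (m : ℤ) : ℕ := ∏ p ∈ m.natAbs.primeFactors, p

/-- The abc conjecture of Masser–Oesterlé. -/
def ABCConjecture : Prop :=
  ∀ ε : ℝ, 0 < ε → ∃ K : ℝ, 0 < K ∧ ∀ a b c : ℤ,
    a ≠ 0 → b ≠ 0 → c ≠ 0 →
    IsCoprime a b → IsCoprime a c → IsCoprime b c →
    a + b = c →
    ((max (max |a| |b|) |c| : ℤ) : ℝ) ≤ K * (IntRadical (a * b * c) : ℝ) ^ (1 + ε)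

/-- `d` is `n`-th power free. -/
def NthPowerFree (n : ℕ) (d : ℤ) : Prop :=
  d ≠ 0 ∧ ∀ p : ℕ, p.Prime → ¬ ((p : ℤ) ^ n ∣ d)

/-- A `K`-point of the twist `C_d : d·y^n = f(x)`. -/
def HasTwistPoint (n : ℕ) (f : Polynomial ℤ) (d : ℤ) (K : Type) [CommRing K] : Prop :=
  ∃ x y : K, (d : K) * y ^ n = Polynomial.aeval x f

/-- The twist `C_d : d·y^n = f(x)` has points everywhere locally. -/
def EverywhereLocallySoluble (n : ℕ) (f : Polynomial ℤ) (d : ℤ) : Prop :=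
  HasTwistPoint n f d ℝ ∧ ∀ (p : ℕ) (_ : Fact p.Prime), HasTwistPoint n f d ℚ_[p]

/-- The twist `C_d` violates the Hasse principle. -/
def ViolatesHasse (n : ℕ) (f : Polynomial ℤ) (d : ℤ) : Prop :=
  EverywhereLocallySoluble n f d ∧ ¬ HasTwistPoint n f d ℚ

/-- `f` is weakly intersective: the primes modulo which `f` has a root have
relative natural density `1` in the primes. -/
def WeaklyIntersective (f : Polynomial ℤ) : Prop :=
  Filter.Tendsto (fun X : ℕ =>
      (Nat.card {ℓ : ℕ // ℓ ≤ X ∧ ℓ.Prime ∧ ∃ x : ZMod ℓ, Polynomial.aeval x f = 0} : ℝ) /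
      (Nat.card {ℓ : ℕ // ℓ ≤ X ∧ ℓ.Prime} : ℝ))
    Filter.atTop (nhds 1)

open IsDedekindDomain NumberField

section LatticeSums

open MeasureTheory
open scoped ContDiff

/-- Iterated forward differences. -/
def iterDiff {E F : Type*} [AddCommGroup E] [AddCommGroup F] (hs : List E) (Φ : E → F) : E → F :=
  hs.foldr (fun h Ψ => fwdDiff h Ψ) Φ

lemma iterDiff_cons {E F : Type*} [AddCommGroup E] [AddCommGroup F] (h : E) (hs : List E)
    (Φ : E → F) (x : E) :
    iterDiff (h :: hs) Φ x = iterDiff hs Φ (x + h) - iterDiff hs Φ x := rfl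

lemma iterDiff_eq_zero_of_norm {E F : Type*} [NormedAddCommGroup E] [AddCommGroup F]
    (Φ : E → F) (R : ℝ) (hΦ : ∀ x, R < ‖x‖ → Φ x = 0) (hs : List E) :
    ∀ x, R + (hs.map norm).sum < ‖x‖ → iterDiff hs Φ x = 0 := by
  induction hs with
  | nil => intro x hx; exact hΦ x (by simpa using hx)
  | cons h hs ih =>
    intro x hx
    simp only [List.map_cons, List.sum_cons] at hx
    rw [iterDiff_cons, ih, ih, sub_zero]
    · linarith [norm_nonneg h]
    · have := norm_sub_norm_le x (-h)
      rw [sub_neg_eq_add, norm_neg] at this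
      linarith

lemma hasFDerivAt_iterDiff {E F : Type*} [NormedAddCommGroup E] [NormedSpace ℝ E]
    [NormedAddCommGroup F] [NormedSpace ℝ F] (Φ : E → F) (hΦ : Differentiable ℝ Φ)
    (hs : List E) : ∀ x, HasFDerivAt (iterDiff hs Φ) (iterDiff hs (fderiv ℝ Φ) x) x := by
  induction hs with
  | nil => intro x; exact (hΦ x).hasFDerivAt
  | cons h hs ih =>
    intro x
    have h1 := (hasFDerivAt_comp_add_right h).2 (ih (x + h))
    exact h1.sub (ih x)

lemma norm_iterDiff_le {E : Type} [NormedAddCommGroup E] [NormedSpace ℝ E] (K : ℕ) :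
    ∀ {F : Type} [NormedAddCommGroup F] [NormedSpace ℝ F] (Φ : E → F),
      ContDiff ℝ ∞ Φ → HasCompactSupport Φ →
      ∃ C : ℝ, 0 ≤ C ∧ ∀ hs : List E, hs.length = K → ∀ x,
        ‖iterDiff hs Φ x‖ ≤ C * (hs.map norm).prod := by
  induction K with
  | zero =>
    intro F _ _ Φ h1 h2
    obtain ⟨C, hC⟩ := h2.exists_bound_of_continuous h1.continuous
    refine ⟨max C 0, le_max_right _ _, fun hs hl x => ?_⟩
    rw [List.length_eq_zero_iff] at hl
    subst hl
    simpa [iterDiff] using Or.inl (hC x)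
  | succ K ih =>
    intro F _ _ Φ h1 h2
    obtain ⟨C, hC0, hC⟩ := ih (fderiv ℝ Φ) (h1.fderiv_right (by simp)) (h2.fderiv (𝕜 := ℝ))
    refine ⟨C, hC0, fun hs hl x => ?_⟩
    match hs, hl with
    | h :: hs, hl =>
      have hd := hasFDerivAt_iterDiff Φ (h1.differentiable (by simp)) hs
      have := Convex.norm_image_sub_le_of_norm_fderiv_le (𝕜 := ℝ) (f := iterDiff hs Φ)
        (C := C * (hs.map norm).prod) (s := Set.univ) (x := x) (y := x + h)
        (fun y _ => (hd y).differentiableAt)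
        (fun y _ => by rw [(hd y).fderiv]; exact hC hs (by simpa using hl) y) convex_univ
        (Set.mem_univ _) (Set.mem_univ _)
      rw [iterDiff_cons]
      refine this.trans (le_of_eq ?_)
      simp only [add_sub_cancel_left, List.map_cons, List.prod_cons]
      ring

open scoped Pointwise

variable {E : Type} [NormedAddCommGroup E] [NormedSpace ℝ E] [FiniteDimensional ℝ E]

lemma exists_card_lattice_ball_le (L : Submodule ℤ E) [DiscreteTopology L] [IsZLattice ℝ L] :
    ∃ C : ℝ, 0 ≤ C ∧ ∀ (R : ℝ) (x : E), 1 ≤ R → ∃ s : Finset L,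
      (∀ l : L, ‖x + l‖ ≤ R → l ∈ s) ∧ (s.card : ℝ) ≤ C * R ^ Module.finrank ℝ E := by
  classical
  have := ZLattice.module_free ℝ L
  have := ZLattice.module_finite ℝ L
  let b₀ := Module.Free.chooseBasis ℤ L
  let b := b₀.ofZLatticeBasis ℝ L
  obtain ⟨c, hc0, hc⟩ : ∃ c : ℝ, 0 ≤ c ∧ ∀ i x, |b.repr x i| ≤ c * ‖x‖ := by
    refine ⟨‖(b.equivFunL : E →L[ℝ] (Module.Free.ChooseBasisIndex ℤ L → ℝ))‖, norm_nonneg _,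
      fun i x => ?_⟩
    have := (norm_le_pi_norm (b.equivFunL x) i).trans
      ((b.equivFunL : E →L[ℝ] (Module.Free.ChooseBasisIndex ℤ L → ℝ)).le_opNorm x)
    simpa using this
  have hcard : Fintype.card (Module.Free.ChooseBasisIndex ℤ L) = Module.finrank ℝ E := by
    rw [Module.finrank_eq_card_basis b]
  refine ⟨(2 * c + 1) ^ Module.finrank ℝ E, by positivity, fun R x hR => ?_⟩
  let I : Module.Free.ChooseBasisIndex ℤ L → Finset ℤ := fun i =>
    Finset.Icc ⌈-(b.repr x i) - c * R⌉ ⌊-(b.repr x i) + c * R⌋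
  let s : Finset L := (Fintype.piFinset I).image (fun n => b₀.equivFun.symm n)
  refine ⟨s, fun l hl => ?_, ?_⟩
  · refine Finset.mem_image.2 ⟨b₀.equivFun l, ?_, by simp⟩
    rw [Fintype.mem_piFinset]
    intro i
    have h1 : b.repr (l : E) i = (b₀.repr l i : ℤ) := b₀.ofZLatticeBasis_repr_apply ℝ L l i
    have h2 := (hc i (x + l)).trans (mul_le_mul_of_nonneg_left hl hc0)
    rw [map_add, Finsupp.add_apply, h1, abs_le] at h2
    simp only [I, Finset.mem_Icc, Int.ceil_le, Int.le_floor, Module.Basis.equivFun_apply]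
    constructor <;> linarith [h2.1, h2.2]
  · calc (s.card : ℝ) ≤ ((Fintype.piFinset I).card : ℝ) := by exact_mod_cast Finset.card_image_le
      _ = ∏ i, ((I i).card : ℝ) := by rw [Fintype.card_piFinset]; push_cast; rfl
      _ ≤ ∏ i : Module.Free.ChooseBasisIndex ℤ L, ((2 * c + 1) * R) := by
        refine Finset.prod_le_prod (fun _ _ => by positivity) (fun i _ => ?_)
        simp only [I, Int.card_Icc]
        have h3 : ((⌊-(b.repr x i) + c * R⌋ + 1 - ⌈-(b.repr x i) - c * R⌉ : ℤ) : ℝ)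
            ≤ (2 * c + 1) * R := by
          push_cast
          have h4 := Int.floor_le (-(b.repr x i) + c * R)
          have h5 := Int.le_ceil (-(b.repr x i) - c * R)
          linarith
        have h6 : 0 ≤ (2 * c + 1) * R := by positivity
        rcases le_total 0 (⌊-(b.repr x i) + c * R⌋ + 1 - ⌈-(b.repr x i) - c * R⌉) with h | h
        · rw [← Int.toNat_of_nonneg h] at h3
          exact_mod_cast h3
        · rw [Int.toNat_of_nonpos h]; simpa using h6
      _ = _ := by rw [Finset.prod_const, Finset.card_univ, hcard, mul_pow]

lemma finite_lattice_ball (L : Submodule ℤ E) [DiscreteTopology L] [IsZLattice ℝ L] (R : ℝ)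
    (x : E) : {l : L | ‖x + l‖ ≤ R}.Finite := by
  obtain ⟨C, -, hC⟩ := exists_card_lattice_ball_le L
  obtain ⟨s, hs, -⟩ := hC (max R 1) x (le_max_right _ _)
  exact s.finite_toSet.subset fun l hl => hs l (le_trans hl (le_max_left _ _))

/-- The periodization of a function along a lattice, after scaling by `T`. -/
noncomputable def latticePeriodize (L : Submodule ℤ E) (T : ℝ) (Φ : E → ℝ) (v : E) : ℝ :=
  ∑' l : L, Φ (T⁻¹ • (v + l))

variable (L : Submodule ℤ E) [DiscreteTopology L] [IsZLattice ℝ L]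

lemma finite_support_periodize {T : ℝ} (hT : 0 < T) {Φ : E → ℝ} {R : ℝ}
    (hΦ : ∀ x, R < ‖x‖ → Φ x = 0) (v : E) :
    (Function.support fun l : L => Φ (T⁻¹ • (v + l))).Finite := by
  refine (finite_lattice_ball L (T * R) v).subset fun l hl => ?_
  by_contra h
  apply hl
  apply hΦ
  rw [norm_smul, Real.norm_of_nonneg (by positivity), lt_inv_mul_iff₀ hT]
  simpa using h

lemma iterDiff_latticePeriodize {T : ℝ} (hT : 0 < T) {Φ : E → ℝ} {R : ℝ}
    (hΦ : ∀ x, R < ‖x‖ → Φ x = 0) (hs : List E) : ∀ v,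
    iterDiff hs (latticePeriodize L T Φ) v =
      latticePeriodize L T (iterDiff (hs.map (T⁻¹ • ·)) Φ) v := by
  induction hs with
  | nil => intro v; rfl
  | cons h hs ih =>
    intro v
    rw [iterDiff_cons, ih, ih, latticePeriodize, latticePeriodize, latticePeriodize,
      ← Summable.tsum_sub]
    · congr 1; ext l
      rw [List.map_cons, iterDiff_cons, ← smul_add, add_right_comm]
    · exact summable_of_hasFiniteSupport (finite_support_periodize L hT
        (iterDiff_eq_zero_of_norm Φ R hΦ _) _)
    · exact summable_of_hasFiniteSupport (finite_support_periodize L hT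
        (iterDiff_eq_zero_of_norm Φ R hΦ _) _)

lemma continuous_latticePeriodize {T : ℝ} (hT : 0 < T) {Φ : E → ℝ} {R : ℝ}
    (hΦ : ∀ x, R < ‖x‖ → Φ x = 0) (hc : Continuous Φ) :
    Continuous (latticePeriodize L T Φ) := by
  have h1 : latticePeriodize L T Φ = fun v => ∑ᶠ l : L, Φ (T⁻¹ • (v + l)) := by
    ext v
    exact tsum_eq_finsum (finite_support_periodize L hT hΦ v)
  rw [h1]
  refine continuous_finsum (fun l => by fun_prop) fun x => ?_
  refine ⟨Metric.ball x 1, Metric.ball_mem_nhds x one_pos,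
    (finite_lattice_ball L (T * R + 1) x).subset ?_⟩
  rintro l ⟨y, hy, hyx⟩
  by_contra h
  apply hy
  apply hΦ
  rw [norm_smul, Real.norm_of_nonneg (by positivity), lt_inv_mul_iff₀ hT]
  simp only [Set.mem_ofPred_eq, not_le] at h
  rw [mem_ball_iff_norm] at hyx
  have := norm_sub_norm_le (x + (l : E)) (y + l)
  rw [add_sub_add_right_eq_sub, norm_sub_rev] at this
  linarith

variable [MeasurableSpace E] [BorelSpace E] (μ : Measure E) [μ.IsAddHaarMeasure]

lemma vaddInvariantMeasure_lattice (L : Submodule ℤ E) : VAddInvariantMeasure L E μ :=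
  inferInstanceAs (VAddInvariantMeasure L.toAddSubgroup E μ)

/-- A function periodic along a lattice, with mean zero, is bounded by its iterated differences. -/
lemma abs_le_of_iterDiff {D : Set E} (hD : IsAddFundamentalDomain L D μ)
    (hDb : Bornology.IsBounded D) (hDm : μ.real D ≠ 0) (B : ℝ) (K : ℕ) :
    ∀ S : E → ℝ, Continuous S → (∀ (l : L) x, S (l + x) = S x) → ∫ x in D, S x ∂μ = 0 →
      (∀ hs : List E, hs.length = K → (∀ h ∈ hs, h ∈ D) → ∀ x, |iterDiff hs S x| ≤ B) →
      ∀ x, |S x| ≤ B := by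
  have := vaddInvariantMeasure_lattice μ L
  have hDfin : μ D < ⊤ := hDb.measure_lt_top
  have hint : ∀ S : E → ℝ, Continuous S → IntegrableOn S D μ := fun S hS => by
    have := hDb.isCompact_closure
    exact (hS.continuousOn.integrableOn_compact this).mono_set subset_closure
  have htrans : ∀ S : E → ℝ, (∀ (l : L) x, S (l + x) = S x) → ∀ y,
      ∫ x in D, S (y + x) ∂μ = ∫ x in D, S x ∂μ := by
    intro S hS y
    have h1 : IsAddFundamentalDomain L (y +ᵥ D) μ := hD.vadd_of_comm y
    rw [← h1.setIntegral_eq hD (f := S) hS]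
    have h2 := (measurePreserving_add_left μ y).setIntegral_preimage_emb
      (measurableEmbedding_addLeft y) S (y +ᵥ D)
    rw [← h2]
    congr 2
    ext z
    simp [Set.mem_vadd_set_iff_neg_vadd_mem]
  induction K with
  | zero => intro S _ _ _ h x; simpa [iterDiff] using h [] rfl (by simp) x
  | succ K ih =>
    intro S hc hp h0 hB x
    have key : ∀ h ∈ D, |S (x + h) - S x| ≤ B := by
      intro h hh
      refine ih (fun x => S (x + h) - S x) (by fun_prop) (fun l y => ?_) ?_ ?_ x
      · rw [add_assoc, hp, hp]
      · have hcomm : (fun x => S (x + h)) = fun x => S (h + x) := by ext; rw [add_comm]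
        rw [integral_sub (hint _ (by fun_prop)) (hint _ hc), hcomm, htrans S hp, sub_self]
      · intro hs hl hm y
        have : iterDiff hs (fun x => S (x + h) - S x) = iterDiff (hs ++ [h]) S := by
          simp only [iterDiff, List.foldr_append]; rfl
        rw [this]
        refine hB _ (by simp [hl]) ?_ y
        intro h' hh'
        rcases List.mem_append.1 hh' with h1 | h1
        · exact hm _ h1
        · simp at h1; rwa [h1]
    have h1 : ∫ h in D, (S (x + h) - S x) ∂μ = -(μ.real D * S x) := by
      rw [integral_sub (hint _ (by fun_prop)) (hint _ (by fun_prop)), htrans S hp, h0]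
      simp
    have h2 : ‖∫ h in D, (S (x + h) - S x) ∂μ‖ ≤ B * μ.real D :=
      norm_setIntegral_le_of_norm_le_const_ae' hDfin (Filter.Eventually.of_forall key)
    rw [h1, norm_neg, norm_mul, mul_comm, Real.norm_eq_abs, Real.norm_eq_abs,
      abs_of_nonneg measureReal_nonneg] at h2
    exact le_of_mul_le_mul_right h2 (lt_of_le_of_ne measureReal_nonneg hDm.symm)

/-- Sums of a smooth compactly supported function over the translates of a scaled lattice are
very close to the corresponding integral. -/
theorem exists_latticePeriodize_sub_integral_le (Φ : E → ℝ) (hΦ : ContDiff ℝ ∞ Φ)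
    (hΦc : HasCompactSupport Φ) (K : ℕ) :
    ∃ C : ℝ, ∀ T : ℝ, 1 ≤ T → ∀ v : E,
      |latticePeriodize L T Φ v -
        T ^ Module.finrank ℝ E * (∫ x, Φ x ∂μ) / ZLattice.covolume L μ| ≤
      C * (T ^ Module.finrank ℝ E / T ^ (K + 1)) := by
  classical
  have := ZLattice.module_free ℝ L
  have := ZLattice.module_finite ℝ L
  let b := (Module.Free.chooseBasis ℤ L).ofZLatticeBasis ℝ L
  have := vaddInvariantMeasure_lattice μ L
  let D := ZSpan.fundamentalDomain b
  have hD : IsAddFundamentalDomain L D μ :=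
    ZLattice.isAddFundamentalDomain (Module.Free.chooseBasis ℤ L) μ
  have hDb : Bornology.IsBounded D := ZSpan.fundamentalDomain_isBounded b
  have hcov : ZLattice.covolume L μ = μ.real D :=
    ZLattice.covolume_eq_measure_fundamentalDomain L μ hD
  have hDm : μ.real D ≠ 0 := hcov ▸ ZLattice.covolume_ne_zero L μ
  have hint : ∀ S : E → ℝ, Continuous S → IntegrableOn S D μ := fun S hS => by
    have := hDb.isCompact_closure
    exact (hS.continuousOn.integrableOn_compact this).mono_set subset_closure
  obtain ⟨R, hR⟩ : ∃ R : ℝ, ∀ x, R < ‖x‖ → Φ x = 0 := by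
    obtain ⟨R, hR⟩ := hΦc.isCompact.isBounded.exists_norm_le
    refine ⟨R, fun x hx => ?_⟩
    by_contra h
    exact absurd (hR x (subset_tsupport _ h)) (not_le.2 hx)
  obtain ⟨ρ, hρ⟩ := hDb.exists_norm_le
  obtain ⟨C₁, hC₁0, hC₁⟩ := norm_iterDiff_le (K + 1) Φ hΦ hΦc
  obtain ⟨C₂, hC₂0, hC₂⟩ := exists_card_lattice_ball_le L
  set d := Module.finrank ℝ E
  set R' : ℝ := max 1 (R + (K + 1) * |ρ|) with hR'
  refine ⟨C₂ * R' ^ d * (C₁ * |ρ| ^ (K + 1)), fun T hT v => ?_⟩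
  have hT0 : 0 < T := by linarith
  have hcont := continuous_latticePeriodize L hT0 hR hΦ.continuous
  set m := T ^ d * (∫ x, Φ x ∂μ) / ZLattice.covolume L μ with hm
  have hmean : ∫ x in D, latticePeriodize L T Φ x ∂μ = T ^ d * ∫ x, Φ x ∂μ := by
    have h1 := Measure.integral_comp_inv_smul μ Φ T
    rw [abs_of_nonneg (by positivity), smul_eq_mul] at h1
    have hcs : HasCompactSupport fun x : E => Φ (T⁻¹ • x) :=
      hΦc.comp_smul (inv_ne_zero hT0.ne')
    have hinte : Integrable (fun x : E => Φ (T⁻¹ • x)) μ :=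
      (hΦ.continuous.comp (continuous_const_smul _)).integrable_of_hasCompactSupport hcs
    rw [← h1, hD.integral_eq_tsum'' _ hinte]
    simp only [latticePeriodize]
    rw [integral_tsum_of_summable_integral_norm]
    · congr 1; ext l; congr 1; ext x; rw [add_comm]; rfl
    · intro l; exact hint _ (hΦ.continuous.comp (by fun_prop))
    · refine summable_of_hasFiniteSupport ((finite_lattice_ball L (T * R + |ρ|) 0).subset ?_)
      intro l hl
      by_contra h
      apply hl
      simp only [Set.mem_ofPred_eq, not_le, zero_add] at h
      refine setIntegral_eq_zero_of_forall_eq_zero fun x hx => ?_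
      rw [norm_eq_zero]
      apply hR
      rw [norm_smul, Real.norm_of_nonneg (by positivity), lt_inv_mul_iff₀ hT0]
      change T * R < ‖(l : E) + x‖
      rw [add_comm]
      have h1 := norm_sub_norm_le (l : E) (-x)
      rw [sub_neg_eq_add, norm_neg, add_comm (l : E)] at h1
      have h2 := (hρ x hx).trans (le_abs_self ρ)
      linarith
  refine abs_le_of_iterDiff L μ hD hDb hDm _ (K + 1) (fun x => latticePeriodize L T Φ x - m)
    (by fun_prop) (fun l x => ?_) ?_ ?_ v
  · congr 1
    simp only [latticePeriodize]
    rw [← (Equiv.addLeft l).tsum_eq (fun l' : L => Φ (T⁻¹ • (x + l')))]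
    congr 1; ext l'
    simp only [Equiv.coe_addLeft, Submodule.coe_add]
    congr 2; abel
  · have := integral_sub (hint _ hcont) (hint _ (continuous_const (y := m)))
    rw [this, hmean, setIntegral_const, smul_eq_mul, hm, hcov]
    field_simp
    ring
  · intro hs hl hmem x
    have e1 : iterDiff hs (fun x => latticePeriodize L T Φ x - m) x =
        iterDiff hs (latticePeriodize L T Φ) x := by
      match hs, hl with
      | h :: hs, _ =>
        have : ∀ (hs : List E) (h x : E),
            iterDiff (h :: hs) (fun x => latticePeriodize L T Φ x - m) x
            = iterDiff (h :: hs) (latticePeriodize L T Φ) x := by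
          intro hs
          induction hs with
          | nil => intro h x; simp [iterDiff, fwdDiff]
          | cons h' hs ih => intro h x; rw [iterDiff_cons, ih, ih]; rfl
        exact this hs h x
    rw [e1, iterDiff_latticePeriodize L hT0 hR]
    have hsum : ((hs.map (T⁻¹ • ·)).map norm).sum ≤ (K + 1) * |ρ| := by
      have : ∀ t ∈ ((hs.map (T⁻¹ • ·)).map norm), t ≤ |ρ| := by
        intro t ht
        simp only [List.map_map, List.mem_map, Function.comp] at ht
        obtain ⟨h, hh, rfl⟩ := ht
        rw [norm_smul, Real.norm_of_nonneg (by positivity)]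
        have h1 := (hρ h (hmem h hh)).trans (le_abs_self ρ)
        have h2 : T⁻¹ ≤ 1 := inv_le_one_of_one_le₀ hT
        nlinarith [norm_nonneg h, inv_pos.2 hT0]
      have h3 := List.sum_le_card_nsmul _ _ this
      simpa [hl] using h3
    have hprod : ((hs.map (T⁻¹ • ·)).map norm).prod ≤ (T⁻¹) ^ (K + 1) * |ρ| ^ (K + 1) := by
      rw [← hl]
      clear hl e1 hsum
      induction hs with
      | nil => simp
      | cons h hs ih =>
        simp only [List.map_cons, List.prod_cons, List.length_cons]
        rw [norm_smul, Real.norm_of_nonneg (by positivity), pow_succ', pow_succ']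
        have h1 := (hρ h (hmem h (by simp))).trans (le_abs_self ρ)
        have h2 := ih (fun h' hh' => hmem h' (by simp [hh']))
        calc T⁻¹ * ‖h‖ * ((hs.map (T⁻¹ • ·)).map norm).prod
            ≤ T⁻¹ * |ρ| * (T⁻¹ ^ hs.length * |ρ| ^ hs.length) := by
              apply mul_le_mul _ h2 _ (by positivity)
              · gcongr
              · apply List.prod_nonneg; intro t ht; simp only [List.map_map, List.mem_map] at ht
                obtain ⟨_, _, rfl⟩ := ht; exact norm_nonneg _
          _ = _ := by ring
    obtain ⟨s, hs1, hs2⟩ := hC₂ (T * R') x (by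
      have : 1 ≤ R' := le_max_left _ _
      nlinarith)
    rw [latticePeriodize, tsum_eq_sum (s := s)]
    · refine (Finset.abs_sum_le_sum_abs _ _).trans ?_
      calc ∑ l ∈ s, |iterDiff (hs.map (T⁻¹ • ·)) Φ (T⁻¹ • (x + l))|
          ≤ ∑ l ∈ s, C₁ * ((T⁻¹) ^ (K + 1) * |ρ| ^ (K + 1)) := by
            refine Finset.sum_le_sum fun l _ => (hC₁ _ (by simp [hl]) _).trans ?_
            gcongr
        _ = s.card * (C₁ * ((T⁻¹) ^ (K + 1) * |ρ| ^ (K + 1))) := by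
            rw [Finset.sum_const, nsmul_eq_mul]
        _ ≤ (C₂ * (T * R') ^ d) * (C₁ * ((T⁻¹) ^ (K + 1) * |ρ| ^ (K + 1))) := by gcongr
        _ = _ := by rw [inv_pow]; field_simp; ring
    · intro l hl'
      refine iterDiff_eq_zero_of_norm Φ R hR _ _ ?_
      have h1 : T * R' < ‖x + l‖ := by
        by_contra h; exact hl' (hs1 l (not_lt.1 h))
      rw [norm_smul, Real.norm_of_nonneg (by positivity), lt_inv_mul_iff₀ hT0]
      refine lt_of_le_of_lt ?_ h1
      gcongr
      exact (by linarith : _ ≤ R + (K + 1) * |ρ|).trans (le_max_right _ _)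

end LatticeSums

section RayClass

variable (L : Type*) [Field L] [NumberField L] (M : ℕ)

/-- Reduction modulo the integer `M` on the ring of integers. -/
noncomputable abbrev redMod : 𝓞 L →+* 𝓞 L ⧸ Ideal.span {(M : 𝓞 L)} := Ideal.Quotient.mk _

/-- The ideals coprime to the integer `M`. -/
def coprimeIdeals : Submonoid (Ideal (𝓞 L)) where
  carrier := {a | IsCoprime a (Ideal.span {(M : 𝓞 L)})}
  mul_mem' := IsCoprime.mul_left
  one_mem' := isCoprime_one_left

variable {L M}

lemma span_natCast_ne_top [M.AtLeastTwo] : Ideal.span {(M : 𝓞 L)} ≠ ⊤ := by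
  intro h
  have h1 := Ideal.absNorm_eq_one_iff.2 h
  rw [Ideal.absNorm_span_natCast, Nat.pow_eq_one] at h1
  have := Nat.AtLeastTwo.prop (n := M)
  have := Module.finrank_pos (R := ℤ) (M := 𝓞 L)
  omega

lemma redMod_ne_zero_of_isUnit [M.AtLeastTwo] {α : 𝓞 L} (h : IsUnit (redMod L M α)) : α ≠ 0 := by
  rintro rfl
  have := Ideal.Quotient.nontrivial_iff.2 (span_natCast_ne_top (L := L) (M := M))
  rw [map_zero] at h
  exact not_isUnit_zero h

lemma ne_zero_of_redMod_eq_one [M.AtLeastTwo] {α : 𝓞 L} (h : redMod L M α = 1) : α ≠ 0 :=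
  redMod_ne_zero_of_isUnit (h ▸ isUnit_one)

lemma mem_coprimeIdeals_iff {L : Type*} [Field L] {M : ℕ} {a : Ideal (𝓞 L)} :
    a ∈ coprimeIdeals L M ↔ ∃ γ ∈ a, redMod L M γ = 1 := by
  change IsCoprime _ _ ↔ _
  rw [Ideal.isCoprime_iff_exists]
  constructor
  · rintro ⟨i, hi, j, hj, h⟩
    refine ⟨i, hi, ?_⟩
    rw [← map_one (redMod L M), Ideal.Quotient.eq, ← h, sub_add_cancel_left]
    exact neg_mem hj
  · rintro ⟨γ, hγ, h⟩
    rw [← map_one (redMod L M), Ideal.Quotient.eq] at h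
    exact ⟨γ, hγ, 1 - γ, by rw [← neg_sub]; exact neg_mem h, by ring⟩

lemma coprimeIdeals_ne_bot [M.AtLeastTwo] (a : coprimeIdeals L M) : (a : Ideal (𝓞 L)) ≠ ⊥ := by
  intro h
  obtain ⟨γ, hγ, h1⟩ := mem_coprimeIdeals_iff.1 a.2
  rw [h, Ideal.mem_bot] at hγ
  exact ne_zero_of_redMod_eq_one h1 hγ

lemma span_mem_coprimeIdeals_iff {L : Type*} [Field L] {M : ℕ} {α : 𝓞 L} :
    Ideal.span {α} ∈ coprimeIdeals L M ↔ IsUnit (redMod L M α) := by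
  rw [mem_coprimeIdeals_iff]
  constructor
  · rintro ⟨γ, hγ, h⟩
    obtain ⟨δ, rfl⟩ := Ideal.mem_span_singleton'.1 hγ
    rw [map_mul] at h
    exact IsUnit.of_mul_eq_one_right _ h
  · intro h
    obtain ⟨β, hβ⟩ := h.exists_left_inv
    obtain ⟨δ, rfl⟩ := Ideal.Quotient.mk_surjective β
    exact ⟨δ * α, Ideal.mul_mem_left _ _ (Ideal.mem_span_singleton_self _), by rwa [map_mul]⟩

lemma mem_coprimeIdeals_of_mul {L : Type*} [Field L] {M : ℕ} {a b : Ideal (𝓞 L)}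
    (h : a * b ∈ coprimeIdeals L M) :
    a ∈ coprimeIdeals L M := by
  rw [mem_coprimeIdeals_iff] at h ⊢
  obtain ⟨γ, hγ, h1⟩ := h
  exact ⟨γ, Ideal.mul_le_left (I := a) (J := b) hγ, h1⟩

lemma exists_mul_eq_span (a : coprimeIdeals L M) :
    ∃ (c : coprimeIdeals L M) (γ : 𝓞 L), redMod L M γ = 1 ∧
      (a * c : Ideal (𝓞 L)) = Ideal.span {γ} := by
  obtain ⟨γ, hγ, h1⟩ := mem_coprimeIdeals_iff.1 a.2
  obtain ⟨c, hc⟩ := Ideal.dvd_iff_le.2 ((Ideal.span_singleton_le_iff_mem _).2 hγ)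
  refine ⟨⟨c, ?_⟩, γ, h1, hc.symm⟩
  have h2 : Ideal.span {γ} ∈ coprimeIdeals L M := by
    rw [span_mem_coprimeIdeals_iff, h1]; exact isUnit_one
  rw [hc, mul_comm] at h2
  exact mem_coprimeIdeals_of_mul h2

variable (L M)

/-- The congruence on the ideals coprime to `M` whose classes are the ray classes modulo `M`
(without conditions at the infinite places). -/
def rayCon : Con (coprimeIdeals L M) where
  r a b := ∃ α β : 𝓞 L, α ≠ 0 ∧ β ≠ 0 ∧ redMod L M α = 1 ∧ redMod L M β = 1 ∧
    Ideal.span {α} * (a : Ideal (𝓞 L)) = Ideal.span {β} * b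
  iseqv :=
    { refl := fun a => ⟨1, 1, one_ne_zero, one_ne_zero, map_one _, map_one _, rfl⟩
      symm := fun ⟨α, β, hα, hβ, hα1, hβ1, h⟩ => ⟨β, α, hβ, hα, hβ1, hα1, h.symm⟩
      trans := by
        rintro a b c ⟨α, β, hα, hβ, hα1, hβ1, h⟩ ⟨α', β', hα', hβ', hα1', hβ1', h'⟩
        refine ⟨α' * α, β * β', mul_ne_zero hα' hα, mul_ne_zero hβ hβ', by simp [hα1, hα1'],
          by simp [hβ1, hβ1'], ?_⟩
        rw [← Ideal.span_singleton_mul_span_singleton, ← Ideal.span_singleton_mul_span_singleton,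
          mul_assoc, h, mul_left_comm, h', mul_assoc] }
  mul' := by
    rintro a b c d ⟨α, β, hα, hβ, hα1, hβ1, h⟩ ⟨α', β', hα', hβ', hα1', hβ1', h'⟩
    refine ⟨α * α', β * β', mul_ne_zero hα hα', mul_ne_zero hβ hβ', by simp [hα1, hα1'],
      by simp [hβ1, hβ1'], ?_⟩
    rw [← Ideal.span_singleton_mul_span_singleton, ← Ideal.span_singleton_mul_span_singleton,
      Submonoid.coe_mul, Submonoid.coe_mul, mul_mul_mul_comm, h, h', mul_mul_mul_comm]

/-- The ray class group modulo the integer `M`, without conditions at the infinite places. -/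
abbrev RayClassGroup : Type _ := (rayCon L M).Quotient

variable {L M}

/-- The ray class of an ideal coprime to `M`. -/
def rayClass : coprimeIdeals L M →* RayClassGroup L M := (rayCon L M).mk'

lemma rayClass_surjective : Function.Surjective (rayClass (L := L) (M := M)) := Con.mk'_surjective

lemma rayClass_eq_iff {a b : coprimeIdeals L M} : rayClass a = rayClass b ↔
    ∃ α β : 𝓞 L, α ≠ 0 ∧ β ≠ 0 ∧ redMod L M α = 1 ∧ redMod L M β = 1 ∧
      Ideal.span {α} * (a : Ideal (𝓞 L)) = Ideal.span {β} * b :=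
  (rayCon L M).eq

variable [M.AtLeastTwo]

lemma rayClass_eq_one_iff {a : coprimeIdeals L M} :
    rayClass a = 1 ↔ ∃ γ, redMod L M γ = 1 ∧ (a : Ideal (𝓞 L)) = Ideal.span {γ} := by
  rw [← map_one rayClass, rayClass_eq_iff]
  constructor
  · rintro ⟨α, β, hα, hβ, hα1, hβ1, h⟩
    rw [Submonoid.coe_one, mul_one] at h
    have h1 : β ∈ Ideal.span {α} := by
      have h2 : Ideal.span {α} * (a : Ideal (𝓞 L)) ≤ Ideal.span {α} := Ideal.mul_le_left
      refine h2 ?_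
      rw [h]; exact Ideal.mem_span_singleton_self _
    obtain ⟨γ, rfl⟩ := Ideal.mem_span_singleton.1 h1
    refine ⟨γ, by simpa [hα1] using hβ1, ?_⟩
    rw [← Ideal.span_singleton_mul_span_singleton] at h
    exact mul_left_cancel₀ (by simpa using hα) h
  · rintro ⟨γ, h1, h⟩
    refine ⟨1, γ, one_ne_zero, ne_zero_of_redMod_eq_one h1, map_one _, h1, ?_⟩
    rw [h, Submonoid.coe_one, mul_one, Ideal.span_singleton_one]
    exact Ideal.top_mul _

lemma exists_rayClass_mul_eq_one (a : coprimeIdeals L M) : ∃ c, rayClass a * rayClass c = 1 := by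
  obtain ⟨c, γ, h1, h⟩ := exists_mul_eq_span a
  exact ⟨c, by rw [← map_mul]; exact rayClass_eq_one_iff.2 ⟨γ, h1, h⟩⟩

noncomputable instance : CommGroup (RayClassGroup L M) :=
  { (inferInstance : CommMonoid (RayClassGroup L M)),
    commGroupOfIsUnit fun a => by
      obtain ⟨a, rfl⟩ := rayClass_surjective a
      obtain ⟨c, hc⟩ := exists_rayClass_mul_eq_one a
      exact IsUnit.of_mul_eq_one _ hc with }

open nonZeroDivisors in
instance : Finite (RayClassGroup L M) := by
  have hM : (M : 𝓞 L) ≠ 0 := by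
    have := Nat.AtLeastTwo.prop (n := M)
    exact_mod_cast (by omega : M ≠ 0)
  have : Finite (𝓞 L ⧸ Ideal.span {(M : 𝓞 L)}) :=
    Ideal.finiteQuotientOfFreeOfNeBot _ (by simpa using hM)
  let cl : coprimeIdeals L M → ClassGroup (𝓞 L) := fun a =>
    ClassGroup.mk0 ⟨a, mem_nonZeroDivisors_of_ne_zero (coprimeIdeals_ne_bot a)⟩
  have h1 : ∀ C : ClassGroup (𝓞 L), ∃ b : coprimeIdeals L M, ∀ a, cl a = C →
      ∃ α : 𝓞 L, (a * b : Ideal (𝓞 L)) = Ideal.span {α} := by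
    intro C
    by_cases hC : ∃ a₀, cl a₀ = C
    · obtain ⟨a₀, rfl⟩ := hC
      obtain ⟨b, γ, -, hb⟩ := exists_mul_eq_span a₀
      refine ⟨b, fun a ha => ?_⟩
      have hm : (a * b : Ideal (𝓞 L)) ∈ (Ideal (𝓞 L))⁰ := mem_nonZeroDivisors_of_ne_zero
        (mul_ne_zero (coprimeIdeals_ne_bot a) (coprimeIdeals_ne_bot b))
      have hm' : (a₀ * b : Ideal (𝓞 L)) ∈ (Ideal (𝓞 L))⁰ := mem_nonZeroDivisors_of_ne_zero
        (mul_ne_zero (coprimeIdeals_ne_bot a₀) (coprimeIdeals_ne_bot b))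
      have h2 : ClassGroup.mk0 ⟨(a * b : Ideal (𝓞 L)), hm⟩ = 1 := by
        have e1 : ClassGroup.mk0 ⟨(a * b : Ideal (𝓞 L)), hm⟩ = cl a * cl b := by
          rw [← map_mul]; rfl
        have e2 : ClassGroup.mk0 ⟨(a₀ * b : Ideal (𝓞 L)), hm'⟩ = cl a₀ * cl b := by
          rw [← map_mul]; rfl
        rw [e1, ha, ← e2, ClassGroup.mk0_eq_one_iff, hb]
        exact ⟨⟨γ, rfl⟩⟩
      obtain ⟨⟨α, hα⟩⟩ := (ClassGroup.mk0_eq_one_iff hm).1 h2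
      exact ⟨α, hα⟩
    · exact ⟨1, fun a ha => (hC ⟨a, ha⟩).elim⟩
  choose b hb using h1
  choose α hα using fun a => hb _ a rfl
  have hsurj := rayClass_surjective (L := L) (M := M)
  refine Finite.of_injective (fun g => (cl (Function.surjInv hsurj g),
    redMod L M (α (Function.surjInv hsurj g)))) fun g g' hgg' => ?_
  obtain ⟨hc, hr⟩ := Prod.ext_iff.1 hgg'
  dsimp only at hc hr
  rw [← Function.surjInv_eq hsurj g, ← Function.surjInv_eq hsurj g', rayClass_eq_iff]
  set a := Function.surjInv hsurj g
  set a' := Function.surjInv hsurj g'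
  have h2 := hα a
  have h3 := hα a'
  rw [← hc] at h3
  have h4 : IsUnit (redMod L M (α a)) := by
    rw [← span_mem_coprimeIdeals_iff, ← h2]
    exact mul_mem a.2 (b _).2
  obtain ⟨β, hβ⟩ := h4.exists_left_inv
  obtain ⟨δ, rfl⟩ := Ideal.Quotient.mk_surjective β
  have e1 : redMod L M (δ * α a) = 1 := by rw [map_mul]; exact hβ
  have e2 : redMod L M (δ * α a') = 1 := by rw [map_mul, ← hr]; exact hβ
  refine ⟨δ * α a', δ * α a, ne_zero_of_redMod_eq_one e2, ne_zero_of_redMod_eq_one e1, e2, e1, ?_⟩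
  refine mul_right_cancel₀ (coprimeIdeals_ne_bot (b (cl a))) ?_
  rw [mul_assoc, mul_assoc, h2, h3]
  simp only [Ideal.span_singleton_mul_span_singleton]
  congr 2
  ring

end RayClass

section IdealVonMangoldt

open UniqueFactorizationMonoid

variable {L : Type*} [Field L] [NumberField L]

open Classical in
/-- The von Mangoldt function on ideals. -/
noncomputable def idealVonMangoldt (a : Ideal (𝓞 L)) : ℝ :=
  if h : IsPrimePow a then Real.log (Ideal.absNorm h.choose) else 0

lemma idealVonMangoldt_pow {p : Ideal (𝓞 L)} (hp : Prime p) {k : ℕ} (hk : 0 < k) :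
    idealVonMangoldt (p ^ k) = Real.log (Ideal.absNorm p) := by
  have h : IsPrimePow (p ^ k) := ⟨p, k, hp, hk, rfl⟩
  rw [idealVonMangoldt, dif_pos h]
  obtain ⟨l, hq, hl, e⟩ := h.choose_spec
  rw [eq_of_prime_pow_eq hq hp hl e]

lemma idealVonMangoldt_nonneg (a : Ideal (𝓞 L)) : 0 ≤ idealVonMangoldt a := by
  rw [idealVonMangoldt]
  split_ifs
  · exact Real.log_natCast_nonneg _
  · exact le_rfl

lemma sum_idealVonMangoldt {a : Ideal (𝓞 L)} (ha : a ≠ ⊥) {D : Finset (Ideal (𝓞 L))}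
    (hD : ∀ b, b ∈ D ↔ b ∣ a) : ∑ b ∈ D, idealVonMangoldt b = Real.log (Ideal.absNorm a) := by
  classical
  set F := normalizedFactors a with hF
  have hprime : ∀ p ∈ F, Prime p := fun p hp => prime_of_normalized_factor p hp
  have hdvd : ∀ p k, Prime p → (p ^ k ∣ a ↔ k ≤ F.count p) := by
    intro p k hp
    rw [dvd_iff_normalizedFactors_le_normalizedFactors (pow_ne_zero _ hp.ne_zero) ha,
      normalizedFactors_pow, normalizedFactors_irreducible hp.irreducible, normalize_eq,
      Multiset.nsmul_singleton, Multiset.le_count_iff_replicate_le]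
  have h1 : ∑ b ∈ D, idealVonMangoldt b =
      ∑ i ∈ F.toFinset.sigma fun p => Finset.Icc 1 (F.count p), idealVonMangoldt (i.1 ^ i.2) := by
    rw [← Finset.sum_image (f := idealVonMangoldt)
      (g := fun i : (_ : Ideal (𝓞 L)) × ℕ => i.1 ^ i.2)]
    · symm
      refine Finset.sum_subset ?_ ?_
      · intro b hb
        obtain ⟨⟨p, k⟩, hi, rfl⟩ := Finset.mem_image.1 hb
        simp only [Finset.mem_sigma, Multiset.mem_toFinset, Finset.mem_Icc] at hi
        exact (hD _).2 ((hdvd p k (hprime p hi.1)).2 hi.2.2)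
      · intro b hb hb'
        rw [idealVonMangoldt, dif_neg]
        rintro ⟨p, k, hp, hk, rfl⟩
        have h2 := (hdvd p k hp).1 ((hD _).1 hb)
        refine hb' (Finset.mem_image.2 ⟨⟨p, k⟩, ?_, rfl⟩)
        simp only [Finset.mem_sigma, Multiset.mem_toFinset, Finset.mem_Icc]
        exact ⟨Multiset.count_pos.1 (hk.trans_le h2), hk, h2⟩
    · rintro ⟨p, k⟩ hi ⟨q, l⟩ hj h
      simp only [Finset.mem_coe, Finset.mem_sigma, Multiset.mem_toFinset, Finset.mem_Icc] at hi hj h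
      have hp := hprime p hi.1
      obtain rfl := eq_of_prime_pow_eq hp (hprime q hj.1) hi.2.1 h
      have := pow_injective_of_not_isUnit hp.not_isUnit hp.ne_zero h
      rw [this]
  have h2 : ∑ i ∈ F.toFinset.sigma fun p => Finset.Icc 1 (F.count p),
      idealVonMangoldt (i.1 ^ i.2) = ∑ p ∈ F.toFinset, F.count p • Real.log (Ideal.absNorm p) := by
    rw [Finset.sum_sigma]
    refine Finset.sum_congr rfl fun p hp => ?_
    rw [Finset.sum_congr rfl fun k hk =>
      idealVonMangoldt_pow (hprime p (Multiset.mem_toFinset.1 hp))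
      (Finset.mem_Icc.1 hk).1]
    simp
  rw [h1, h2, ← Finset.sum_multiset_map_count]
  have h3 : F.prod = a := by
    rw [← associated_iff_eq]; exact prod_normalizedFactors ha
  rw [← h3]
  have h4 : ∀ s : Multiset (Ideal (𝓞 L)), (∀ p ∈ s, Prime p) →
      (s.map fun p => Real.log (Ideal.absNorm p)).sum = Real.log (Ideal.absNorm s.prod) := by
    intro s
    induction s using Multiset.induction with
    | empty => simp
    | cons p s ih =>
      intro hs
      rw [Multiset.map_cons, Multiset.sum_cons, Multiset.prod_cons, map_mul, Nat.cast_mul,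
        Real.log_mul, ih fun q hq => hs q (Multiset.mem_cons_of_mem hq)]
      · exact_mod_cast (Ideal.absNorm_eq_zero_iff (I := p)).not.2
          (hs p (Multiset.mem_cons_self _ _)).ne_zero
      · have : s.prod ≠ 0 := Multiset.prod_ne_zero fun h =>
          (hs 0 (Multiset.mem_cons_of_mem h)).ne_zero rfl
        exact_mod_cast (Ideal.absNorm_eq_zero_iff (I := s.prod)).not.2 this
  exact h4 F hprime

lemma exists_absNorm_eq_prime_pow {p : Ideal (𝓞 L)} (hp : Prime p) :
    ∃ l f : ℕ, l.Prime ∧ 0 < f ∧ Ideal.absNorm p = l ^ f ∧ p ∣ Ideal.span {(l : 𝓞 L)} := by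
  have hpp : p.IsPrime := Ideal.isPrime_of_prime hp
  have hne : Ideal.absNorm p ≠ 0 := (Ideal.absNorm_eq_zero_iff (I := p)).not.2 hp.ne_zero
  have h1 : ∃ l : ℕ, l.Prime ∧ (l : 𝓞 L) ∈ p := by
    have h0 := Ideal.absNorm_mem p
    rw [← Nat.prod_primeFactorsList hne, Nat.cast_list_prod] at h0
    obtain ⟨x, hx, hxp⟩ := (Ideal.IsPrime.multiset_prod_mem_iff_exists_mem hpp
      (((Ideal.absNorm p).primeFactorsList.map Nat.cast : List (𝓞 L)) : Multiset (𝓞 L))).1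
      (by simpa using h0)
    simp only [Multiset.mem_coe, List.mem_map] at hx
    obtain ⟨l, hl, rfl⟩ := hx
    exact ⟨l, Nat.prime_of_mem_primeFactorsList hl, hxp⟩
  obtain ⟨l, hl, hlp⟩ := h1
  have h2 : p ∣ Ideal.span {(l : 𝓞 L)} :=
    Ideal.dvd_iff_le.2 ((Ideal.span_singleton_le_iff_mem _).2 hlp)
  have h3 := map_dvd Ideal.absNorm h2
  rw [Ideal.absNorm_span_natCast, Nat.dvd_prime_pow hl] at h3
  obtain ⟨f, -, hf⟩ := h3
  refine ⟨l, f, hl, Nat.pos_of_ne_zero ?_, hf, h2⟩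
  rintro rfl
  rw [pow_zero, Ideal.absNorm_eq_one_iff] at hf
  exact hpp.ne_top hf

lemma sum_idealVonMangoldt_le (S : Finset (Ideal (𝓞 L))) (n : ℕ)
    (hS : ∀ b ∈ S, Ideal.absNorm b = n) :
    ∑ b ∈ S, idealVonMangoldt b ≤
      Module.finrank ℤ (𝓞 L) * ArithmeticFunction.vonMangoldt n := by
  classical
  have hnn : 0 ≤ Module.finrank ℤ (𝓞 L) * ArithmeticFunction.vonMangoldt n :=
    mul_nonneg (Nat.cast_nonneg _) ArithmeticFunction.vonMangoldt_nonneg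
  set S' := S.filter IsPrimePow with hS'
  have h1 : ∑ b ∈ S, idealVonMangoldt b = ∑ b ∈ S', idealVonMangoldt b := by
    rw [hS', Finset.sum_filter]
    refine Finset.sum_congr rfl fun b _ => ?_
    split_ifs with h
    · rfl
    · rw [idealVonMangoldt, dif_neg h]
  rw [h1]
  rcases S'.eq_empty_or_nonempty with h0 | ⟨b₀, hb₀⟩
  · rw [h0, Finset.sum_empty]; exact hnn
  obtain ⟨hb₀S, p₀, k₀, hp₀, hk₀, rfl⟩ := Finset.mem_filter.1 hb₀
  obtain ⟨l, f, hl, hf, hlf, hpl⟩ := exists_absNorm_eq_prime_pow hp₀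
  have hn : n = l ^ (f * k₀) := by rw [← hS _ hb₀S, map_pow, hlf, pow_mul]
  have hΛ : ArithmeticFunction.vonMangoldt n = Real.log l := by
    rw [hn, ArithmeticFunction.vonMangoldt_apply_pow (by positivity),
      ArithmeticFunction.vonMangoldt_apply_prime hl]
  have key : ∀ b ∈ S', ∃ p : Ideal (𝓞 L), Prime p ∧ p ∣ Ideal.span {(l : 𝓞 L)} ∧
      ∃ k, 0 < k ∧ p ^ k = b := by
    intro b hb
    obtain ⟨hbS, p, k, hp, hk, rfl⟩ := Finset.mem_filter.1 hb
    obtain ⟨l', f', hl', hf', hlf', hpl'⟩ := exists_absNorm_eq_prime_pow hp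
    have hn' : n = l' ^ (f' * k) := by rw [← hS _ hbS, map_pow, hlf', pow_mul]
    have : l' = l := by
      have h2 : l' ∣ n := hn' ▸ dvd_pow_self _ (by positivity)
      rw [hn] at h2
      exact (Nat.prime_dvd_prime_iff_eq hl' hl).1 (hl'.dvd_of_dvd_pow h2)
    subst this
    exact ⟨p, hp, hpl', k, hk, rfl⟩
  choose! P hP hPl K hK hPK using key
  have hinj : Set.InjOn P S' := by
    intro b hb b' hb' h
    have e1 := hPK b hb
    have e2 := hPK b' hb'
    rw [← h] at e2
    have hN : Ideal.absNorm (P b) ^ K b = Ideal.absNorm (P b) ^ K b' := by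
      rw [← map_pow, ← map_pow, e1, e2, hS b (Finset.mem_filter.1 hb).1,
        hS b' (Finset.mem_filter.1 hb').1]
    obtain ⟨l', f', hl', hf', hlf', -⟩ := exists_absNorm_eq_prime_pow (hP b hb)
    have h2 : 2 ≤ Ideal.absNorm (P b) := by
      rw [hlf']; exact hl'.two_le.trans (Nat.le_self_pow hf'.ne' _)
    have := Nat.pow_right_injective h2 hN
    rw [← e1, ← e2, this]
  have hdvd : ∏ p ∈ S'.image P, p ∣ Ideal.span {(l : 𝓞 L)} := by
    refine Finset.prod_primes_dvd _ ?_ ?_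
    · intro p hp
      obtain ⟨b, hb, rfl⟩ := Finset.mem_image.1 hp
      exact hP b hb
    · intro p hp
      obtain ⟨b, hb, rfl⟩ := Finset.mem_image.1 hp
      exact hPl b hb
  rw [Finset.prod_image hinj] at hdvd
  have h3 := map_dvd Ideal.absNorm hdvd
  rw [Ideal.absNorm_span_natCast, map_prod] at h3
  have h4 := Nat.le_of_dvd (pow_pos hl.pos _) h3
  have hpos : ∀ b ∈ S', 0 < Ideal.absNorm (P b) := fun b hb => Nat.pos_of_ne_zero
    ((Ideal.absNorm_eq_zero_iff (I := P b)).not.2 (hP b hb).ne_zero)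
  calc ∑ b ∈ S', idealVonMangoldt b = ∑ b ∈ S', Real.log (Ideal.absNorm (P b)) := by
        refine Finset.sum_congr rfl fun b hb => ?_
        conv_lhs => rw [← hPK b hb]
        exact idealVonMangoldt_pow (hP b hb) (hK b hb)
    _ = Real.log ((∏ b ∈ S', Ideal.absNorm (P b) : ℕ) : ℝ) := by
        push_cast
        rw [Real.log_prod]
        intro b hb
        exact_mod_cast (hpos b hb).ne'
    _ ≤ Real.log ((l ^ Module.finrank ℤ (𝓞 L) : ℕ) : ℝ) := by
        refine Real.log_le_log ?_ (by exact_mod_cast h4)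
        exact_mod_cast Finset.prod_pos hpos
    _ = _ := by rw [hΛ]; push_cast; rw [Real.log_pow]

end IdealVonMangoldt

section RayCount

variable {L : Type*} [Field L] [NumberField L] {M : ℕ}

lemma finite_setOf_absNorm_coprimeIdeals (n : ℕ) :
    {a : coprimeIdeals L M | Ideal.absNorm (a : Ideal (𝓞 L)) = n}.Finite :=
  (Ideal.finite_setOfPred_absNorm_eq (S := 𝓞 L) n).preimage Subtype.val_injective.injOn

/-- The ideals coprime to `M` of given norm. -/
noncomputable def normFinset (n : ℕ) : Finset (coprimeIdeals L M) :=
  (finite_setOf_absNorm_coprimeIdeals n).toFinset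

@[simp] lemma mem_normFinset {n : ℕ} {a : coprimeIdeals L M} :
    a ∈ normFinset n ↔ Ideal.absNorm (a : Ideal (𝓞 L)) = n := by
  simp [normFinset]

/-- The additive form of the ray class map. -/
def rayClassAdd (a : coprimeIdeals L M) : Additive (RayClassGroup L M) :=
  Additive.ofMul (rayClass a)

lemma rayClassAdd_mul (a b : coprimeIdeals L M) :
    rayClassAdd (a * b) = rayClassAdd a + rayClassAdd b := by
  rw [rayClassAdd, map_mul]; rfl

lemma rayClassAdd_one : rayClassAdd (1 : coprimeIdeals L M) = 0 := by
  rw [rayClassAdd, map_one]; rfl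

lemma normFinset_one : normFinset (L := L) (M := M) 1 = {1} := by
  ext a
  simp only [mem_normFinset, Finset.mem_singleton]
  rw [Ideal.absNorm_eq_one_iff, ← Ideal.one_eq_top, ← Submonoid.coe_one, Subtype.ext_iff]

variable [M.AtLeastTwo]

lemma absNorm_coprimeIdeals_ne_zero (a : coprimeIdeals L M) :
    Ideal.absNorm (a : Ideal (𝓞 L)) ≠ 0 :=
  (Ideal.absNorm_eq_zero_iff (I := (a : Ideal (𝓞 L)))).not.2 (coprimeIdeals_ne_bot a)

lemma normFinset_zero : normFinset (L := L) (M := M) 0 = ∅ := by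
  ext a
  simp only [mem_normFinset, Finset.notMem_empty, iff_false]
  exact absNorm_coprimeIdeals_ne_zero a

open Classical in
/-- The number of ideals of given norm in a ray class. -/
noncomputable def rayCount (g : Additive (RayClassGroup L M)) : ArithmeticFunction ℝ :=
  ⟨fun n => ∑ a ∈ normFinset (L := L) (M := M) n with rayClassAdd a = g, 1,
    by simp [normFinset_zero]⟩

open Classical in
/-- The von Mangoldt function of a ray class. -/
noncomputable def rayVonMangoldt (g : Additive (RayClassGroup L M)) : ArithmeticFunction ℝ :=
  ⟨fun n => ∑ a ∈ normFinset (L := L) (M := M) n with rayClassAdd a = g,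
    idealVonMangoldt (a : Ideal (𝓞 L)), by simp [normFinset_zero]⟩

open Classical in
lemma rayCount_apply (g : Additive (RayClassGroup L M)) (n : ℕ) :
    rayCount g n = ∑ a ∈ normFinset (L := L) (M := M) n with rayClassAdd a = g, 1 := rfl

open Classical in
lemma rayVonMangoldt_apply (g : Additive (RayClassGroup L M)) (n : ℕ) :
    rayVonMangoldt g n = ∑ a ∈ normFinset (L := L) (M := M) n with rayClassAdd a = g,
      idealVonMangoldt (a : Ideal (𝓞 L)) := rfl

lemma rayCount_nonneg (g : Additive (RayClassGroup L M)) (n : ℕ) : 0 ≤ rayCount g n :=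
  Finset.sum_nonneg fun _ _ => zero_le_one

lemma rayVonMangoldt_nonneg (g : Additive (RayClassGroup L M)) (n : ℕ) : 0 ≤ rayVonMangoldt g n :=
  Finset.sum_nonneg fun _ _ => idealVonMangoldt_nonneg _

lemma rayCount_one (g : Additive (RayClassGroup L M)) (hg : g ≠ 0) : rayCount g 1 = 0 := by
  classical
  rw [rayCount_apply, normFinset_one, Finset.sum_filter, Finset.sum_singleton, rayClassAdd_one,
    if_neg hg.symm]

lemma rayCount_zero_one : rayCount (0 : Additive (RayClassGroup L M)) 1 = 1 := by
  classical
  rw [rayCount_apply, normFinset_one, Finset.sum_filter, Finset.sum_singleton, rayClassAdd_one,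
    if_pos rfl]

instance : Finite (Additive (RayClassGroup L M)) := inferInstanceAs (Finite (RayClassGroup L M))

noncomputable instance : Fintype (Additive (RayClassGroup L M)) := Fintype.ofFinite _

lemma sum_rayVonMangoldt_le (n : ℕ) : ∑ g, rayVonMangoldt (L := L) (M := M) g n ≤
    Module.finrank ℤ (𝓞 L) * ArithmeticFunction.vonMangoldt n := by
  classical
  simp_rw [rayVonMangoldt_apply]
  rw [Finset.sum_fiberwise (normFinset n) rayClassAdd
    (fun a : coprimeIdeals L M => idealVonMangoldt (a : Ideal (𝓞 L)))]
  have h := sum_idealVonMangoldt_le ((normFinset (L := L) (M := M) n).map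
    (Function.Embedding.subtype _)) n ?_
  · rwa [Finset.sum_map] at h
  · intro b hb
    obtain ⟨a, ha, rfl⟩ := Finset.mem_map.1 hb
    exact mem_normFinset.1 ha

lemma rayCount_mul_log (g : Additive (RayClassGroup L M)) (n : ℕ) :
    rayCount g n * Real.log n = ∑ p ∈ n.divisorsAntidiagonal, ∑ h,
      rayCount h p.1 * rayVonMangoldt (g - h) p.2 := by
  classical
  rcases eq_or_ne n 0 with rfl | hn
  · simp
  have e1 : ∀ p : ℕ × ℕ, ∑ h, rayCount h p.1 * rayVonMangoldt (g - h) p.2 =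
      ∑ i ∈ normFinset (L := L) (M := M) p.1 ×ˢ normFinset p.2 with
        rayClassAdd (i.1 * i.2) = g, idealVonMangoldt (i.2 : Ideal (𝓞 L)) := by
    intro p
    rw [Finset.sum_filter, Finset.sum_product]
    have : ∀ h, rayCount h p.1 * rayVonMangoldt (g - h) p.2 =
        ∑ a ∈ normFinset (L := L) (M := M) p.1 with rayClassAdd a = h,
          rayVonMangoldt (g - rayClassAdd a) p.2 := by
      intro h
      rw [rayCount_apply, Finset.sum_mul]
      refine Finset.sum_congr rfl fun a ha => ?_
      rw [(Finset.mem_filter.1 ha).2, one_mul]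
    rw [Finset.sum_congr rfl fun h _ => this h, Finset.sum_fiberwise (normFinset p.1) rayClassAdd
      fun a => rayVonMangoldt (g - rayClassAdd a) p.2]
    refine Finset.sum_congr rfl fun a _ => ?_
    rw [rayVonMangoldt_apply, Finset.sum_filter]
    refine Finset.sum_congr rfl fun b _ => ?_
    simp_rw [rayClassAdd_mul, eq_sub_iff_add_eq, add_comm]
  rw [Finset.sum_congr rfl fun p _ => e1 p, ← Finset.sum_biUnion]
  swap
  · intro p _ q _ hpq
    refine Finset.disjoint_left.2 fun i hi hj => hpq ?_
    simp only [Finset.mem_filter, Finset.mem_product, mem_normFinset] at hi hj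
    exact Prod.ext (hi.1.1.symm.trans hj.1.1) (hi.1.2.symm.trans hj.1.2)
  set U := n.divisorsAntidiagonal.biUnion fun p => (normFinset (L := L) (M := M) p.1 ×ˢ
    normFinset p.2).filter fun i => rayClassAdd (i.1 * i.2) = g with hU
  have memU : ∀ i, i ∈ U ↔ Ideal.absNorm ((i.1 * i.2 : coprimeIdeals L M) : Ideal (𝓞 L)) = n ∧
      rayClassAdd (i.1 * i.2) = g := by
    intro i
    simp only [hU, Finset.mem_biUnion, Nat.mem_divisorsAntidiagonal, Finset.mem_filter,
      Finset.mem_product, mem_normFinset, Submonoid.coe_mul, map_mul]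
    constructor
    · rintro ⟨p, ⟨hp, -⟩, ⟨h1, h2⟩, h3⟩
      exact ⟨by rw [h1, h2, hp], h3⟩
    · rintro ⟨h1, h2⟩
      exact ⟨(_, _), ⟨h1, hn⟩, ⟨rfl, rfl⟩, h2⟩
  rw [rayCount_apply, Finset.sum_mul, ← Finset.sum_fiberwise_of_maps_to (s := U)
    (t := (normFinset n).filter fun a => rayClassAdd a = g) (g := fun i => i.1 * i.2)]
  · refine Finset.sum_congr rfl fun a ha => ?_
    simp only [Finset.mem_filter, mem_normFinset] at ha
    rw [one_mul, ← ha.1, ← sum_idealVonMangoldt (coprimeIdeals_ne_bot a)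
      (D := (U.filter fun i => i.1 * i.2 = a).image fun i => (i.2 : Ideal (𝓞 L))) fun b => ?_]
    · rw [Finset.sum_image]
      rintro ⟨i₁, i₂⟩ hi ⟨j₁, j₂⟩ hj h
      simp only [Finset.coe_filter, Set.mem_ofPred_eq] at hi hj h
      obtain rfl := Subtype.ext h
      have h2 := congr_arg Subtype.val (hi.2.trans hj.2.symm)
      simp only [Submonoid.coe_mul] at h2
      exact Prod.ext (Subtype.ext (mul_right_cancel₀ (coprimeIdeals_ne_bot _) h2)) rfl
    · simp only [Finset.mem_image, Finset.mem_filter, memU]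
      constructor
      · rintro ⟨⟨i₁, i₂⟩, ⟨-, h⟩, rfl⟩
        exact ⟨i₁, by rw [← h, Submonoid.coe_mul, mul_comm]⟩
      · rintro ⟨c, hc⟩
        have hc' : c * b ∈ coprimeIdeals L M := by rw [mul_comm, ← hc]; exact a.2
        have hb' : b * c ∈ coprimeIdeals L M := by rw [← hc]; exact a.2
        have e : (⟨c, mem_coprimeIdeals_of_mul hc'⟩ * ⟨b, mem_coprimeIdeals_of_mul hb'⟩ :
            coprimeIdeals L M) = a := Subtype.ext (by rw [hc, Submonoid.coe_mul, mul_comm])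
        exact ⟨(⟨c, mem_coprimeIdeals_of_mul hc'⟩, ⟨b, mem_coprimeIdeals_of_mul hb'⟩),
          ⟨⟨by rw [e]; exact ha.1, by rw [e]; exact ha.2⟩, e⟩, rfl⟩
  · intro i hi
    rw [memU] at hi
    simpa using hi

lemma exists_le_rayCount_pow : ∃ n₀ : ℕ, 2 ≤ n₀ ∧ ∃ c₀ : ℝ, 0 < c₀ ∧ ∀ j : ℕ, 1 ≤ j →
    1 ≤ rayCount (0 : Additive (RayClassGroup L M)) (n₀ ^ j) ∧
      c₀ ≤ rayVonMangoldt (0 : Additive (RayClassGroup L M)) (n₀ ^ j) := by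
  classical
  have hM := Nat.AtLeastTwo.prop (n := M)
  have hnt : Ideal.span {((1 + M : ℕ) : 𝓞 L)} ≠ ⊤ := by
    have : (1 + M).AtLeastTwo := ⟨by omega⟩
    exact span_natCast_ne_top
  obtain ⟨p, hp, hle⟩ := Ideal.exists_le_maximal _ hnt
  have hmem : ((1 + M : ℕ) : 𝓞 L) ∈ p := hle (Ideal.mem_span_singleton_self _)
  have hpc : p ∈ coprimeIdeals L M := mem_coprimeIdeals_iff.2 ⟨_, hmem, by
    rw [← map_one (redMod L M), Ideal.Quotient.eq, Ideal.mem_span_singleton']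
    exact ⟨1, by push_cast; ring⟩⟩
  set P : coprimeIdeals L M := ⟨p, hpc⟩ with hP
  have hp0 : p ≠ ⊥ := coprimeIdeals_ne_bot P
  have hpr : Prime p := Ideal.prime_of_isPrime hp0 hp.isPrime
  obtain ⟨l, f, hl, hf, hlf, -⟩ := exists_absNorm_eq_prime_pow hpr
  have h2 : 2 ≤ Ideal.absNorm p := by
    rw [hlf]; exact hl.two_le.trans (Nat.le_self_pow hf.ne' _)
  set o := Nat.card (RayClassGroup L M) with ho
  have ho0 : 0 < o := Nat.card_pos
  refine ⟨Ideal.absNorm p ^ o, h2.trans (Nat.le_self_pow ho0.ne' _), Real.log (Ideal.absNorm p),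
    Real.log_pos (by exact_mod_cast h2), fun j hj => ?_⟩
  have hm : P ^ (o * j) ∈ (normFinset (L := L) (M := M) ((Ideal.absNorm p ^ o) ^ j)).filter
      fun a => rayClassAdd a = 0 := by
    rw [Finset.mem_filter, mem_normFinset, SubmonoidClass.coe_pow, map_pow, pow_mul]
    refine ⟨rfl, ?_⟩
    rw [rayClassAdd, map_pow, pow_mul, pow_card_eq_one', one_pow]
    rfl
  constructor
  · rw [rayCount_apply]
    exact Finset.single_le_sum (f := fun _ => (1 : ℝ)) (fun _ _ => zero_le_one) hm
  · rw [rayVonMangoldt_apply]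
    refine le_trans ?_ (Finset.single_le_sum
      (f := fun a : coprimeIdeals L M => idealVonMangoldt (a : Ideal (𝓞 L)))
      (fun _ _ => idealVonMangoldt_nonneg _) hm)
    rw [SubmonoidClass.coe_pow, idealVonMangoldt_pow hpr (by positivity)]

lemma rayVonMangoldt_prime (g : Additive (RayClassGroup L M)) {l : ℕ} (hl : l.Prime) :
    rayVonMangoldt g l = rayCount g l * Real.log l := by
  classical
  rw [rayVonMangoldt_apply, rayCount_apply, Finset.sum_mul]
  refine Finset.sum_congr rfl fun a ha => ?_
  rw [Finset.mem_filter, mem_normFinset] at ha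
  have h1 : (a : Ideal (𝓞 L)).IsPrime :=
    Ideal.isPrime_of_irreducible_absNorm (by rw [ha.1]; exact hl.prime.irreducible)
  have h2 := idealVonMangoldt_pow (Ideal.prime_of_isPrime (coprimeIdeals_ne_bot a) h1) one_pos
  rw [pow_one] at h2
  rw [h2, ha.1, one_mul]

end RayCount

section UnitWeight

open NumberField.Units NumberField.mixedEmbedding
open NumberField.Units.dirichletUnitTheorem
open scoped ContDiff Topology Classical

/-- A smooth function on the line whose translates by the integers sum to `1`. -/
noncomputable def unitStep (z : ℝ) : ℝ := Real.smoothTransition (z + 1) - Real.smoothTransition z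

lemma contDiff_unitStep : ContDiff ℝ ∞ unitStep := by
  have h : ContDiff ℝ ∞ Real.smoothTransition := Real.smoothTransition.contDiff
  exact (h.comp (contDiff_id.add contDiff_const)).sub h

lemma unitStep_eq_zero {z : ℝ} (hz : 1 ≤ |z|) : unitStep z = 0 := by
  rw [unitStep]
  rcases le_abs'.1 hz with h | h
  · rw [Real.smoothTransition.zero_of_nonpos (by linarith),
      Real.smoothTransition.zero_of_nonpos (by linarith), sub_zero]
  · rw [Real.smoothTransition.one_of_one_le (by linarith),
      Real.smoothTransition.one_of_one_le h, sub_self]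

lemma exists_finset_unitStep (z : ℝ) : ∃ s : Finset ℤ, (∀ m ∉ s, unitStep (z + m) = 0) ∧
    ∑ m ∈ s, unitStep (z + m) = 1 := by
  set a : ℤ := ⌊-z⌋ - 1 with ha
  have h1 : (⌊-z⌋ : ℝ) ≤ -z := Int.floor_le _
  have h2 : -z < ⌊-z⌋ + 1 := Int.lt_floor_add_one _
  refine ⟨(Finset.range 4).image fun i : ℕ => a + (i : ℤ), fun m hm => ?_, ?_⟩
  · apply unitStep_eq_zero
    have hm' : m < a ∨ a + 4 ≤ m := by
      by_contra! h
      refine hm (Finset.mem_image.2 ⟨(m - a).toNat, ?_, ?_⟩)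
      · rw [Finset.mem_range]; omega
      · omega
    rw [le_abs']
    rcases hm' with h | h
    · left
      have : (m : ℝ) ≤ ⌊-z⌋ - 2 := by exact_mod_cast (by omega : m ≤ ⌊-z⌋ - 2)
      linarith
    · right
      have : (⌊-z⌋ + 3 : ℝ) ≤ m := by exact_mod_cast (by omega : ⌊-z⌋ + 3 ≤ m)
      linarith
  · rw [Finset.sum_image fun i _ j _ h => by simpa using h]
    have h3 := Finset.sum_range_sub (fun i : ℕ => Real.smoothTransition (z + a + i)) 4
    have h4 : ∀ i : ℕ, unitStep (z + ((a + (i : ℤ) : ℤ) : ℝ)) =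
        Real.smoothTransition (z + a + (i + 1 : ℕ)) - Real.smoothTransition (z + a + i) := by
      intro i
      rw [unitStep]
      push_cast
      congr 2 <;> ring
    rw [Finset.sum_congr rfl fun i _ => h4 i, h3, Real.smoothTransition.one_of_one_le,
      Real.smoothTransition.zero_of_nonpos, sub_zero]
    · rw [ha]; push_cast; linarith
    · rw [ha]; push_cast; linarith

lemma exists_finset_prod_unitStep {r : ℕ} (z : Fin r → ℝ) : ∃ s : Finset (Fin r → ℤ),
    (∀ e ∉ s, ∏ j, unitStep (z j + e j) = 0) ∧ ∑ e ∈ s, ∏ j, unitStep (z j + e j) = 1 := by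
  choose s hs hs1 using fun j => exists_finset_unitStep (z j)
  refine ⟨Fintype.piFinset s, fun e he => ?_, ?_⟩
  · rw [Fintype.mem_piFinset, not_forall] at he
    obtain ⟨j, hj⟩ := he
    exact Finset.prod_eq_zero (Finset.mem_univ j) (hs j _ hj)
  · rw [← Finset.prod_univ_sum s fun j m => unitStep (z j + (m : ℝ))]
    exact Finset.prod_eq_one fun j _ => hs1 j

variable {L : Type} [Field L] [NumberField L]

variable (L) in
/-- The coordinates on the logarithmic space given by a basis of the unit lattice. -/
noncomputable def logCoord : logSpace L →ₗ[ℝ] (Fin (rank L) → ℝ) :=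
  ((basisUnitLattice L).ofZLatticeBasis ℝ (unitLattice L)).equivFun

lemma logCoord_injective : Function.Injective (logCoord L) :=
  ((basisUnitLattice L).ofZLatticeBasis ℝ (unitLattice L)).equivFun.injective

lemma logCoord_logEmbedding_fundSystem (i : Fin (rank L)) :
    logCoord L (logEmbedding L (Additive.ofMul (fundSystem L i))) = Pi.single i 1 := by
  rw [logEmbedding_fundSystem, ← Module.Basis.ofZLatticeBasis_apply ℝ (unitLattice L)]
  ext j
  rw [logCoord, LinearEquiv.coe_coe, Module.Basis.equivFun_self, Pi.single_apply]
  simp only [eq_comm]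

/-- The decomposition of a unit along a fundamental system. -/
noncomputable def unitEquiv : (torsion L) × (Fin (rank L) → ℤ) ≃ (𝓞 L)ˣ :=
  Equiv.ofBijective (fun ζe => (ζe.1 : (𝓞 L)ˣ) * ∏ i, fundSystem L i ^ ζe.2 i) <| by
    rw [Function.bijective_iff_existsUnique]
    intro u
    obtain ⟨x, hx, hu⟩ := exist_unique_eq_mul_prod L u
    exact ⟨x, hx.symm, fun y hy => hu y hy.symm⟩

lemma logCoord_unitEquiv (ζ : torsion L) (e : Fin (rank L) → ℤ) (j : Fin (rank L)) :
    logCoord L (logEmbedding L (Additive.ofMul (unitEquiv (ζ, e)))) j = e j := by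
  have h0 : logEmbedding L (Additive.ofMul (ζ : (𝓞 L)ˣ)) = 0 :=
    logEmbedding_eq_zero_iff.2 ζ.2
  have h1 : logEmbedding L (Additive.ofMul (unitEquiv (ζ, e))) =
      ∑ i, e i • logEmbedding L (Additive.ofMul (fundSystem L i)) := by
    change logEmbedding L (Additive.ofMul ((ζ : (𝓞 L)ˣ) * ∏ i, fundSystem L i ^ e i)) = _
    rw [ofMul_mul, map_add, h0, zero_add, ofMul_prod, map_sum]
    refine Finset.sum_congr rfl fun i _ => ?_
    rw [ofMul_zpow, map_zsmul]
  rw [h1, map_sum, Finset.sum_apply, Finset.sum_eq_single j]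
  · rw [map_zsmul, logCoord_logEmbedding_fundSystem, Pi.smul_apply, Pi.single_eq_same]
    simp
  · intro i _ hij
    rw [map_zsmul, logCoord_logEmbedding_fundSystem, Pi.smul_apply, Pi.single_eq_of_ne hij.symm,
      smul_zero]
  · simp

/-- A smooth weight on the logarithmic space whose translates by the unit lattice sum to `1`. -/
noncomputable def unitWeight (y : logSpace L) : ℝ := ∏ j, unitStep (logCoord L y j)

lemma contDiff_unitWeight : ContDiff ℝ ∞ (unitWeight (L := L)) := by
  refine contDiff_prod fun j _ => contDiff_unitStep.comp ?_
  have : ContDiff ℝ ∞ (LinearMap.toContinuousLinearMap (logCoord L)) :=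
    ContinuousLinearMap.contDiff _
  exact (contDiff_pi.1 this) j

lemma exists_norm_le_of_unitWeight_ne_zero :
    ∃ C : ℝ, ∀ y : logSpace L, unitWeight y ≠ 0 → ‖y‖ ≤ C := by
  obtain ⟨K, -, hK⟩ := (LinearMap.toContinuousLinearMap (logCoord L)).exists_antilipschitzWith
    (LinearMap.ker_eq_bot.2 logCoord_injective)
  refine ⟨K * 1, fun y hy => ?_⟩
  have h1 := hK.le_mul_dist y 0
  rw [map_zero, dist_zero_right, dist_zero_right] at h1
  refine h1.trans ?_
  gcongr
  refine (pi_norm_le_iff_of_nonneg zero_le_one).2 fun j => ?_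
  by_contra! h
  exact hy (Finset.prod_eq_zero (Finset.mem_univ j) (unitStep_eq_zero h.le))

lemma hasSum_unitWeight (y : logSpace L) :
    HasSum (fun u : (𝓞 L)ˣ => unitWeight (logEmbedding L (Additive.ofMul u) + y))
      (torsionOrder L) := by
  have : Fintype (torsion L) := Fintype.ofFinite _
  rw [← unitEquiv.hasSum_iff]
  obtain ⟨s, hs, hs1⟩ := exists_finset_prod_unitStep fun j => logCoord L y j
  have h1 : ∀ x : (torsion L) × (Fin (rank L) → ℤ), ((fun u : (𝓞 L)ˣ =>
      unitWeight (logEmbedding L (Additive.ofMul u) + y)) ∘ unitEquiv) x =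
      ∏ j, unitStep (logCoord L y j + x.2 j) := by
    rintro ⟨ζ, e⟩
    simp only [Function.comp_apply, unitWeight]
    refine Finset.prod_congr rfl fun j _ => ?_
    rw [map_add, Pi.add_apply, logCoord_unitEquiv, add_comm]
  have h2 : (torsionOrder L : ℝ) = ∑ x ∈ (Finset.univ : Finset (torsion L)) ×ˢ s,
      ((fun u : (𝓞 L)ˣ => unitWeight (logEmbedding L (Additive.ofMul u) + y)) ∘ unitEquiv) x := by
    rw [Finset.sum_congr rfl fun x _ => h1 x, Finset.sum_product]
    simp [hs1, torsionOrder, Nat.card_eq_fintype_card]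
  rw [h2]
  refine hasSum_sum_of_ne_finset_zero fun x hx => ?_
  rw [h1]
  refine hs _ fun h => hx ?_
  simpa using h

/-- The weight on the mixed space obtained from a weight on the logarithm of the norm. -/
noncomputable def mixedWeight (φ : ℝ → ℝ) (x : mixedSpace L) : ℝ :=
  if mixedEmbedding.norm x = 0 then 0 else
    φ (Real.log (mixedEmbedding.norm x)) * unitWeight (logMap x)

lemma contDiffAt_normAtPlace {x : mixedSpace L} {w : InfinitePlace L} (h : normAtPlace w x ≠ 0) :
    ContDiffAt ℝ ∞ (normAtPlace w) x := by
  rcases w.isReal_or_isComplex with hw | hw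
  · have e : ⇑(normAtPlace w) = fun x : mixedSpace L => ‖x.1 ⟨w, hw⟩‖ :=
      funext (normAtPlace_apply_of_isReal hw)
    rw [e] at h ⊢
    have h1 : ContDiffAt ℝ ∞ (fun x : mixedSpace L => x.1 ⟨w, hw⟩) x := by fun_prop
    exact h1.norm ℝ (norm_ne_zero_iff.1 h)
  · have e : ⇑(normAtPlace w) = fun x : mixedSpace L => ‖x.2 ⟨w, hw⟩‖ :=
      funext (normAtPlace_apply_of_isComplex hw)
    rw [e] at h ⊢
    have h1 : ContDiffAt ℝ ∞ (fun x : mixedSpace L => x.2 ⟨w, hw⟩) x := by fun_prop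
    exact h1.norm ℝ (norm_ne_zero_iff.1 h)

lemma contDiff_mixedWeight {φ : ℝ → ℝ} (hφ : ContDiff ℝ ∞ φ) (hφc : HasCompactSupport φ) :
    ContDiff ℝ ∞ (mixedWeight (L := L) φ) := by
  obtain ⟨R, hR⟩ := hφc.isCompact.isBounded.subset_closedBall 0
  have hs : ∀ t, R < |t| → φ t = 0 := by
    intro t ht
    refine image_eq_zero_of_notMem_tsupport fun h => ?_
    have := hR h
    rw [Metric.mem_closedBall, dist_zero_right, Real.norm_eq_abs] at this
    linarith
  have hcont : Continuous (mixedEmbedding.norm : mixedSpace L → ℝ) :=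
    mixedEmbedding.continuous_norm L
  rw [contDiff_iff_contDiffAt]
  intro x
  by_cases hx : mixedEmbedding.norm x = 0
  · have hev : mixedWeight φ =ᶠ[𝓝 x] fun _ => 0 := by
      have : ∀ᶠ y in 𝓝 x, mixedEmbedding.norm y < Real.exp (-R) :=
        hcont.continuousAt.eventually_lt continuousAt_const (by rw [hx]; exact Real.exp_pos _)
      filter_upwards [this] with y hy
      rw [mixedWeight]
      split_ifs with h
      · rfl
      · rw [hs, zero_mul]
        have h1 : Real.log (mixedEmbedding.norm y) < -R :=
          (Real.log_lt_iff_lt_exp ((mixedEmbedding.norm_nonneg y).lt_of_ne' h)).2 hy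
        rw [lt_abs]; right; linarith
    exact contDiffAt_const.congr_of_eventuallyEq hev
  · have hev : mixedWeight φ =ᶠ[𝓝 x] fun y =>
        φ (Real.log (mixedEmbedding.norm y)) * unitWeight (logMap y) := by
      filter_upwards [hcont.continuousAt.eventually_ne hx] with y hy
      rw [mixedWeight, if_neg hy]
    refine ContDiffAt.congr_of_eventuallyEq ?_ hev
    have hpl : ∀ w, normAtPlace w x ≠ 0 := by
      intro w h
      exact hx (mixedEmbedding.norm_eq_zero_iff.2 ⟨w, h⟩)
    have h1 : ContDiffAt ℝ ∞ (fun y : mixedSpace L => mixedEmbedding.norm y) x := by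
      simp_rw [mixedEmbedding.norm_apply]
      exact contDiffAt_prod fun w _ => (contDiffAt_normAtPlace (hpl w)).pow _
    have h2 := h1.log hx
    refine (hφ.contDiffAt.comp x h2).mul (contDiff_unitWeight.contDiffAt.comp x ?_)
    refine contDiffAt_pi.2 fun w => ?_
    exact contDiffAt_const.mul (((contDiffAt_normAtPlace (hpl w)).log (hpl w)).sub
      (h2.mul contDiffAt_const))

lemma hasCompactSupport_mixedWeight {φ : ℝ → ℝ} (hφc : HasCompactSupport φ) :
    HasCompactSupport (mixedWeight (L := L) φ) := by
  obtain ⟨R, hR⟩ := hφc.isCompact.isBounded.subset_closedBall 0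
  have hs : ∀ t, φ t ≠ 0 → |t| ≤ R := by
    intro t ht
    have := hR (subset_tsupport _ ht)
    rwa [Metric.mem_closedBall, dist_zero_right, Real.norm_eq_abs] at this
  obtain ⟨C, hC⟩ := exists_norm_le_of_unitWeight_ne_zero (L := L)
  set d : ℝ := (Module.finrank ℚ L : ℝ) with hd
  have hd1 : 1 ≤ d := by rw [hd]; exact_mod_cast Module.finrank_pos
  refine HasCompactSupport.of_support_subset_isCompact
    (isCompact_closedBall (0 : mixedSpace L) (Real.exp (R + d * (C + R)))) ?_
  intro x hx
  rw [Function.mem_support, mixedWeight] at hx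
  split_ifs at hx with h0
  · exact (hx rfl).elim
  have hφx := hs _ (left_ne_zero_of_mul hx)
  have hCx := hC _ (right_ne_zero_of_mul hx)
  have hR0 : 0 ≤ R := (abs_nonneg _).trans hφx
  have hC0 : 0 ≤ C := (norm_nonneg _).trans hCx
  have hpos : ∀ w, 0 < normAtPlace w x := fun w => (normAtPlace_nonneg w x).lt_of_ne'
    fun h => h0 (mixedEmbedding.norm_eq_zero_iff.2 ⟨w, h⟩)
  have hdR : |Real.log (mixedEmbedding.norm x) * d⁻¹| ≤ R := by
    have hd0 : 0 < d := by linarith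
    rw [abs_mul, abs_of_pos (inv_pos.2 hd0), ← div_eq_mul_inv, div_le_iff₀ hd0]
    nlinarith
  have h1 : ∀ w, w ≠ w₀ → |Real.log (normAtPlace w x)| ≤ C + R := by
    intro w hw
    have h2 := (norm_le_pi_norm (logMap x) ⟨w, hw⟩).trans hCx
    rw [logMap, Real.norm_eq_abs, abs_mul, Nat.abs_cast] at h2
    have h3 : (1 : ℝ) ≤ w.mult := by exact_mod_cast InfinitePlace.one_le_mult
    have h4 : |Real.log (normAtPlace w x) - Real.log (mixedEmbedding.norm x) * d⁻¹| ≤ C :=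
      (le_mul_of_one_le_left (abs_nonneg _) h3).trans h2
    have := abs_sub_abs_le_abs_sub (Real.log (normAtPlace w x))
      (Real.log (mixedEmbedding.norm x) * d⁻¹)
    linarith
  have hlog : Real.log (mixedEmbedding.norm x) =
      ∑ w : InfinitePlace L, w.mult * Real.log (normAtPlace w x) := by
    rw [mixedEmbedding.norm_apply, Real.log_prod fun w _ => pow_ne_zero _ (hpos w).ne']
    simp_rw [Real.log_pow]
  have hdsum : ∑ w : InfinitePlace L, (w.mult : ℝ) = d := by
    rw [hd]; exact_mod_cast InfinitePlace.sum_mult_eq (K := L)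
  have h5 : ∀ w, Real.log (normAtPlace w x) ≤ R + d * (C + R) := by
    intro w
    by_cases hw : w = w₀
    · subst hw
      classical
      rw [← Finset.add_sum_erase _ _ (Finset.mem_univ w₀)] at hlog
      have h6 : |∑ w ∈ Finset.univ.erase (w₀ : InfinitePlace L),
          w.mult * Real.log (normAtPlace w x)| ≤ d * (C + R) := by
        refine (Finset.abs_sum_le_sum_abs _ _).trans ?_
        rw [← hdsum, Finset.sum_mul]
        refine (Finset.sum_le_sum fun w hw => ?_).trans (Finset.sum_le_sum_of_subset_of_nonneg
          (Finset.erase_subset _ _) fun w _ _ => by positivity)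
        rw [abs_mul, Nat.abs_cast]
        gcongr
        exact h1 w (Finset.ne_of_mem_erase hw)
      rcases le_or_gt (Real.log (normAtPlace (w₀ : InfinitePlace L) x)) 0 with h7 | h7
      · have : 0 ≤ d * (C + R) := by positivity
        linarith
      · have h8 : (1 : ℝ) ≤ (w₀ : InfinitePlace L).mult := by
          exact_mod_cast InfinitePlace.one_le_mult
        have := le_mul_of_one_le_left h7.le h8
        linarith [(abs_le.1 h6).1, (abs_le.1 hφx).2]
    · have h6 := (le_abs_self _).trans (h1 w hw)
      have : C + R ≤ d * (C + R) := le_mul_of_one_le_left (by positivity) hd1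
      linarith
  rw [Metric.mem_closedBall, dist_zero_right, norm_eq_sup'_normAtPlace, Finset.sup'_le_iff]
  intro w _
  rw [← Real.log_le_iff_le_exp (hpos w)]
  exact h5 w

lemma hasSum_mixedWeight (φ : ℝ → ℝ) {T : ℝ} (hT : 0 < T) {x : mixedSpace L}
    (hx : mixedEmbedding.norm x ≠ 0) :
    HasSum (fun u : (𝓞 L)ˣ => mixedWeight φ (T⁻¹ • (u • x)))
      (torsionOrder L *
        φ (Real.log (mixedEmbedding.norm x) - Module.finrank ℚ L * Real.log T)) := by
  have h1 : ∀ u : (𝓞 L)ˣ, mixedWeight φ (T⁻¹ • (u • x)) =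
      unitWeight (logEmbedding L (Additive.ofMul u) + logMap x) *
      φ (Real.log (mixedEmbedding.norm x) - Module.finrank ℚ L * Real.log T) := by
    intro u
    have hT' : |T⁻¹| ^ Module.finrank ℚ L ≠ 0 := by positivity
    have hn : mixedEmbedding.norm (T⁻¹ • (u • x)) =
        |T⁻¹| ^ Module.finrank ℚ L * mixedEmbedding.norm x := by
      rw [mixedEmbedding.norm_smul, norm_unit_smul]
    rw [mixedWeight, if_neg (by rw [hn]; exact mul_ne_zero hT' hx), hn, Real.log_mul hT' hx,
      Real.log_pow, abs_of_pos (inv_pos.2 hT), Real.log_inv,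
      logMap_real_smul (by rwa [norm_unit_smul]) (inv_pos.2 hT).ne',
      logMap_unit_smul _ hx, mul_comm]
    congr 2
    ring
  simp_rw [h1]
  exact (hasSum_unitWeight _).mul_right _

end UnitWeight

section RayCount

open NumberField.Units NumberField.mixedEmbedding MeasureTheory
open scoped ContDiff Topology Classical nonZeroDivisors

variable {L : Type} [Field L] [NumberField L] {M : ℕ}

variable (L M) in
/-- The residues modulo `M` of the units. -/
def unitResidues : Set (𝓞 L ⧸ Ideal.span {(M : 𝓞 L)}) :=
  Set.range fun u : (𝓞 L)ˣ => redMod L M u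

/-- The elements of an ideal which are congruent to a unit modulo `M`. -/
def unitCongruent (c : coprimeIdeals L M) : Set (𝓞 L) :=
  {α | α ∈ (c : Ideal (𝓞 L)) ∧ redMod L M α ∈ unitResidues L M}

lemma exists_mem_redMod_eq {L : Type} [Field L] {M : ℕ} (c : coprimeIdeals L M)
    (ε : unitResidues L M) :
    ∃ α ∈ (c : Ideal (𝓞 L)), redMod L M α = ε := by
  obtain ⟨γ, hγ, h1⟩ := mem_coprimeIdeals_iff.1 c.2
  obtain ⟨u, hu⟩ := ε.2
  exact ⟨u * γ, Ideal.mul_mem_left _ _ hγ, by rw [map_mul, h1, mul_one]; exact hu⟩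

lemma mem_mul_span_iff {L : Type} [Field L] {M : ℕ} (c : coprimeIdeals L M) (α : 𝓞 L) :
    α ∈ (c : Ideal (𝓞 L)) * Ideal.span {(M : 𝓞 L)} ↔ α ∈ (c : Ideal (𝓞 L)) ∧ redMod L M α = 0 := by
  have h : IsCoprime (c : Ideal (𝓞 L)) (Ideal.span {(M : 𝓞 L)}) := c.2
  rw [Ideal.mul_eq_inf_of_isCoprime h, Ideal.mem_inf, Ideal.Quotient.eq_zero_iff_mem]

lemma natCast_ne_zero_of_atLeastTwo [M.AtLeastTwo] : (M : 𝓞 L) ≠ 0 := by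
  have := Nat.AtLeastTwo.prop (n := M)
  exact_mod_cast (by omega : M ≠ 0)

lemma finite_quotient_span_natCast [M.AtLeastTwo] : Finite (𝓞 L ⧸ Ideal.span {(M : 𝓞 L)}) :=
  Ideal.finiteQuotientOfFreeOfNeBot _
    (by simpa using natCast_ne_zero_of_atLeastTwo (L := L) (M := M))

variable [M.AtLeastTwo]

noncomputable instance : Fintype (unitResidues L M) :=
  have := finite_quotient_span_natCast (L := L) (M := M)
  Fintype.ofFinite _

lemma finite_support_mixedEmbedding {Φ : mixedSpace L → ℝ} (hΦ : HasCompactSupport Φ) {T : ℝ}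
    (hT : 0 < T) : (Function.support fun α : 𝓞 L => Φ (T⁻¹ • mixedEmbedding L α)).Finite := by
  obtain ⟨R, hR⟩ := hΦ.isCompact.isBounded.subset_closedBall 0
  have hs : ∀ x, R < ‖x‖ → Φ x = 0 := by
    intro x hx
    refine image_eq_zero_of_notMem_tsupport fun h => ?_
    have := hR h
    rw [Metric.mem_closedBall, dist_zero_right] at this
    linarith
  have h := finite_support_periodize (idealLattice L 1) hT hs 0
  have hmem : ∀ α : 𝓞 L, mixedEmbedding L α ∈ idealLattice L 1 := by
    intro α
    rw [mem_idealLattice]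
    exact ⟨α, by simp, rfl⟩
  have hinj : Function.Injective fun α : 𝓞 L => (⟨mixedEmbedding L α, hmem α⟩ : idealLattice L 1) :=
    fun α β hab => RingOfIntegers.coe_injective
      (mixedEmbedding_injective L (congrArg Subtype.val hab))
  refine (h.preimage hinj.injOn).subset fun α hα => ?_
  simpa using hα

/-- The product of an ideal with `M`, as an invertible fractional ideal. -/
noncomputable def mulNatCastUnit (c : coprimeIdeals L M) : (FractionalIdeal (𝓞 L)⁰ L)ˣ :=
  FractionalIdeal.mk0 L ⟨(c : Ideal (𝓞 L)) * Ideal.span {(M : 𝓞 L)}, mem_nonZeroDivisors_of_ne_zero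
    (mul_ne_zero (coprimeIdeals_ne_bot c)
      (by simpa using natCast_ne_zero_of_atLeastTwo (L := L) (M := M)))⟩

lemma mem_idealLattice_mulNatCastUnit (c : coprimeIdeals L M) (x : mixedSpace L) :
    x ∈ idealLattice L (mulNatCastUnit c) ↔
      ∃ α : 𝓞 L, α ∈ (c : Ideal (𝓞 L)) * Ideal.span {(M : 𝓞 L)} ∧ mixedEmbedding L α = x := by
  rw [mem_idealLattice, mulNatCastUnit, FractionalIdeal.coe_mk0]
  constructor
  · rintro ⟨y, hy, rfl⟩
    obtain ⟨α, hα, rfl⟩ := (FractionalIdeal.mem_coeIdeal _).1 hy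
    exact ⟨α, hα, rfl⟩
  · rintro ⟨α, hα, rfl⟩
    exact ⟨α, (FractionalIdeal.mem_coeIdeal _).2 ⟨α, hα, rfl⟩, rfl⟩

/-- The lattice of an ideal in the mixed space. -/
noncomputable def equivIdealLattice (c : coprimeIdeals L M) :
    ((c : Ideal (𝓞 L)) * Ideal.span {(M : 𝓞 L)} : Ideal (𝓞 L)) ≃
      idealLattice L (mulNatCastUnit c) :=
  Equiv.ofBijective (fun α => ⟨mixedEmbedding L (α : 𝓞 L),
    (mem_idealLattice_mulNatCastUnit c _).2 ⟨α, α.2, rfl⟩⟩) <| by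
    constructor
    · intro α β hab
      exact Subtype.ext
        (RingOfIntegers.coe_injective (mixedEmbedding_injective L (congrArg Subtype.val hab)))
    · rintro ⟨x, hx⟩
      obtain ⟨α, hα, rfl⟩ := (mem_idealLattice_mulNatCastUnit c _).1 hx
      exact ⟨⟨α, hα⟩, rfl⟩

/-- The decomposition of the elements congruent to a unit into cosets of a lattice. -/
noncomputable def equivUnitCongruent (c : coprimeIdeals L M) :
    unitResidues L M × ((c : Ideal (𝓞 L)) * Ideal.span {(M : 𝓞 L)} : Ideal (𝓞 L)) ≃
      unitCongruent c :=
  have hred : ∀ x : unitResidues L M × ((c : Ideal (𝓞 L)) * Ideal.span {(M : 𝓞 L)} : Ideal (𝓞 L)),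
      redMod L M ((exists_mem_redMod_eq c x.1).choose + x.2) = x.1 := fun x => by
    rw [map_add, (exists_mem_redMod_eq c x.1).choose_spec.2, ((mem_mul_span_iff c _).1 x.2.2).2,
      add_zero]
  Equiv.ofBijective (fun x => ⟨(exists_mem_redMod_eq c x.1).choose + x.2,
    Ideal.add_mem _ (exists_mem_redMod_eq c x.1).choose_spec.1 ((mem_mul_span_iff c _).1 x.2.2).1,
    by rw [hred]; exact x.1.2⟩) <| by
    constructor
    · intro x y hxy
      have h := congrArg Subtype.val hxy
      have h1 : x.1 = y.1 := Subtype.ext (by rw [← hred x, ← hred y]; exact congrArg _ h)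
      refine Prod.ext h1 (Subtype.ext ?_)
      simp only [h1] at h
      exact add_left_cancel h
    · rintro ⟨α, hα, hε⟩
      obtain ⟨h1, h2⟩ := (exists_mem_redMod_eq c ⟨_, hε⟩).choose_spec
      refine ⟨(⟨_, hε⟩, ⟨α - (exists_mem_redMod_eq c ⟨_, hε⟩).choose, ?_⟩), Subtype.ext ?_⟩
      · rw [mem_mul_span_iff, map_sub, h2, sub_self]
        exact ⟨Ideal.sub_mem _ hα h1, rfl⟩
      · exact add_sub_cancel _ _

lemma tsum_unitCongruent_eq_sum_latticePeriodize (c : coprimeIdeals L M) {Φ : mixedSpace L → ℝ}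
    (hΦ : HasCompactSupport Φ) {T : ℝ} (hT : 0 < T) :
    ∑' α : unitCongruent c, Φ (T⁻¹ • mixedEmbedding L (α : 𝓞 L)) = ∑ ε : unitResidues L M,
      latticePeriodize (idealLattice L (mulNatCastUnit c)) T Φ
        (mixedEmbedding L ((exists_mem_redMod_eq c ε).choose : 𝓞 L)) := by
  have hsum : Summable fun α : unitCongruent c => Φ (T⁻¹ • mixedEmbedding L (α : 𝓞 L)) :=
    summable_of_hasFiniteSupport
      ((finite_support_mixedEmbedding hΦ hT).preimage Subtype.val_injective.injOn)
  have h := ((equivUnitCongruent c).summable_iff.2 hsum).tsum_prod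
  simp only [Function.comp_apply] at h
  rw [(equivUnitCongruent c).tsum_eq fun α : unitCongruent c =>
    Φ (T⁻¹ • mixedEmbedding L (α : 𝓞 L))] at h
  rw [h, tsum_fintype]
  refine Finset.sum_congr rfl fun ε _ => ?_
  rw [latticePeriodize, ← (equivIdealLattice c).tsum_eq]
  refine tsum_congr fun l => ?_
  congr 2
  exact (map_add (mixedEmbedding L) _ _).symm ▸ rfl

lemma exists_generator_of_rayClass_mul_eq_one {c a : coprimeIdeals L M}
    (h : rayClass a * rayClass c = 1) :
    ∃ γ, redMod L M γ = 1 ∧ (a * c : Ideal (𝓞 L)) = Ideal.span {γ} := by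
  rw [← map_mul] at h
  exact rayClass_eq_one_iff.1 h

/-- The generators of the products of `c` with the ideals of the inverse class are the elements
congruent to a unit. -/
noncomputable def equivUnitCongruentOfClass (c : coprimeIdeals L M) :
    {a : coprimeIdeals L M // rayClass a * rayClass c = 1} × (𝓞 L)ˣ ≃ unitCongruent c :=
  Equiv.ofBijective (fun x => ⟨x.2 * (exists_generator_of_rayClass_mul_eq_one x.1.2).choose, by
    obtain ⟨h1, h2⟩ := (exists_generator_of_rayClass_mul_eq_one x.1.2).choose_spec
    refine ⟨Ideal.mul_mem_left _ _ ?_, ?_⟩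
    · refine Ideal.mul_le_right (I := (x.1.1 : Ideal (𝓞 L))) (J := c) ?_
      refine h2.ge ?_
      exact Ideal.mem_span_singleton_self _
    · rw [map_mul, h1, mul_one]
      exact ⟨x.2, rfl⟩⟩) <| by
    constructor
    · rintro ⟨a, u⟩ ⟨b, v⟩ h
      obtain ⟨h1, h2⟩ := (exists_generator_of_rayClass_mul_eq_one a.2).choose_spec
      obtain ⟨h3, h4⟩ := (exists_generator_of_rayClass_mul_eq_one b.2).choose_spec
      have h5 : (u : 𝓞 L) * (exists_generator_of_rayClass_mul_eq_one a.2).choose =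
        v * (exists_generator_of_rayClass_mul_eq_one b.2).choose := congrArg Subtype.val h
      have h6 : (a.1 * c : Ideal (𝓞 L)) = b.1 * c := by
        rw [h2, h4, ← Ideal.span_singleton_mul_left_unit u.isUnit, h5,
          Ideal.span_singleton_mul_left_unit v.isUnit]
      have h7 : a = b := Subtype.ext (Subtype.ext
        (mul_right_cancel₀ (coprimeIdeals_ne_bot c) h6))
      subst h7
      have := mul_right_cancel₀ (ne_zero_of_redMod_eq_one h1) h5
      rw [Units.ext this]
    · rintro ⟨α, hα, u, hu⟩
      obtain ⟨a, ha⟩ := Ideal.dvd_iff_le.2 ((Ideal.span_singleton_le_iff_mem _).2 hα)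
      have hu' : redMod L M u = redMod L M α := hu
      set γ : 𝓞 L := (u⁻¹ : (𝓞 L)ˣ) * α with hγ
      have hγ1 : redMod L M γ = 1 := by
        rw [hγ, map_mul, ← hu', ← map_mul, Units.inv_mul, map_one]
      have hγs : Ideal.span {γ} = Ideal.span {α} :=
        Ideal.span_singleton_mul_left_unit (u⁻¹).isUnit α
      rw [mul_comm] at ha
      have hac : a ∈ coprimeIdeals L M := by
        refine mem_coprimeIdeals_of_mul (b := c) ?_
        rw [← ha, ← hγs, span_mem_coprimeIdeals_iff, hγ1]
        exact isUnit_one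
      have hcl : rayClass (⟨a, hac⟩ : coprimeIdeals L M) * rayClass c = 1 := by
        rw [← map_mul]
        exact rayClass_eq_one_iff.2 ⟨γ, hγ1, by rw [hγs, ha]; rfl⟩
      obtain ⟨h1, h2⟩ := (exists_generator_of_rayClass_mul_eq_one hcl).choose_spec
      have h3 : Ideal.span {(exists_generator_of_rayClass_mul_eq_one hcl).choose} =
          Ideal.span {α} := by
        rw [← h2, ha]
      obtain ⟨v, hv⟩ := Ideal.span_singleton_eq_span_singleton.1 h3
      exact ⟨(⟨⟨a, hac⟩, hcl⟩, v), Subtype.ext ((mul_comm _ _).trans hv)⟩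

lemma mixedEmbedding_norm_eq_absNorm (α : 𝓞 L) :
    mixedEmbedding.norm (mixedEmbedding L (α : L)) = Ideal.absNorm (Ideal.span {α}) := by
  rw [mixedEmbedding.norm_eq_norm, Ideal.absNorm_span_singleton, ← Algebra.coe_norm_int,
    Nat.cast_natAbs]
  push_cast
  rfl

lemma tsum_unitCongruent_eq_tsum_rayClass (c : coprimeIdeals L M) {φ : ℝ → ℝ}
    (hφ : HasCompactSupport φ) {T : ℝ} (hT : 0 < T) :
    ∑' α : unitCongruent c, mixedWeight φ (T⁻¹ • mixedEmbedding L (α : 𝓞 L)) =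
      torsionOrder L * ∑' a : {a : coprimeIdeals L M // rayClass a * rayClass c = 1},
        φ (Real.log (Ideal.absNorm (a.1 : Ideal (𝓞 L))) +
          (Real.log (Ideal.absNorm (c : Ideal (𝓞 L))) - Module.finrank ℚ L * Real.log T)) ∧
    Summable fun a : {a : coprimeIdeals L M // rayClass a * rayClass c = 1} =>
        φ (Real.log (Ideal.absNorm (a.1 : Ideal (𝓞 L))) +
          (Real.log (Ideal.absNorm (c : Ideal (𝓞 L))) - Module.finrank ℚ L * Real.log T)) := by
  have hsum : Summable fun α : unitCongruent c =>
      mixedWeight φ (T⁻¹ • mixedEmbedding L (α : 𝓞 L)) :=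
    summable_of_hasFiniteSupport ((finite_support_mixedEmbedding
      (hasCompactSupport_mixedWeight hφ) hT).preimage Subtype.val_injective.injOn)
  have hsum' := (equivUnitCongruentOfClass c).summable_iff.2 hsum
  have key : ∀ a : {a : coprimeIdeals L M // rayClass a * rayClass c = 1},
      HasSum (fun u : (𝓞 L)ˣ => ((fun α : unitCongruent c =>
        mixedWeight φ (T⁻¹ • mixedEmbedding L (α : 𝓞 L))) ∘ equivUnitCongruentOfClass c) (a, u))
      (torsionOrder L * φ (Real.log (Ideal.absNorm (a.1 : Ideal (𝓞 L))) +
          (Real.log (Ideal.absNorm (c : Ideal (𝓞 L))) - Module.finrank ℚ L * Real.log T))) := by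
    intro a
    obtain ⟨h1, h2⟩ := (exists_generator_of_rayClass_mul_eq_one a.2).choose_spec
    set γ := (exists_generator_of_rayClass_mul_eq_one a.2).choose with hγ
    have hn : mixedEmbedding.norm (mixedEmbedding L (γ : L)) =
        Ideal.absNorm (a.1 : Ideal (𝓞 L)) * Ideal.absNorm (c : Ideal (𝓞 L)) := by
      rw [mixedEmbedding_norm_eq_absNorm, ← h2, map_mul, Nat.cast_mul]
    have ha0 : (Ideal.absNorm (a.1 : Ideal (𝓞 L)) : ℝ) ≠ 0 :=
      Nat.cast_ne_zero.2 (absNorm_coprimeIdeals_ne_zero _)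
    have hc0 : (Ideal.absNorm (c : Ideal (𝓞 L)) : ℝ) ≠ 0 :=
      Nat.cast_ne_zero.2 (absNorm_coprimeIdeals_ne_zero _)
    have h3 := hasSum_mixedWeight φ hT (x := mixedEmbedding L (γ : L))
      (by rw [hn]; exact mul_ne_zero ha0 hc0)
    rw [hn, Real.log_mul ha0 hc0, add_sub_assoc] at h3
    convert h3 using 2 with u
    simp only [Function.comp_apply]
    rw [unitSMul_smul, ← map_mul]
    rfl
  have h4 := hsum'.hasSum.prod_fiberwise key
  simp only [Function.comp_apply] at h4
  rw [(equivUnitCongruentOfClass c).tsum_eq fun α : unitCongruent c =>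
    mixedWeight φ (T⁻¹ • mixedEmbedding L (α : 𝓞 L))] at h4
  have h0 : (torsionOrder L : ℝ) ≠ 0 := by
    exact_mod_cast (torsionOrder_pos L).ne'
  have h5 := (summable_mul_left_iff h0).1 h4.summable
  exact ⟨by rw [← tsum_mul_left, h4.tsum_eq], h5⟩

lemma tsum_rayCount_mul_eq {g : Additive (RayClassGroup L M)} {c : coprimeIdeals L M}
    (hg : g + rayClassAdd c = 0) {ψ : ℕ → ℝ}
    (hs : Summable fun a : {a : coprimeIdeals L M // rayClass a * rayClass c = 1} =>
      ψ (Ideal.absNorm (a.1 : Ideal (𝓞 L)))) :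
    ∑' n, rayCount g n * ψ n =
      ∑' a : {a : coprimeIdeals L M // rayClass a * rayClass c = 1},
        ψ (Ideal.absNorm (a.1 : Ideal (𝓞 L))) := by
  set N : {a : coprimeIdeals L M // rayClass a * rayClass c = 1} → ℕ :=
    fun a => Ideal.absNorm (a.1 : Ideal (𝓞 L)) with hN
  rw [← (hs.hasSum.tsum_fiberwise N).tsum_eq]
  refine tsum_congr fun n => ?_
  have h1 : ∀ b : N ⁻¹' {n}, ψ (Ideal.absNorm (b.1.1 : Ideal (𝓞 L))) = ψ n := fun b =>
    congrArg ψ b.2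
  rw [tsum_congr h1, tsum_const, nsmul_eq_mul, rayCount_apply, Finset.sum_const, nsmul_eq_mul,
    mul_one]
  congr 2
  have hmem : ∀ a : coprimeIdeals L M, rayClassAdd a = g ↔ rayClass a * rayClass c = 1 := by
    intro a
    rw [← add_left_inj (rayClassAdd c), hg]
    exact Iff.rfl
  rw [← Nat.card_eq_finsetCard]
  refine Nat.card_congr ⟨fun a => ⟨⟨a.1, (hmem _).1 (Finset.mem_filter.1 a.2).2⟩,
    mem_normFinset.1 (Finset.mem_filter.1 a.2).1⟩, fun b => ⟨b.1.1, Finset.mem_filter.2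
      ⟨mem_normFinset.2 b.2, (hmem _).2 b.1.2⟩⟩, fun _ => rfl, fun _ => rfl⟩

lemma covolume_mulNatCastUnit (c : coprimeIdeals L M) :
    ZLattice.covolume (idealLattice L (mulNatCastUnit c)) =
      Ideal.absNorm (c : Ideal (𝓞 L)) * (Ideal.absNorm (Ideal.span {(M : 𝓞 L)}) *
        (2⁻¹) ^ InfinitePlace.nrComplexPlaces L * √|discr L|) := by
  rw [covolume_idealLattice, mulNatCastUnit, FractionalIdeal.coe_mk0,
    FractionalIdeal.coeIdeal_absNorm, map_mul]
  push_cast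
  ring

/-- Smooth sums over a ray class have the same main term for all classes and a very small error. -/
theorem exists_tsum_rayCount_sub_exp_le (φ : ℝ → ℝ) (hφ : ContDiff ℝ ∞ φ)
    (hφc : HasCompactSupport φ) : ∃ ρ C : ℝ, ∀ (g : Additive (RayClassGroup L M)) (x : ℝ), 0 ≤ x →
      |∑' n : ℕ, rayCount g n * φ (Real.log n - x) - ρ * Real.exp x| ≤ C * Real.exp (-x) := by
  set d := Module.finrank ℚ L with hd
  have hd0 : 0 < d := Module.finrank_pos
  set κ : ℝ := Ideal.absNorm (Ideal.span {(M : 𝓞 L)}) *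
        (2⁻¹) ^ InfinitePlace.nrComplexPlaces L * √|discr L| with hκ
  set Φ : mixedSpace L → ℝ := mixedWeight φ with hΦ
  set w : ℝ := (torsionOrder L : ℝ) with hw
  have hw0 : 1 ≤ w := by rw [hw]; exact_mod_cast torsionOrder_pos L
  set ρ : ℝ := Fintype.card (unitResidues L M) * (∫ x, Φ x) / κ / w with hρ
  have key : ∀ g : Additive (RayClassGroup L M), ∃ C, ∀ x : ℝ, 0 ≤ x →
      |∑' n : ℕ, rayCount g n * φ (Real.log n - x) - ρ * Real.exp x| ≤ C * Real.exp (-x) := by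
    intro g
    obtain ⟨c, hc⟩ := rayClass_surjective (L := L) (M := M) (Additive.toMul (-g))
    have hg : g + rayClassAdd c = 0 := by
      rw [rayClassAdd, hc, ofMul_toMul, add_neg_cancel]
    obtain ⟨C, hC⟩ := exists_latticePeriodize_sub_integral_le
      (idealLattice L (mulNatCastUnit c)) volume Φ (contDiff_mixedWeight hφ hφc)
      (hasCompactSupport_mixedWeight hφc) (2 * d - 1)
    set N : ℝ := (Ideal.absNorm (c : Ideal (𝓞 L)) : ℝ) with hN
    have hN1 : 1 ≤ N := by
      rw [hN]
      exact_mod_cast Nat.pos_of_ne_zero (absNorm_coprimeIdeals_ne_zero c)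
    refine ⟨Fintype.card (unitResidues L M) * |C|, fun x hx => ?_⟩
    set T : ℝ := Real.exp ((x + Real.log N) / d) with hT
    have hd' : (d : ℝ) ≠ 0 := by positivity
    have hTd : T ^ d = Real.exp x * N := by
      rw [hT, ← Real.exp_nat_mul, mul_div_cancel₀ _ hd', Real.exp_add, Real.exp_log (by linarith)]
    have hT1 : 1 ≤ T := Real.one_le_exp (div_nonneg (add_nonneg hx (Real.log_nonneg hN1))
      (Nat.cast_nonneg _))
    have hT0 : 0 < T := Real.exp_pos _
    have hlogT : Real.log N - d * Real.log T = -x := by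
      rw [hT, Real.log_exp, mul_div_cancel₀ _ hd']; ring
    obtain ⟨h1, h2⟩ := tsum_unitCongruent_eq_tsum_rayClass c hφc hT0
    rw [tsum_unitCongruent_eq_sum_latticePeriodize c (hasCompactSupport_mixedWeight hφc) hT0,
      ← hN, hlogT] at h1
    rw [← hN, hlogT] at h2
    have h3 := tsum_rayCount_mul_eq hg (ψ := fun n => φ (Real.log n + -x)) h2
    simp only [← sub_eq_add_neg] at h1 h3
    rw [← h3] at h1
    set S := ∑' n : ℕ, rayCount g n * φ (Real.log n - x) with hS
    rw [mixedEmbedding.finrank, ← hd, covolume_mulNatCastUnit, ← hN, ← hκ] at hC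
    have h4 : T ^ d * (∫ x, Φ x) / (N * κ) = Real.exp x * ((∫ x, Φ x) / κ) := by
      rw [hTd]
      field_simp
    have h5 : T ^ d / T ^ (2 * d - 1 + 1) ≤ Real.exp (-x) := by
      rw [show 2 * d - 1 + 1 = d + d by omega, pow_add, div_mul_cancel_left₀ (by positivity), hTd,
        Real.exp_neg]
      gcongr
      exact le_mul_of_one_le_right (Real.exp_pos _).le hN1
    have h6 : |w * S - w * (ρ * Real.exp x)| ≤
        Fintype.card (unitResidues L M) * (|C| * Real.exp (-x)) := by
      have : w * (ρ * Real.exp x) = ∑ _ε : unitResidues L M, Real.exp x * ((∫ x, Φ x) / κ) := by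
        rw [Finset.sum_const, nsmul_eq_mul, Finset.card_univ, hρ]
        field_simp
      rw [← h1, this, ← Finset.sum_sub_distrib]
      refine (Finset.abs_sum_le_sum_abs _ _).trans ((Finset.sum_le_card_nsmul _ _
        (|C| * Real.exp (-x)) fun ε _ => ?_).trans_eq (by rw [nsmul_eq_mul, Finset.card_univ]))
      rw [← h4]
      refine (hC T hT1 _).trans ?_
      refine mul_le_mul (le_abs_self _) h5 (by positivity) (abs_nonneg _)
    rw [← mul_sub, abs_mul, abs_of_pos (by linarith)] at h6
    rw [mul_assoc]
    exact (le_mul_of_one_le_left (abs_nonneg _) hw0).trans h6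
  choose C hC using key
  refine ⟨ρ, ∑ g, |C g|, fun g x hx => (hC g x hx).trans ?_⟩
  gcongr
  exact (le_abs_self _).trans
    (Finset.single_le_sum (f := fun g => |C g|) (fun _ _ => abs_nonneg _) (Finset.mem_univ g))

end RayCount

section SmoothSums

open MeasureTheory
open scoped Convolution

/-- The smoothed sum of an arithmetic function near `exp x`. -/
noncomputable def smoothSum (a : ArithmeticFunction ℂ) (φ : ℝ → ℝ) (x : ℝ) : ℂ :=
  ∑' n : ℕ, a n * (φ (Real.log n - x) : ℂ)

lemma smoothSum_eq_sum (a : ArithmeticFunction ℂ) {φ : ℝ → ℝ} {R : ℝ}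
    (hφ : ∀ y, R < |y| → φ y = 0) {x : ℝ} {N : ℕ} (hN : Real.exp (x + R) < N) :
    smoothSum a φ x = ∑ n ∈ Finset.range N, a n * (φ (Real.log n - x) : ℂ) := by
  refine tsum_eq_sum fun n hn => ?_
  rw [Finset.mem_range, not_lt] at hn
  rw [hφ, Complex.ofReal_zero, mul_zero]
  refine lt_of_lt_of_le ?_ (le_abs_self _)
  have h1 : Real.exp (x + R) < n := hN.trans_le (by exact_mod_cast hn)
  have := (Real.lt_log_iff_exp_lt ((Real.exp_pos _).trans h1)).2 h1
  linarith

lemma sum_smooth_eq_zero (a : ArithmeticFunction ℂ) {φ : ℝ → ℝ} {R : ℝ}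
    (hφ : ∀ y, R < |y| → φ y = 0) {x : ℝ} (hx : x < -R) (n : ℕ) :
    a n * (φ (Real.log n - x) : ℂ) = 0 := by
  have := Real.log_natCast_nonneg n
  rw [hφ _ (lt_of_lt_of_le (by linarith) (le_abs_self _)), Complex.ofReal_zero, mul_zero]

lemma smoothSum_eq_zero (a : ArithmeticFunction ℂ) {φ : ℝ → ℝ} {R : ℝ}
    (hφ : ∀ y, R < |y| → φ y = 0) {x : ℝ} (hx : x < -R) : smoothSum a φ x = 0 := by
  simp [smoothSum, sum_smooth_eq_zero a hφ hx]

lemma continuous_smoothSum (a : ArithmeticFunction ℂ) {φ : ℝ → ℝ} {R : ℝ}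
    (hφ : ∀ y, R < |y| → φ y = 0) (hc : Continuous φ) : Continuous (smoothSum a φ) := by
  rw [continuous_iff_continuousAt]
  intro x
  obtain ⟨N, hN⟩ := exists_nat_gt (Real.exp (x + 1 + R))
  have h1 : smoothSum a φ =ᶠ[nhds x]
      fun x => ∑ n ∈ Finset.range N, a n * (φ (Real.log n - x) : ℂ) := by
    filter_upwards [Iio_mem_nhds (lt_add_one x)] with y hy
    refine smoothSum_eq_sum a hφ (lt_trans ?_ hN)
    have : y < x + 1 := hy
    gcongr
  refine ContinuousAt.congr (Continuous.continuousAt ?_) h1.symm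
  fun_prop

lemma exists_support_bound {φ : ℝ → ℝ} (hφ : HasCompactSupport φ) :
    ∃ R, 0 < R ∧ ∀ y, R < |y| → φ y = 0 := by
  obtain ⟨R, hR⟩ := hφ.isCompact.isBounded.exists_norm_le
  refine ⟨max R 1, lt_max_of_lt_right one_pos, fun x hx => ?_⟩
  by_contra h
  exact absurd (hR x (subset_tsupport _ h)) (not_le.2 ((le_max_left _ _).trans_lt hx))

lemma sum_arith_mul_eq (f g : ArithmeticFunction ℂ) {H : ℝ → ℝ} {N : ℕ}
    (hH : ∀ y, Real.log N ≤ y → H y = 0) :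
    ∑ n ∈ Finset.range N, (f * g) n * (H (Real.log n) : ℂ) =
      ∑ m ∈ Finset.range N, ∑ n ∈ Finset.range N,
        f m * g n * (H (Real.log m + Real.log n) : ℂ) := by
  rw [← Finset.sum_product']
  simp only [ArithmeticFunction.mul_apply, Finset.sum_mul]
  rw [Finset.sum_sigma']
  refine Finset.sum_of_injOn (fun p => p.2) ?_ ?_ ?_ ?_
  · rintro ⟨k, p⟩ hp ⟨k', p'⟩ hp' h
    simp only [Finset.coe_sigma, Set.mem_sigma_iff, Finset.mem_coe,
      Nat.mem_divisorsAntidiagonal] at hp hp' h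
    subst h
    obtain rfl : k = k' := hp.2.1.symm.trans hp'.2.1
    rfl
  · rintro ⟨k, p⟩ hp
    simp only [Finset.coe_sigma, Set.mem_sigma_iff, Finset.mem_coe, Finset.mem_range,
      Nat.mem_divisorsAntidiagonal] at hp
    simp only [Finset.coe_product, Set.mem_prod, Finset.mem_coe, Finset.mem_range]
    obtain ⟨hk, hp, hk0⟩ := hp
    exact ⟨(Nat.le_of_dvd (Nat.pos_of_ne_zero hk0) ⟨_, hp.symm⟩).trans_lt hk,
      (Nat.le_of_dvd (Nat.pos_of_ne_zero hk0) ⟨_, (mul_comm _ _).trans hp |>.symm⟩).trans_lt hk⟩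
  · rintro ⟨m, n⟩ hmn' hmn
    by_cases hm : m = 0
    · simp [hm]
    by_cases hn : n = 0
    · simp [hn]
    have hk : N ≤ m * n := by
      by_contra! hk
      exact hmn ⟨⟨m * n, (m, n)⟩, by simp [hk, hm, hn], rfl⟩
    have hN : 0 < N := by
      simp only [Finset.mem_product, Finset.mem_range] at hmn'
      omega
    rw [hH, Complex.ofReal_zero, mul_zero]
    rw [← Real.log_mul (by exact_mod_cast hm) (by exact_mod_cast hn)]
    exact Real.log_le_log (by exact_mod_cast hN) (by exact_mod_cast hk)
  · rintro ⟨k, p⟩ hp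
    simp only [Finset.mem_sigma, Nat.mem_divisorsAntidiagonal] at hp
    obtain ⟨-, rfl, hp0⟩ := hp
    rw [mul_ne_zero_iff] at hp0
    rw [Nat.cast_mul, Real.log_mul (by exact_mod_cast hp0.1) (by exact_mod_cast hp0.2)]

lemma integral_smoothSum_mul (f g : ArithmeticFunction ℂ) {φ η : ℝ → ℝ}
    (hφ : HasCompactSupport φ) (hη : HasCompactSupport η) (hφc : Continuous φ)
    (hηc : Continuous η) (x : ℝ) :
    ∫ t, smoothSum f φ t * smoothSum g η (x - t) =
      smoothSum (f * g) (φ ⋆[ContinuousLinearMap.mul ℝ ℝ] η) x := by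
  obtain ⟨R₁, hR₁, h1⟩ := exists_support_bound hφ
  obtain ⟨R₂, hR₂, h2⟩ := exists_support_bound hη
  set R := max R₁ R₂
  replace h1 : ∀ y, R < |y| → φ y = 0 := fun y hy => h1 y ((le_max_left _ _).trans_lt hy)
  replace h2 : ∀ y, R < |y| → η y = 0 := fun y hy => h2 y ((le_max_right _ _).trans_lt hy)
  have hR : 0 < R := lt_max_of_lt_left hR₁
  have h3 : ∀ y, 2 * R < |y| → (φ ⋆[ContinuousLinearMap.mul ℝ ℝ] η) y = 0 := by
    intro y hy
    rw [convolution_def]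
    refine integral_eq_zero_of_ae (Filter.Eventually.of_forall fun t => ?_)
    simp only [ContinuousLinearMap.mul_apply', Pi.zero_apply, mul_eq_zero]
    by_contra! h
    have h4 : |t| ≤ R := not_lt.1 fun h5 => h.1 (h1 _ h5)
    have h5 : |y - t| ≤ R := not_lt.1 fun h5 => h.2 (h2 _ h5)
    have := abs_add_le t (y - t)
    rw [add_sub_cancel] at this
    linarith
  obtain ⟨N, hN⟩ := exists_nat_gt (Real.exp (x + 2 * R))
  have hN' : ∀ t, t ≤ x + R → Real.exp (t + R) < N := fun t ht => lt_of_le_of_lt (by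
    apply Real.exp_le_exp.2; linarith) hN
  have h4 : ∀ t, smoothSum f φ t * smoothSum g η (x - t) =
      (∑ n ∈ Finset.range N, f n * (φ (Real.log n - t) : ℂ)) *
        ∑ n ∈ Finset.range N, g n * (η (Real.log n - (x - t)) : ℂ) := by
    intro t
    rcases lt_or_ge t (-R) with ht | ht
    · simp [smoothSum_eq_zero f h1 ht, sum_smooth_eq_zero f h1 ht]
    rcases lt_or_ge (x - t) (-R) with ht' | ht'
    · simp [smoothSum_eq_zero g h2 ht', sum_smooth_eq_zero g h2 ht']
    rw [smoothSum_eq_sum f h1 (hN' t (by linarith)),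
      smoothSum_eq_sum g h2 (hN' _ (by linarith))]
  have h5 : ∀ y₁ y₂ : ℝ, ∫ t, φ (y₁ - t) * η (y₂ - (x - t)) =
      (φ ⋆[ContinuousLinearMap.mul ℝ ℝ] η) (y₁ + y₂ - x) := by
    intro y₁ y₂
    rw [convolution_def, ← integral_sub_left_eq_self _ volume y₁]
    congr 1; ext t
    simp only [ContinuousLinearMap.mul_apply', sub_sub_cancel]
    congr 2; ring
  have h6 : ∀ y₁ y₂ : ℝ, Integrable fun t => φ (y₁ - t) * η (y₂ - (x - t)) := by
    intro y₁ y₂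
    refine Continuous.integrable_of_hasCompactSupport (by fun_prop) ?_
    refine HasCompactSupport.mul_right ?_
    exact hφ.comp_homeomorph (Homeomorph.subLeft y₁)
  simp_rw [h4, Finset.sum_mul_sum]
  rw [smoothSum_eq_sum (f * g) h3 hN, integral_finsetSum]
  swap
  · intro m _
    refine integrable_finsetSum _ fun n _ => ?_
    have := (Complex.ofRealCLM.integrable_comp (h6 (Real.log m) (Real.log n))).const_mul
        (f m * g n)
    refine this.congr (Filter.Eventually.of_forall fun t => ?_)
    simp only [Complex.ofRealCLM_apply]
    push_cast; ring
  have h7 : ∀ m n : ℕ, ∫ t, f m * (φ (Real.log m - t) : ℂ) *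
      (g n * (η (Real.log n - (x - t)) : ℂ)) =
      f m * g n *
        (((φ ⋆[ContinuousLinearMap.mul ℝ ℝ] η) (Real.log m + Real.log n - x) : ℝ) : ℂ) := by
    intro m n
    rw [← h5, ← integral_complex_ofReal, ← integral_const_mul]
    congr 1; ext t; push_cast; ring
  have h8 : ∀ m : ℕ, ∫ t, ∑ n ∈ Finset.range N, f m * (φ (Real.log m - t) : ℂ) *
      (g n * (η (Real.log n - (x - t)) : ℂ)) = ∑ n ∈ Finset.range N,
      f m * g n *
        (((φ ⋆[ContinuousLinearMap.mul ℝ ℝ] η) (Real.log m + Real.log n - x) : ℝ) : ℂ) := by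
    intro m
    rw [integral_finsetSum]
    · simp_rw [h7]
    · intro n _
      have := (Complex.ofRealCLM.integrable_comp (h6 (Real.log m) (Real.log n))).const_mul
        (f m * g n)
      refine this.congr (Filter.Eventually.of_forall fun t => ?_)
      simp only [Complex.ofRealCLM_apply]
      push_cast; ring
  simp_rw [h8]
  symm
  exact sum_arith_mul_eq f g (H := fun y => (φ ⋆[ContinuousLinearMap.mul ℝ ℝ] η) (y - x))
    fun y hy => h3 _ (lt_of_lt_of_le (by
      have := (Real.lt_log_iff_exp_lt ((Real.exp_pos _).trans hN)).2 hN
      linarith) (le_abs_self _))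

lemma integrable_exp_neg_mul_abs {b : ℝ} (hb : 0 < b) :
    Integrable fun t : ℝ => Real.exp (-(b * |t|)) := by
  have h1 : IntegrableOn (fun t : ℝ => Real.exp (-(b * |t|))) (Set.Ioi 0) :=
    (exp_neg_integrableOn_Ioi 0 hb).congr_fun
      (fun t ht => by simp only [abs_of_pos (Set.mem_Ioi.1 ht), neg_mul]) measurableSet_Ioi
  have h2 : IntegrableOn (fun t : ℝ => Real.exp (-(b * |t|))) (Set.Iio 0) := by
    have h3 : IntegrableOn (fun t : ℝ => Real.exp (-(b * |t|))) (Set.Ioi (-0)) := by simpa using h1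
    simpa using h3.comp_neg_Iio
  rw [← integrableOn_univ, ← Set.Iic_union_Ioi (a := (0 : ℝ))]
  exact ((integrableOn_Iic_iff_integrableOn_Iio (by simp)).2 h2).union h1

lemma norm_integral_mul_le_exp {F G : ℝ → ℂ} {a C₁ C₂ : ℝ} (ha : 0 < a)
    (hF : ∀ t, ‖F t‖ ≤ C₁ * Real.exp (-(a * |t|)))
    (hG : ∀ t, ‖G t‖ ≤ C₂ * Real.exp (-(a * |t|))) :
    ∃ C, ∀ x, ‖∫ t, F t * G (x - t)‖ ≤ C * Real.exp (-(a / 2 * |x|)) := by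
  have hC1 : 0 ≤ C₁ := by have := (norm_nonneg _).trans (hF 0); simpa using this
  have hC2 : 0 ≤ C₂ := by have := (norm_nonneg _).trans (hG 0); simpa using this
  have hint : Integrable fun t : ℝ => Real.exp (-(a / 2 * |t|)) :=
    integrable_exp_neg_mul_abs (by linarith)
  refine ⟨C₁ * C₂ * ∫ t : ℝ, Real.exp (-(a / 2 * |t|)), fun x => ?_⟩
  have h1 : ∀ t, ‖F t * G (x - t)‖ ≤
      C₁ * C₂ * Real.exp (-(a / 2 * |x|)) * Real.exp (-(a / 2 * |t|)) := by
    intro t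
    rw [norm_mul]
    calc _ ≤ C₁ * Real.exp (-(a * |t|)) * (C₂ * Real.exp (-(a * |x - t|))) := by
          gcongr
          · exact hF t
          · exact hG _
      _ = C₁ * C₂ * Real.exp (-(a * |t|) - a * |x - t|) := by
          rw [sub_eq_add_neg (-(a * |t|)), Real.exp_add]; ring
      _ ≤ C₁ * C₂ * Real.exp (-(a / 2 * |x|) - a / 2 * |t|) := by
          refine mul_le_mul_of_nonneg_left (Real.exp_le_exp.2 ?_) (by positivity)
          have h2 := abs_add_le t (x - t)
          rw [add_sub_cancel] at h2
          nlinarith [mul_le_mul_of_nonneg_left h2 ha.le, mul_nonneg ha.le (abs_nonneg (x - t))]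
      _ = _ := by rw [sub_eq_add_neg, Real.exp_add]; ring
  refine (norm_integral_le_of_norm_le (hint.const_mul _) (Filter.Eventually.of_forall h1)).trans
    (le_of_eq ?_)
  rw [integral_const_mul]; ring

lemma convolution_pos {φ η : ℝ → ℝ} (hφ : HasCompactSupport φ) (hη : HasCompactSupport η)
    (hφc : Continuous φ) (hηc : Continuous η) (hφ0 : ∀ x, 0 ≤ φ x) (hη0 : ∀ x, 0 ≤ η x)
    (h1 : φ 0 ≠ 0) (h2 : η 0 ≠ 0) :
    HasCompactSupport (φ ⋆[ContinuousLinearMap.mul ℝ ℝ] η) ∧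
    Continuous (φ ⋆[ContinuousLinearMap.mul ℝ ℝ] η) ∧
    (∀ x, 0 ≤ (φ ⋆[ContinuousLinearMap.mul ℝ ℝ] η) x) ∧
    (φ ⋆[ContinuousLinearMap.mul ℝ ℝ] η) 0 ≠ 0 := by
  refine ⟨HasCompactSupport.convolution _ hφ hη, hη.continuous_convolution_right _
    (hφc.integrable_of_hasCompactSupport hφ).locallyIntegrable hηc, fun x => ?_, ?_⟩
  · rw [convolution_def]
    exact integral_nonneg fun t => mul_nonneg (hφ0 _) (hη0 _)
  · rw [convolution_def]
    refine (Continuous.integral_pos_of_hasCompactSupport_nonneg_nonzero (x := 0) ?_ ?_ ?_ ?_).ne'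
    · simp only [ContinuousLinearMap.mul_apply']; fun_prop
    · exact HasCompactSupport.mul_right hφ
    · exact fun t => mul_nonneg (hφ0 _) (hη0 _)
    · simpa using ⟨h1, h2⟩

end SmoothSums

section NonVanishing

open MeasureTheory
open scoped Convolution ComplexOrder ComplexConjugate

/-- Multiplication of an arithmetic function by the logarithm. -/
noncomputable def logMul (f : ArithmeticFunction ℂ) : ArithmeticFunction ℂ :=
  ⟨fun n => f n * Real.log n, by simp⟩

lemma logMul_apply (f : ArithmeticFunction ℂ) (n : ℕ) : logMul f n = f n * Real.log n := rfl

lemma logMul_mul (f g : ArithmeticFunction ℂ) :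
    logMul (f * g) = logMul f * g + f * logMul g := by
  ext n
  simp only [logMul_apply, ArithmeticFunction.mul_apply, ArithmeticFunction.add_apply,
    Finset.sum_mul]
  rw [← Finset.sum_add_distrib]
  refine Finset.sum_congr rfl fun p hp => ?_
  obtain ⟨rfl, hp0⟩ := Nat.mem_divisorsAntidiagonal.1 hp
  rw [mul_ne_zero_iff] at hp0
  rw [Nat.cast_mul, Real.log_mul (by exact_mod_cast hp0.1) (by exact_mod_cast hp0.2)]
  push_cast
  ring

/-- The complex conjugate of an arithmetic function. -/
noncomputable def conjArith (f : ArithmeticFunction ℂ) : ArithmeticFunction ℂ :=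
  ⟨fun n => conj (f n), by simp⟩

lemma conjArith_apply (f : ArithmeticFunction ℂ) (n : ℕ) : conjArith f n = conj (f n) := rfl

lemma conjArith_mul (f g : ArithmeticFunction ℂ) :
    conjArith (f * g) = conjArith f * conjArith g := by
  ext n
  simp [conjArith_apply, ArithmeticFunction.mul_apply]

lemma logMul_conjArith (f : ArithmeticFunction ℂ) :
    logMul (conjArith f) = conjArith (logMul f) := by
  ext n
  simp only [conjArith_apply, logMul_apply, map_mul, Complex.conj_ofReal]

lemma smoothSum_conjArith (f : ArithmeticFunction ℂ) (φ : ℝ → ℝ) (x : ℝ) :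
    smoothSum (conjArith f) φ x = conj (smoothSum f φ x) := by
  simp [smoothSum, conjArith_apply, Complex.conj_tsum]

lemma arith_one_eq_zero {f c : ArithmeticFunction ℂ} (h : logMul f = f * c) (h1 : f 1 = 1) :
    c 1 = 0 := by
  have := congrArg (fun g => g 1) h
  simp only [logMul_apply, ArithmeticFunction.mul_apply_one, h1] at this
  simpa using this.symm

lemma nonneg_of_logMul_eq {r c : ArithmeticFunction ℂ} (h : logMul r = r * c) (h1 : r 1 = 1)
    (hc : ∀ n, 0 ≤ c n) (n : ℕ) : 0 ≤ r n := by
  have hc1 := arith_one_eq_zero h h1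
  induction n using Nat.strong_induction_on with
  | _ n ih =>
    rcases Nat.lt_or_ge n 2 with hn | hn
    · interval_cases n <;> simp [h1]
    have hlog : 0 < Real.log n := Real.log_pos (by exact_mod_cast hn)
    have h2 : r n * Real.log n = (r * c) n := by rw [← h]; rfl
    have h3 : r n = (r * c) n * ((Real.log n)⁻¹ : ℝ) := by
      rw [← h2]; push_cast
      rw [mul_inv_cancel_right₀ (by exact_mod_cast hlog.ne')]
    rw [h3]
    refine mul_nonneg ?_ (by rw [Complex.zero_le_real]; positivity)
    rw [ArithmeticFunction.mul_apply]
    refine Finset.sum_nonneg fun p hp => ?_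
    obtain ⟨hp, hp0⟩ := Nat.mem_divisorsAntidiagonal.1 hp
    by_cases hp2 : p.2 = 1
    · simp [hp2, hc1]
    refine mul_nonneg (ih _ ?_) (hc _)
    have hp1 : p.1 ≠ 0 := by rintro h; simp [h] at hp; omega
    have hp3 : p.2 ≠ 0 := by rintro h; simp [h] at hp; omega
    rw [← hp]
    exact lt_mul_of_one_lt_right (by omega) (by omega)

lemma le_mul_log_of_logMul_eq {r c : ArithmeticFunction ℂ} (h : logMul r = r * c) (h1 : r 1 = 1)
    (hc : ∀ n, 0 ≤ c n) {n : ℕ} (hn : n ≠ 0) : c n ≤ r n * Real.log n := by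
  have h2 : r n * Real.log n = (r * c) n := by rw [← h]; rfl
  rw [h2, ArithmeticFunction.mul_apply]
  have := Finset.single_le_sum (f := fun p : ℕ × ℕ => r p.1 * c p.2)
    (s := n.divisorsAntidiagonal)
    (fun p _ => mul_nonneg (nonneg_of_logMul_eq h h1 hc _) (hc _)) (a := (1, n)) (by simp [hn])
  simpa [h1] using this

lemma smoothSum_re_ge {r : ArithmeticFunction ℂ} (hr : ∀ n, 0 ≤ r n) {φ : ℝ → ℝ}
    (hφ : HasCompactSupport φ) (hφ0 : ∀ x, 0 ≤ φ x) (n : ℕ) :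
    (r n).re * φ 0 ≤ (smoothSum r φ (Real.log n)).re := by
  obtain ⟨R, hR, h⟩ := exists_support_bound hφ
  obtain ⟨N, hN⟩ := exists_nat_gt (max (Real.exp (Real.log n + R)) n)
  rw [smoothSum_eq_sum r h ((le_max_left _ _).trans_lt hN), Complex.re_sum]
  have hn : n < N := by exact_mod_cast (le_max_right _ _).trans_lt hN
  have := Finset.single_le_sum (f := fun m => (r m * (φ (Real.log m - Real.log n) : ℂ)).re)
    (s := Finset.range N) (fun m _ => by
      rw [Complex.re_mul_ofReal]
      exact mul_nonneg (Complex.nonneg_iff.1 (hr m)).1 (hφ0 _)) (a := n) (by simpa using hn)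
  simpa using this

lemma integrable_smoothSum_mul_exp {f : ArithmeticFunction ℂ} {φ : ℝ → ℝ}
    (hφ : HasCompactSupport φ) (hφc : Continuous φ) {C : ℝ}
    (hf : ∀ x, ‖smoothSum f φ x‖ ≤ C * Real.exp (-|x|)) :
    Integrable fun t : ℝ => smoothSum f φ t * (Real.exp (-t) : ℂ) := by
  obtain ⟨R, hR, h⟩ := exists_support_bound hφ
  have hcont := continuous_smoothSum f h hφc
  have hint := (integrable_exp_neg_mul_abs one_pos).const_mul (C * Real.exp R)
  refine hint.mono' (by fun_prop) (Filter.Eventually.of_forall fun t => ?_)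
  have hC : 0 ≤ C := by have := (norm_nonneg _).trans (hf 0); simpa using this
  rcases lt_or_ge t (-R) with ht | ht
  · rw [smoothSum_eq_zero f h ht]; simp; positivity
  · rw [norm_mul, Complex.norm_real, Real.norm_of_nonneg (Real.exp_pos _).le, one_mul]
    calc _ ≤ C * Real.exp (-|t|) * Real.exp R := by
          gcongr
          · exact hf t
          · linarith
      _ = _ := by ring

lemma exists_norm_smoothSum_mul_le {f g : ArithmeticFunction ℂ} {φ : ℝ → ℝ}
    (hφ : HasCompactSupport φ) (hφc : Continuous φ) {C₁ C₂ : ℝ} {ρ : ℂ}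
    (hf : ∀ x, ‖smoothSum f φ x - ρ * Real.exp x‖ ≤ C₁ * Real.exp (-|x|))
    (hg : ∀ x, ‖smoothSum g φ x‖ ≤ C₂ * Real.exp (-|x|))
    (h0 : ∫ t : ℝ, smoothSum g φ t * (Real.exp (-t) : ℂ) = 0) :
    ∃ C, ∀ x, ‖smoothSum (f * g) (φ ⋆[ContinuousLinearMap.mul ℝ ℝ] φ) x‖ ≤
      C * Real.exp (-(1 / 2 * |x|)) := by
  obtain ⟨C, hC⟩ := norm_integral_mul_le_exp (F := fun x => smoothSum f φ x - ρ * Real.exp x)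
    (G := smoothSum g φ) (a := 1) one_pos (by simpa using hf) (by simpa using hg)
  refine ⟨C, fun x => ?_⟩
  convert hC x using 2
  rw [← integral_smoothSum_mul f g hφ hφ hφc hφc]
  obtain ⟨R, hR, h⟩ := exists_support_bound hφ
  have hfc := continuous_smoothSum f h hφc
  have hgc := continuous_smoothSum g h hφc
  have h1 : Integrable fun t => smoothSum f φ t * smoothSum g φ (x - t) := by
    refine Continuous.integrable_of_hasCompactSupport (by fun_prop) ?_
    refine HasCompactSupport.of_support_subset_isCompact (isCompact_Icc (a := -R) (b := x + R)) ?_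
    intro t ht
    rw [Function.mem_support, mul_ne_zero_iff] at ht
    constructor
    · by_contra! h'; exact ht.1 (smoothSum_eq_zero f h h')
    · by_contra! h'; exact ht.2 (smoothSum_eq_zero g h (by linarith))
  have h2 : ∀ t : ℝ, ρ * Real.exp t * smoothSum g φ (x - t) =
      ρ * Real.exp x * (smoothSum g φ (x - t) * (Real.exp (-(x - t)) : ℂ)) := by
    intro t
    have : (Real.exp t : ℂ) = Real.exp x * Real.exp (-(x - t)) := by
      rw [← Complex.ofReal_mul, ← Real.exp_add]; congr 2; ring
    rw [this]; ring
  have h3 : Integrable fun t : ℝ => ρ * Real.exp t * smoothSum g φ (x - t) := by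
    simp_rw [h2]
    exact ((integrable_smoothSum_mul_exp hφ hφc hg).comp_sub_left x).const_mul _
  have h4 : ∫ t : ℝ, ρ * Real.exp t * smoothSum g φ (x - t) = 0 := by
    simp_rw [h2]
    rw [integral_const_mul,
      integral_sub_left_eq_self (fun t : ℝ => smoothSum g φ t * (Real.exp (-t) : ℂ)) volume x,
      h0, mul_zero]
  simp_rw [sub_mul]
  rw [integral_sub h1 h3, h4, sub_zero]

/-- Nonvanishing of the analogue of `L(1, χ)`. -/
theorem integral_smoothSum_ne_zero {f g c d : ArithmeticFunction ℂ} {φ : ℝ → ℝ}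
    (hφ : HasCompactSupport φ) (hφc : Continuous φ) (hφ0 : ∀ x, 0 ≤ φ x) (hφ1 : φ 0 ≠ 0)
    {C₁ C₂ : ℝ} {ρ : ℂ}
    (hf : ∀ x, ‖smoothSum f φ x - ρ * Real.exp x‖ ≤ C₁ * Real.exp (-|x|))
    (hg : ∀ x, ‖smoothSum g φ x‖ ≤ C₂ * Real.exp (-|x|))
    (hf1 : f 1 = 1) (hg1 : g 1 = 1) (hfc : logMul f = f * c) (hgd : logMul g = g * d)
    (hcd : ∀ n, 0 ≤ c n + d n + conj (c n + d n))
    {n₀ : ℕ} (hn₀ : 2 ≤ n₀) {c₀ : ℝ} (hc₀ : 0 < c₀)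
    (hcn : ∀ j : ℕ, 1 ≤ j → (c₀ : ℂ) ≤ c (n₀ ^ j) + d (n₀ ^ j) + conj (c (n₀ ^ j) + d (n₀ ^ j))) :
    ∫ t : ℝ, smoothSum g φ t * (Real.exp (-t) : ℂ) ≠ 0 := by
  intro h0
  obtain ⟨C, hC⟩ := exists_norm_smoothSum_mul_le hφ hφc hf hg h0
  obtain ⟨h21, h22, h23, h24⟩ := convolution_pos hφ hφ hφc hφc hφ0 hφ0 hφ1 hφ1
  set φ₂ := φ ⋆[ContinuousLinearMap.mul ℝ ℝ] φ
  obtain ⟨h41, h42, h43, h44⟩ := convolution_pos h21 h21 h22 h22 h23 h23 h24 h24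
  set φ₄ := φ₂ ⋆[ContinuousLinearMap.mul ℝ ℝ] φ₂
  set q := f * g with hq
  set r := q * conjArith q with hr
  obtain ⟨C', hC'⟩ := norm_integral_mul_le_exp (F := smoothSum q φ₂)
    (G := smoothSum (conjArith q) φ₂) (a := 1 / 2) (by norm_num) hC
    (by intro t; rw [smoothSum_conjArith, RCLike.norm_conj]; exact hC t)
  simp_rw [integral_smoothSum_mul _ _ h21 h21 h22 h22] at hC'
  have hq' : logMul q = q * (c + d) := by rw [hq, logMul_mul, hfc, hgd]; ring
  set e := c + d + conjArith (c + d) with he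
  have hre : logMul r = r * e := by
    rw [hr, logMul_mul, logMul_conjArith, hq', conjArith_mul q (c + d), he]; ring
  have hq1 : q 1 = 1 := by rw [hq, ArithmeticFunction.mul_apply_one, hf1, hg1, one_mul]
  have hr1 : r 1 = 1 := by
    rw [hr, ArithmeticFunction.mul_apply_one, conjArith_apply, hq1]; simp
  have he0 : ∀ n, 0 ≤ e n := hcd
  have hlog : 0 < Real.log n₀ := Real.log_pos (by exact_mod_cast hn₀)
  have h4pos : 0 < φ₄ 0 := lt_of_le_of_ne (h43 0) h44.symm
  have key : ∀ j : ℕ, 1 ≤ j →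
      c₀ * φ₄ 0 ≤ C' * ((j * Real.log n₀) * Real.exp (-(1 / 4 * (j * Real.log n₀)))) := by
    intro j hj
    have hlogj : Real.log ((n₀ ^ j : ℕ) : ℝ) = j * Real.log n₀ := by push_cast; rw [Real.log_pow]
    have hj0 : 0 < (j : ℝ) * Real.log n₀ := by have : 0 < (j : ℝ) := by exact_mod_cast hj
                                               positivity
    have h1 := (hcn j hj).trans
      (le_mul_log_of_logMul_eq hre hr1 he0 (n := n₀ ^ j) (by positivity))
    have h2 := (Complex.le_def.1 h1).1
    rw [Complex.re_mul_ofReal, Complex.ofReal_re, hlogj] at h2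
    have h3 := smoothSum_re_ge (nonneg_of_logMul_eq hre hr1 he0) h41 h43 (n₀ ^ j)
    have h4 := (h3.trans (Complex.re_le_norm _)).trans (hC' _)
    rw [hlogj, abs_of_pos hj0] at h4
    calc c₀ * φ₄ 0 ≤ (r (n₀ ^ j)).re * (j * Real.log n₀) * φ₄ 0 := by gcongr
      _ = (r (n₀ ^ j)).re * φ₄ 0 * (j * Real.log n₀) := by ring
      _ ≤ C' * Real.exp (-(1 / 2 / 2 * (j * Real.log n₀))) * (j * Real.log n₀) := by gcongr
      _ = _ := by rw [show (1 / 2 / 2 : ℝ) = 1 / 4 by norm_num]; ring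
  have hlim : Filter.Tendsto (fun j : ℕ => C' * ((j * Real.log n₀) *
      Real.exp (-(1 / 4 * (j * Real.log n₀))))) Filter.atTop (nhds 0) := by
    have h1 := Real.tendsto_pow_mul_exp_neg_atTop_nhds_zero 1
    have h2 : Filter.Tendsto (fun j : ℕ => 1 / 4 * ((j : ℝ) * Real.log n₀)) Filter.atTop
        Filter.atTop :=
      (tendsto_natCast_atTop_atTop.atTop_mul_const hlog).const_mul_atTop (by norm_num)
    have h3 := (h1.comp h2).const_mul (C' * 4)
    rw [mul_zero] at h3
    refine h3.congr fun j => ?_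
    simp only [Function.comp, pow_one]; ring
  have h5 : c₀ * φ₄ 0 ≤ 0 := ge_of_tendsto hlim (Filter.eventually_atTop.2 ⟨1, key⟩)
  have : 0 < c₀ * φ₄ 0 := by positivity
  linarith

end NonVanishing

section Mertens

open MeasureTheory
open scoped Convolution ComplexOrder ComplexConjugate

lemma smoothSum_logMul (f : ArithmeticFunction ℂ) {φ : ℝ → ℝ} (hφ : HasCompactSupport φ) (y : ℝ) :
    smoothSum (logMul f) φ y = y * smoothSum f φ y + smoothSum f (fun t => t * φ t) y := by
  obtain ⟨R, hR, h⟩ := exists_support_bound hφ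
  obtain ⟨N, hN⟩ := exists_nat_gt (Real.exp (y + R))
  rw [smoothSum_eq_sum _ h hN, smoothSum_eq_sum _ h hN,
    smoothSum_eq_sum (φ := fun t => t * φ t) (R := R) _ (fun t ht => by rw [h t ht, mul_zero]) hN,
    Finset.mul_sum, ← Finset.sum_add_distrib]
  refine Finset.sum_congr rfl fun n _ => ?_
  rw [logMul_apply]
  push_cast
  ring

lemma smoothSum_mul (f c : ArithmeticFunction ℂ) {φ : ℝ → ℝ} {R : ℝ}
    (h : ∀ y, R < |y| → φ y = 0) {y : ℝ} {N : ℕ} (hN : Real.exp (y + R) < N) :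
    smoothSum (f * c) φ y = ∑ k ∈ Finset.range N, c k * smoothSum f φ (y - Real.log k) := by
  rw [smoothSum_eq_sum _ h hN]
  rw [sum_arith_mul_eq f c (H := fun t => φ (t - y)) fun t ht => h _ (lt_of_lt_of_le (by
      have := (Real.lt_log_iff_exp_lt ((Real.exp_pos _).trans hN)).2 hN
      linarith) (le_abs_self _)), Finset.sum_comm]
  refine Finset.sum_congr rfl fun k _ => ?_
  rw [smoothSum_eq_sum _ h (N := N) (lt_of_le_of_lt (Real.exp_le_exp.2 (by
    linarith [Real.log_natCast_nonneg k])) hN), Finset.mul_sum]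
  refine Finset.sum_congr rfl fun m _ => ?_
  rw [show Real.log m + Real.log k - y = Real.log m - (y - Real.log k) by ring]
  ring

lemma norm_sum_div_sub_le {c : ArithmeticFunction ℂ} {l : ℕ → ℝ} (hl : ∀ n, ‖c n‖ ≤ l n)
    {K : ℝ} (hK : ∀ X : ℝ, 0 ≤ X → ∑ n ∈ Finset.Icc 1 ⌊X⌋₊, l n ≤ K * X)
    {W : ℝ → ℂ} {L : ℂ} {R C : ℝ} (hC : 0 ≤ C) (hR : 0 ≤ R) (hW0 : ∀ u < -R, W u = 0)
    (hW : ∀ u, -R ≤ u → ‖W u - if 0 ≤ u then L else 0‖ ≤ C * Real.exp (-u))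
    {x : ℝ} {N : ℕ} (hN : Real.exp (x + R) < N) :
    ‖∑ n ∈ Finset.range N, c n / n * W (x - Real.log n) -
      L * ∑ n ∈ Finset.Icc 1 ⌊Real.exp x⌋₊, c n / n‖ ≤ C * K * Real.exp R := by
  have hmem : ∀ (z : ℝ) (n : ℕ), n ∈ Finset.Icc 1 ⌊Real.exp z⌋₊ ↔ 1 ≤ n ∧ Real.log n ≤ z := by
    intro z n
    rw [Finset.mem_Icc]
    refine and_congr_right fun hn => ?_
    rw [Nat.le_floor_iff (Real.exp_pos _).le, Real.log_le_iff_le_exp (by exact_mod_cast hn)]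
  have hsub : ∀ z ≤ x + R, Finset.Icc 1 ⌊Real.exp z⌋₊ ⊆ Finset.range N := by
    intro z hz n hn
    rw [Finset.mem_range]
    have := Nat.floor_le (Real.exp_pos z).le
    have h2 : (n : ℝ) ≤ ⌊Real.exp z⌋₊ := by exact_mod_cast (Finset.mem_Icc.1 hn).2
    have h3 := Real.exp_le_exp.2 hz
    exact_mod_cast (by linarith : (n : ℝ) < N)
  have h1 : L * ∑ n ∈ Finset.Icc 1 ⌊Real.exp x⌋₊, c n / n =
      ∑ n ∈ Finset.range N, c n / n * if 0 ≤ x - Real.log n then L else 0 := by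
    rw [Finset.mul_sum, ← Finset.sum_subset (hsub x (by linarith))]
    · refine Finset.sum_congr rfl fun n hn => ?_
      rw [if_pos (by linarith [((hmem x n).1 hn).2]), mul_comm]
    · intro n _ hn
      by_cases h0 : n = 0
      · simp [h0]
      rw [if_neg, mul_zero]
      intro h2
      exact hn ((hmem x n).2 ⟨Nat.pos_of_ne_zero h0, by linarith⟩)
  rw [h1, ← Finset.sum_sub_distrib]
  have h2 : ∀ n ∈ Finset.Icc 1 ⌊Real.exp (x + R)⌋₊,
      ‖c n / n * W (x - Real.log n) - c n / n * if 0 ≤ x - Real.log n then L else 0‖ ≤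
      l n * (C * Real.exp (-x)) := by
    intro n hn
    obtain ⟨hn1, hn2⟩ := (hmem _ _).1 hn
    have hn0 : 0 < (n : ℝ) := by exact_mod_cast hn1
    rw [← mul_sub, norm_mul, norm_div, Complex.norm_natCast]
    calc _ ≤ l n / n * (C * Real.exp (-(x - Real.log n))) := by
          gcongr
          · exact div_nonneg ((norm_nonneg _).trans (hl n)) hn0.le
          · exact hl n
          · exact hW _ (by linarith)
      _ = _ := by
          rw [neg_sub, sub_eq_add_neg, Real.exp_add, Real.exp_log hn0]
          field_simp
  rw [← Finset.sum_subset (hsub (x + R) le_rfl)]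
  · refine (norm_sum_le_of_le _ h2).trans ?_
    rw [← Finset.sum_mul]
    calc _ ≤ K * Real.exp (x + R) * (C * Real.exp (-x)) := by
          gcongr
          exact hK _ (Real.exp_pos _).le
      _ = C * K * (Real.exp (x + R) * Real.exp (-x)) := by ring
      _ = _ := by rw [← Real.exp_add]; congr 2; ring
  · intro n _ hn
    by_cases h0 : n = 0
    · simp [h0]
    have h3 : x + R < Real.log n := by
      by_contra! h3
      exact hn ((hmem _ n).2 ⟨Nat.pos_of_ne_zero h0, h3⟩)
    rw [hW0 _ (by linarith), if_neg (by linarith)]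
    simp

/-- Mertens' theorem in the case of a pole. -/
lemma exists_norm_mertens_pole_le {f c : ArithmeticFunction ℂ} (hfc : logMul f = f * c)
    {l : ℕ → ℝ} (hl : ∀ n, ‖c n‖ ≤ l n)
    {K : ℝ} (hK : ∀ X : ℝ, 0 ≤ X → ∑ n ∈ Finset.Icc 1 ⌊X⌋₊, l n ≤ K * X)
    {φ : ℝ → ℝ} (hφ : HasCompactSupport φ) {C C' : ℝ} {ρ ρ' : ℂ} (hρ : ρ ≠ 0)
    (hf : ∀ x, ‖smoothSum f φ x - ρ * Real.exp x‖ ≤ C * Real.exp (-|x|))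
    (hf' : ∀ x, ‖smoothSum f (fun t => t * φ t) x - ρ' * Real.exp x‖ ≤ C' * Real.exp (-|x|)) :
    ∃ B, ∀ x : ℝ, 0 ≤ x → ‖∑ n ∈ Finset.Icc 1 ⌊Real.exp x⌋₊, c n / n - x‖ ≤ B := by
  obtain ⟨R, hR, h⟩ := exists_support_bound hφ
  have hC : 0 ≤ C := by have := (norm_nonneg _).trans (hf 0); simpa using this
  have hC' : 0 ≤ C' := by have := (norm_nonneg _).trans (hf' 0); simpa using this
  set W : ℝ → ℂ := fun u => Real.exp (-u) * smoothSum f φ u with hWdef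
  have hW0 : ∀ u < -R, W u = 0 := fun u hu => by simp [hWdef, smoothSum_eq_zero f h hu]
  have hW : ∀ u, -R ≤ u → ‖W u - if 0 ≤ u then ρ else 0‖ ≤ (C + ‖ρ‖) * Real.exp (-u) := by
    intro u hu
    split_ifs with hu0
    · have h1 : W u - ρ = Real.exp (-u) * (smoothSum f φ u - ρ * Real.exp u) := by
        have : (Real.exp (-u) : ℂ) * Real.exp u = 1 := by
          rw [← Complex.ofReal_mul, ← Real.exp_add]; simp
        rw [mul_sub, mul_left_comm, this, mul_one]
      rw [h1, norm_mul, Complex.norm_real, Real.norm_of_nonneg (Real.exp_pos _).le, mul_comm]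
      gcongr
      refine (hf u).trans ?_
      have : Real.exp (-|u|) ≤ 1 := by simp
      nlinarith [norm_nonneg ρ]
    · rw [sub_zero, norm_mul, Complex.norm_real, Real.norm_of_nonneg (Real.exp_pos _).le, mul_comm]
      gcongr
      have h1 := norm_sub_norm_le (smoothSum f φ u) (ρ * Real.exp u)
      have h2 := hf u
      rw [norm_mul, Complex.norm_real, Real.norm_of_nonneg (Real.exp_pos _).le] at h1
      have h3 : Real.exp (-|u|) ≤ 1 := by simp
      have h4 : Real.exp u ≤ 1 := by simp; linarith
      nlinarith [norm_nonneg ρ, mul_le_mul_of_nonneg_left h4 (norm_nonneg ρ)]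
  refine ⟨((C + ‖ρ‖) * K * Real.exp R + (C + C' + ‖ρ'‖)) / ‖ρ‖, fun x hx => ?_⟩
  obtain ⟨N, hN⟩ := exists_nat_gt (Real.exp (x + R))
  have h1 := norm_sum_div_sub_le hl hK (by positivity) hR.le hW0 hW hN
  have h2 : ∑ n ∈ Finset.range N, c n / n * W (x - Real.log n) =
      Real.exp (-x) * (x * smoothSum f φ x + smoothSum f (fun t => t * φ t) x) := by
    rw [← smoothSum_logMul f hφ, hfc, smoothSum_mul f c h hN, Finset.mul_sum]
    refine Finset.sum_congr rfl fun n _ => ?_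
    by_cases hn : n = 0
    · simp [hn]
    have hn0 : 0 < (n : ℝ) := by exact_mod_cast Nat.pos_of_ne_zero hn
    rw [hWdef]
    simp only
    rw [neg_sub, sub_eq_add_neg, Real.exp_add, Real.exp_log hn0]
    have : (n : ℂ) ≠ 0 := by exact_mod_cast hn
    push_cast
    field_simp
  have h3 : ‖(Real.exp (-x) : ℂ) * (x * smoothSum f φ x + smoothSum f (fun t => t * φ t) x) -
      ρ * x‖ ≤ C + C' + ‖ρ'‖ := by
    have e1 : (Real.exp (-x) : ℂ) * Real.exp x = 1 := by
      rw [← Complex.ofReal_mul, ← Real.exp_add]; simp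
    have e2 : (Real.exp (-x) : ℂ) * (x * smoothSum f φ x + smoothSum f (fun t => t * φ t) x) -
        ρ * x = (Real.exp (-x) * x : ℝ) * (smoothSum f φ x - ρ * Real.exp x) +
          (Real.exp (-x) : ℝ) * (smoothSum f (fun t => t * φ t) x - ρ' * Real.exp x) + ρ' := by
      push_cast at e1 ⊢
      linear_combination (ρ * x + ρ') * e1
    rw [e2]
    refine (norm_add₃_le).trans ?_
    rw [norm_mul, norm_mul, Complex.norm_real, Complex.norm_real,
      Real.norm_of_nonneg (by positivity), Real.norm_of_nonneg (by positivity)]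
    have e3 : Real.exp (-|x|) ≤ 1 := by simp
    have e4 : Real.exp (-x) ≤ 1 := by simpa using hx
    have e5 : Real.exp (-x) * x ≤ 1 := by
      rw [Real.exp_neg, inv_mul_le_iff₀ (Real.exp_pos _)]
      linarith [Real.add_one_le_exp x]
    gcongr
    · calc _ ≤ 1 * (C * 1) := by
            refine mul_le_mul e5 ((hf x).trans ?_) (norm_nonneg _) zero_le_one
            gcongr
        _ = C := by ring
    · calc _ ≤ 1 * (C' * 1) := by
            refine mul_le_mul e4 ((hf' x).trans ?_) (norm_nonneg _) zero_le_one
            gcongr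
        _ = C' := by ring
  rw [h2] at h1
  have hρ0 : 0 < ‖ρ‖ := norm_pos_iff.2 hρ
  rw [le_div_iff₀ hρ0, mul_comm, ← norm_mul, mul_sub]
  calc _ = ‖((Real.exp (-x) : ℂ) * (x * smoothSum f φ x + smoothSum f (fun t => t * φ t) x) -
      ρ * x) - ((Real.exp (-x) : ℂ) * (x * smoothSum f φ x + smoothSum f (fun t => t * φ t) x) -
        ρ * ∑ n ∈ Finset.Icc 1 ⌊Real.exp x⌋₊, c n / n)‖ := by congr 1; ring
    _ ≤ _ := (norm_sub_le _ _).trans (by linarith)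

/-- Mertens' theorem in the absence of a pole. -/
lemma exists_norm_mertens_no_pole_le {f c : ArithmeticFunction ℂ} (hfc : logMul f = f * c)
    {l : ℕ → ℝ} (hl : ∀ n, ‖c n‖ ≤ l n)
    {K : ℝ} (hK : ∀ X : ℝ, 0 ≤ X → ∑ n ∈ Finset.Icc 1 ⌊X⌋₊, l n ≤ K * X)
    {φ : ℝ → ℝ} (hφ : HasCompactSupport φ) (hφc : Continuous φ) {C C' : ℝ}
    (hf : ∀ x, ‖smoothSum f φ x‖ ≤ C * Real.exp (-|x|))
    (hf' : ∀ x, ‖smoothSum f (fun t => t * φ t) x‖ ≤ C' * Real.exp (-|x|))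
    (hL : ∫ t : ℝ, smoothSum f φ t * (Real.exp (-t) : ℂ) ≠ 0) :
    ∃ B, ∀ x : ℝ, 0 ≤ x → ‖∑ n ∈ Finset.Icc 1 ⌊Real.exp x⌋₊, c n / n‖ ≤ B := by
  obtain ⟨R, hR, h⟩ := exists_support_bound hφ
  have hC : 0 ≤ C := by have := (norm_nonneg _).trans (hf 0); simpa using this
  have hC' : 0 ≤ C' := by have := (norm_nonneg _).trans (hf' 0); simpa using this
  set F : ℝ → ℂ := fun t => smoothSum f φ t * (Real.exp (-t) : ℂ) with hF
  have hFi : Integrable F := integrable_smoothSum_mul_exp hφ hφc hf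
  set L := ∫ t : ℝ, F t
  set W : ℝ → ℂ := fun u => ∫ t in Set.Iic u, F t with hWdef
  have hW0 : ∀ u < -R, W u = 0 := fun u hu => by
    refine setIntegral_eq_zero_of_forall_eq_zero fun t ht => ?_
    simp only [hF]
    rw [smoothSum_eq_zero f h (lt_of_le_of_lt ht hu), zero_mul]
  set A := ∫ t, ‖F t‖
  have hA : 0 ≤ A := integral_nonneg fun _ => norm_nonneg _
  have hW : ∀ u, -R ≤ u → ‖W u - if 0 ≤ u then L else 0‖ ≤ (C + A) * Real.exp (-u) := by
    intro u hu
    split_ifs with hu0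
    · have h1 : W u - L = - ∫ t in Set.Ioi u, F t := by
        have h2 : W u + ∫ t in Set.Ioi u, F t = L :=
          intervalIntegral.integral_Iic_add_Ioi hFi.integrableOn hFi.integrableOn
        linear_combination h2
      rw [h1, norm_neg]
      have h2 : ‖∫ t in Set.Ioi u, F t‖ ≤ ∫ t in Set.Ioi u, C * Real.exp (-t) := by
        refine norm_integral_le_of_norm_le ?_ ?_
        · exact ((integrableOn_exp_neg_Ioi u)).const_mul C
        · refine (ae_restrict_iff' measurableSet_Ioi).2 (Filter.Eventually.of_forall fun t ht => ?_)
          have ht0 : 0 ≤ t := hu0.trans (le_of_lt ht)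
          simp only [hF]
          rw [norm_mul, Complex.norm_real, Real.norm_of_nonneg (Real.exp_pos _).le]
          gcongr
          refine (hf t).trans ?_
          have : Real.exp (-|t|) ≤ 1 := by simp
          nlinarith
      rw [integral_const_mul, integral_exp_neg_Ioi] at h2
      nlinarith [Real.exp_pos (-u)]
    · rw [sub_zero]
      have h1 : ‖W u‖ ≤ A := (norm_integral_le_integral_norm _).trans
        (setIntegral_le_integral hFi.norm (Filter.Eventually.of_forall fun _ => norm_nonneg _))
      have h2 : 1 ≤ Real.exp (-u) := by simp; linarith
      nlinarith
  set G : ℝ → ℂ := fun t =>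
    Real.exp (-t) * (t * smoothSum f φ t + smoothSum f (fun t => t * φ t) t) with hG
  set B₀ := ∫ t : ℝ, Real.exp R * (2 * C + C') * Real.exp (-(1 / 2 * |t|)) with hB₀
  have hGb : ∀ t, ‖G t‖ ≤ Real.exp R * (2 * C + C') * Real.exp (-(1 / 2 * |t|)) := by
    intro t
    rcases lt_or_ge t (-R) with ht | ht
    · simp only [hG]
      rw [smoothSum_eq_zero f h ht,
        smoothSum_eq_zero (φ := fun t => t * φ t) (R := R) f
          (fun t ht => by rw [h t ht, mul_zero]) ht]
      simp only [mul_zero, add_zero, norm_zero]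
      positivity
    · simp only [hG]
      rw [norm_mul, Complex.norm_real, Real.norm_of_nonneg (Real.exp_pos _).le, mul_assoc]
      gcongr
      · linarith
      · refine (norm_add_le _ _).trans ?_
        rw [norm_mul, Complex.norm_real, Real.norm_eq_abs]
        have e1 : |t| ≤ 2 * Real.exp (1 / 2 * |t|) := by
          linarith [Real.add_one_le_exp (1 / 2 * |t|)]
        have e2 : Real.exp (-|t|) = Real.exp (-(1 / 2 * |t|)) * Real.exp (-(1 / 2 * |t|)) := by
          rw [← Real.exp_add]; congr 1; ring
        have e3 : Real.exp (1 / 2 * |t|) * Real.exp (-(1 / 2 * |t|)) = 1 := by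
          rw [← Real.exp_add]; simp
        have e4 : Real.exp (-(1 / 2 * |t|)) ≤ 1 := by simp
        calc _ ≤ 2 * Real.exp (1 / 2 * |t|) * (C * Real.exp (-|t|)) + C' * Real.exp (-|t|) := by
              gcongr
              · exact hf t
              · exact hf' t
          _ = 2 * C * Real.exp (-(1 / 2 * |t|)) * (Real.exp (1 / 2 * |t|) *
                Real.exp (-(1 / 2 * |t|))) +
                C' * (Real.exp (-(1 / 2 * |t|)) * Real.exp (-(1 / 2 * |t|))) := by
              rw [e2]; ring
          _ ≤ 2 * C * Real.exp (-(1 / 2 * |t|)) * 1 + C' * (1 * Real.exp (-(1 / 2 * |t|))) := by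
              rw [e3]; gcongr
          _ = _ := by ring
  have hEi := (integrable_exp_neg_mul_abs (b := 1 / 2) (by norm_num)).const_mul
    (Real.exp R * (2 * C + C'))
  refine ⟨((C + A) * K * Real.exp R + B₀) / ‖L‖, fun x hx => ?_⟩
  obtain ⟨N, hN⟩ := exists_nat_gt (Real.exp (x + R))
  have h1 := norm_sum_div_sub_le hl hK (by positivity) hR.le hW0 hW hN
  have h2 : ∑ n ∈ Finset.range N, c n / n * W (x - Real.log n) = ∫ t in Set.Iic x, G t := by
    have e1 : ∀ n ∈ Finset.range N, c n / n * W (x - Real.log n) =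
        ∫ t in Set.Iic x, c n / n * F (t - Real.log n) := by
      intro n _
      rw [integral_const_mul]
      congr 1
      have := (measurePreserving_sub_right volume (Real.log n)).setIntegral_preimage_emb
        (measurableEmbedding_subRight _) F (Set.Iic (x - Real.log n))
      rw [hWdef]
      simp only
      rw [← this]
      congr 2
      ext t; simp
    rw [Finset.sum_congr rfl e1, ← integral_finsetSum]
    · refine setIntegral_congr_fun measurableSet_Iic fun t ht => ?_
      simp only [hG]
      rw [← smoothSum_logMul f hφ, hfc, smoothSum_mul f c h (N := N)
        (lt_of_le_of_lt (Real.exp_le_exp.2 (by linarith [Set.mem_Iic.1 ht])) hN), Finset.mul_sum]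
      refine Finset.sum_congr rfl fun n _ => ?_
      by_cases hn : n = 0
      · simp [hn]
      have hn0 : 0 < (n : ℝ) := by exact_mod_cast Nat.pos_of_ne_zero hn
      simp only [hF]
      rw [neg_sub, sub_eq_add_neg (Real.log n), Real.exp_add, Real.exp_log hn0]
      have : (n : ℂ) ≠ 0 := by exact_mod_cast hn
      push_cast
      field_simp
    · intro n _
      exact ((hFi.comp_sub_right _).const_mul _).integrableOn
  have h3 : ‖∫ t in Set.Iic x, G t‖ ≤ B₀ := by
    refine (norm_integral_le_of_norm_le hEi.integrableOn (Filter.Eventually.of_forall hGb)).trans ?_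
    exact setIntegral_le_integral hEi (Filter.Eventually.of_forall fun t => by
      simp only [Pi.zero_apply]; positivity)
  rw [h2] at h1
  have hL0 : 0 < ‖L‖ := norm_pos_iff.2 hL
  rw [le_div_iff₀ hL0, mul_comm, ← norm_mul]
  calc _ = ‖(∫ t in Set.Iic x, G t) - ((∫ t in Set.Iic x, G t) -
        L * ∑ n ∈ Finset.Icc 1 ⌊Real.exp x⌋₊, c n / n)‖ := by congr 1; ring
    _ ≤ _ := (norm_sub_le _ _).trans (by linarith)

end Mertens

section GroupMertens

open MeasureTheory
open scoped ContDiff ComplexOrder ComplexConjugate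

variable {G : Type*} [AddCommGroup G] [Fintype G]

/-- The twist of a family of arithmetic functions indexed by a finite group by a character. -/
noncomputable def charTwist (A : G → ArithmeticFunction ℝ) (χ : AddChar G ℂ) :
    ArithmeticFunction ℂ :=
  ⟨fun n => ∑ g, χ g * (A g n : ℂ), by simp⟩

lemma charTwist_apply (A : G → ArithmeticFunction ℝ) (χ : AddChar G ℂ) (n : ℕ) :
    charTwist A χ n = ∑ g, χ g * (A g n : ℂ) := rfl

lemma logMul_charTwist {A V : G → ArithmeticFunction ℝ}
    (h : ∀ g n, A g n * Real.log n = ∑ p ∈ n.divisorsAntidiagonal, ∑ h, A h p.1 * V (g - h) p.2)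
    (χ : AddChar G ℂ) : logMul (charTwist A χ) = charTwist A χ * charTwist V χ := by
  ext n
  rw [logMul_apply, ArithmeticFunction.mul_apply, charTwist_apply, Finset.sum_mul]
  have h' : ∀ g, χ g * (A g n : ℂ) * ((Real.log n : ℝ) : ℂ) =
      ∑ p ∈ n.divisorsAntidiagonal, ∑ x, χ g * ((A x p.1 : ℂ) * (V (g - x) p.2 : ℂ)) := by
    intro g
    rw [mul_assoc, ← Complex.ofReal_mul, h]
    simp_rw [← Finset.mul_sum]
    push_cast
    rfl
  rw [Finset.sum_congr rfl fun g _ => h' g, Finset.sum_comm]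
  simp_rw [charTwist_apply]
  refine Finset.sum_congr rfl fun p _ => ?_
  rw [Finset.sum_comm]
  simp_rw [Finset.sum_mul_sum]
  refine Finset.sum_congr rfl fun x _ => ?_
  rw [← (Equiv.subRight x).sum_comp fun g => χ x * (A x p.1 : ℂ) * (χ g * (V g p.2 : ℂ))]
  refine Finset.sum_congr rfl fun g _ => ?_
  simp only [Equiv.subRight_apply]
  have : χ g = χ x * χ (g - x) := by rw [← AddChar.map_add_eq_mul]; congr 1; abel
  rw [this]
  ring

lemma charTwist_one {A : G → ArithmeticFunction ℝ} [DecidableEq G]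
    (hA1 : ∀ g, A g 1 = if g = 0 then 1 else 0) (χ : AddChar G ℂ) : charTwist A χ 1 = 1 := by
  simp [charTwist_apply, hA1, apply_ite Complex.ofReal]

lemma smoothSum_charTwist (A : G → ArithmeticFunction ℝ) (χ : AddChar G ℂ) {φ : ℝ → ℝ}
    (hφ : HasCompactSupport φ) (x : ℝ) :
    smoothSum (charTwist A χ) φ x =
      ∑ g, χ g * ((∑' n : ℕ, A g n * φ (Real.log n - x) : ℝ) : ℂ) := by
  obtain ⟨R, hR, h⟩ := exists_support_bound hφ
  obtain ⟨N, hN⟩ := exists_nat_gt (Real.exp (x + R))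
  have h1 : ∀ g, ∑' n : ℕ, A g n * φ (Real.log n - x) =
      ∑ n ∈ Finset.range N, A g n * φ (Real.log n - x) := by
    intro g
    refine tsum_eq_sum fun n hn => ?_
    rw [Finset.mem_range, not_lt] at hn
    rw [h, mul_zero]
    refine lt_of_lt_of_le ?_ (le_abs_self _)
    have h1 : Real.exp (x + R) < n := hN.trans_le (by exact_mod_cast hn)
    have := (Real.lt_log_iff_exp_lt ((Real.exp_pos _).trans h1)).2 h1
    linarith
  simp_rw [h1, Complex.ofReal_sum, Finset.mul_sum]
  rw [smoothSum_eq_sum _ h hN, Finset.sum_comm]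
  refine Finset.sum_congr rfl fun n _ => ?_
  rw [charTwist_apply, Finset.sum_mul]
  refine Finset.sum_congr rfl fun g _ => ?_
  push_cast; ring

open Classical in
lemma exists_norm_smoothSum_charTwist_le {A : G → ArithmeticFunction ℝ} (χ : AddChar G ℂ)
    {φ : ℝ → ℝ} (hφ : HasCompactSupport φ) (hφc : Continuous φ) {ρ C : ℝ}
    (h : ∀ g x, 0 ≤ x →
      |∑' n : ℕ, A g n * φ (Real.log n - x) - ρ * Real.exp x| ≤ C * Real.exp (-x)) :
    ∃ C' : ℝ, ∀ x, ‖smoothSum (charTwist A χ) φ x -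
      (if χ = 0 then (Fintype.card G * ρ : ℂ) else 0) * Real.exp x‖ ≤ C' * Real.exp (-|x|) := by
  set σ : ℂ := if χ = 0 then (Fintype.card G * ρ : ℂ) else 0 with hσ
  have hσ' : σ = ∑ g, χ g * ρ := by
    rw [← Finset.sum_mul, AddChar.sum_eq_ite, hσ]
    split_ifs <;> simp
  obtain ⟨R, hR, hs⟩ := exists_support_bound hφ
  have hcont := continuous_smoothSum (charTwist A χ) hs hφc
  obtain ⟨B, hB⟩ := (isCompact_Icc (a := -R) (b := 0)).exists_bound_of_continuousOn
    (f := fun x : ℝ => smoothSum (charTwist A χ) φ x - σ * Real.exp x)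
    (Continuous.continuousOn (by fun_prop))
  have hC : 0 ≤ C := by have := (abs_nonneg _).trans (h 0 0 le_rfl); simpa using this
  have hB0 : 0 ≤ B := (norm_nonneg _).trans (hB 0 ⟨by linarith, le_rfl⟩)
  refine ⟨Fintype.card G * C + ‖σ‖ + B * Real.exp R, fun x => ?_⟩
  rcases le_or_gt 0 x with hx | hx
  · rw [abs_of_nonneg hx]
    have h1 : ‖smoothSum (charTwist A χ) φ x - σ * Real.exp x‖ ≤
        ∑ g : G, C * Real.exp (-x) := by
      rw [smoothSum_charTwist A χ hφ, hσ', Finset.sum_mul, ← Finset.sum_sub_distrib]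
      refine norm_sum_le_of_le _ fun g _ => ?_
      rw [mul_assoc, ← mul_sub, norm_mul, AddChar.norm_apply, one_mul, ← Complex.ofReal_mul,
        ← Complex.ofReal_sub, Complex.norm_real]
      exact h g x hx
    rw [Finset.sum_const, Finset.card_univ, nsmul_eq_mul, ← mul_assoc] at h1
    refine h1.trans ?_
    gcongr
    have := norm_nonneg σ
    have : 0 ≤ B * Real.exp R := by positivity
    linarith
  · rw [abs_of_neg hx, neg_neg]
    rcases lt_or_ge x (-R) with hx' | hx'
    · rw [smoothSum_eq_zero _ hs hx', zero_sub, norm_neg, norm_mul, Complex.norm_real,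
        Real.norm_of_nonneg (Real.exp_pos _).le]
      gcongr
      have : 0 ≤ B * Real.exp R := by positivity
      have : 0 ≤ Fintype.card G * C := by positivity
      linarith
    · refine (hB x ⟨hx', hx.le⟩).trans ?_
      calc B ≤ B * Real.exp R * Real.exp x := by
            rw [mul_assoc, ← Real.exp_add]
            exact le_mul_of_one_le_right hB0 (by simp; linarith)
        _ ≤ _ := by
            gcongr
            have := norm_nonneg σ
            have : 0 ≤ Fintype.card G * C := by positivity
            linarith

/-- Mertens' theorem for the trivial class of a finite abelian group. -/
theorem exists_abs_mertens_le (A V : G → ArithmeticFunction ℝ) (hA : ∀ g n, 0 ≤ A g n)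
    (hV : ∀ g n, 0 ≤ V g n) (hA1 : ∀ g, g ≠ 0 → A g 1 = 0) (hA1' : A 0 1 = 1)
    (hAV : ∀ g n, A g n * Real.log n =
      ∑ p ∈ n.divisorsAntidiagonal, ∑ h, A h p.1 * V (g - h) p.2)
    {K : ℝ} (hK : ∀ X : ℝ, 0 ≤ X → ∑ n ∈ Finset.Icc 1 ⌊X⌋₊, ∑ g, V g n ≤ K * X)
    (hS : ∀ φ : ℝ → ℝ, ContDiff ℝ ∞ φ → HasCompactSupport φ → ∃ ρ C : ℝ, ∀ g x, 0 ≤ x →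
      |∑' n : ℕ, A g n * φ (Real.log n - x) - ρ * Real.exp x| ≤ C * Real.exp (-x))
    {n₀ : ℕ} (hn₀ : 2 ≤ n₀) {c₀ : ℝ} (hc₀ : 0 < c₀)
    (hcn : ∀ j : ℕ, 1 ≤ j → 1 ≤ A 0 (n₀ ^ j) ∧ c₀ ≤ V 0 (n₀ ^ j)) :
    ∃ B, ∀ x : ℝ, 0 ≤ x →
      |Fintype.card G * ∑ n ∈ Finset.Icc 1 ⌊Real.exp x⌋₊, V 0 n / n - x| ≤ B := by
  classical
  let b : ContDiffBump (0 : ℝ) := ⟨1, 2, one_pos, by norm_num⟩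
  obtain ⟨φ, hφb⟩ : ∃ φ : ℝ → ℝ, φ = b := ⟨_, rfl⟩
  have hφs : ContDiff ℝ ∞ φ := hφb ▸ b.contDiff
  have hφ : HasCompactSupport φ := hφb ▸ b.hasCompactSupport
  have hφc : Continuous φ := hφs.continuous
  have hφ0 : ∀ x, 0 ≤ φ x := fun x => hφb ▸ b.nonneg
  have hφ1 : φ 0 = 1 := hφb ▸ b.one_of_mem_closedBall (by simp [b])
  have hφ' : HasCompactSupport fun t => t * φ t := hφ.mul_left
  have hφs' : ContDiff ℝ ∞ fun t => t * φ t := contDiff_id.mul hφs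
  obtain ⟨ρ, C, hρ⟩ := hS φ hφs hφ
  obtain ⟨ρ', C', hρ'⟩ := hS _ hφs' hφ'
  have hlog : 0 < Real.log n₀ := Real.log_pos (by exact_mod_cast hn₀)
  have hA1'' : ∀ g, A g 1 = if g = 0 then 1 else 0 := by
    intro g; split_ifs with h
    · rw [h, hA1']
    · exact hA1 g h
  have hρ0 : ρ ≠ 0 := by
    rintro rfl
    have key : ∀ j : ℕ, 1 ≤ j → 1 ≤ C * Real.exp (-(j * Real.log n₀)) := by
      intro j hj
      have hx : (0 : ℝ) ≤ j * Real.log n₀ := by positivity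
      have h1 := hρ 0 _ hx
      rw [zero_mul, sub_zero] at h1
      refine le_trans ?_ ((le_abs_self _).trans h1)
      have h2 : Real.log ((n₀ ^ j : ℕ) : ℝ) = j * Real.log n₀ := by push_cast; rw [Real.log_pow]
      obtain ⟨R, hR, hs⟩ := exists_support_bound hφ
      obtain ⟨N, hN⟩ := exists_nat_gt (Real.exp (j * Real.log n₀ + R))
      have h3 : Summable fun n : ℕ => A 0 n * φ (Real.log n - j * Real.log n₀) := by
        refine summable_of_ne_finset_zero (s := Finset.range N) fun n hn => ?_
        rw [Finset.mem_range, not_lt] at hn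
        rw [hs, mul_zero]
        refine lt_of_lt_of_le ?_ (le_abs_self _)
        have h1 : Real.exp (j * Real.log n₀ + R) < n := hN.trans_le (by exact_mod_cast hn)
        have := (Real.lt_log_iff_exp_lt ((Real.exp_pos _).trans h1)).2 h1
        linarith
      have h4 := h3.le_tsum (n₀ ^ j) fun n _ => mul_nonneg (hA _ _) (hφ0 _)
      rw [h2, sub_self, hφ1, mul_one] at h4
      exact (hcn j hj).1.trans h4
    have hlim : Filter.Tendsto (fun j : ℕ => C * Real.exp (-(j * Real.log n₀))) Filter.atTop
        (nhds 0) := by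
      have := (Real.tendsto_exp_neg_atTop_nhds_zero.comp
        (tendsto_natCast_atTop_atTop.atTop_mul_const hlog)).const_mul C
      simpa using this
    have := ge_of_tendsto hlim (Filter.eventually_atTop.2 ⟨1, key⟩)
    linarith
  have hl : ∀ χ n, ‖charTwist V χ n‖ ≤ ∑ g, V g n := by
    intro χ n
    refine norm_sum_le_of_le _ fun g _ => ?_
    rw [norm_mul, AddChar.norm_apply, one_mul, Complex.norm_real, Real.norm_of_nonneg (hV _ _)]
  have hcard : (Fintype.card G : ℝ) ≠ 0 := by exact_mod_cast Fintype.card_ne_zero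
  have hB : ∀ χ : AddChar G ℂ, ∃ B : ℝ, ∀ x : ℝ, 0 ≤ x →
      ‖∑ n ∈ Finset.Icc 1 ⌊Real.exp x⌋₊, charTwist V χ n / n -
        if χ = 0 then (x : ℂ) else 0‖ ≤ B := by
    intro χ
    obtain ⟨C₁, hC₁⟩ := exists_norm_smoothSum_charTwist_le χ hφ hφc hρ
    obtain ⟨C₂, hC₂⟩ := exists_norm_smoothSum_charTwist_le χ hφ' hφs'.continuous hρ'
    by_cases hχ : χ = 0
    · simp only [if_pos hχ] at hC₁ hC₂ ⊢
      refine exists_norm_mertens_pole_le (logMul_charTwist hAV χ) (hl χ) hK hφ ?_ hC₁ hC₂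
      exact mul_ne_zero (by exact_mod_cast hcard) (by exact_mod_cast hρ0)
    · simp only [if_neg hχ, sub_zero, zero_mul] at hC₁ hC₂ ⊢
      refine exists_norm_mertens_no_pole_le (logMul_charTwist hAV χ) (hl χ) hK hφ hφc hC₁ hC₂ ?_
      obtain ⟨C₀, hC₀⟩ := exists_norm_smoothSum_charTwist_le 0 hφ hφc hρ
      have e : ∀ n, charTwist V 0 n + charTwist V χ n + conj (charTwist V 0 n + charTwist V χ n) =
          ((∑ g, V g n * (2 + 2 * (χ g).re) : ℝ) : ℂ) := by
        intro n
        rw [Complex.add_conj]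
        congr 1
        rw [charTwist_apply, charTwist_apply, ← Finset.sum_add_distrib, Complex.re_sum,
          Finset.mul_sum]
        refine Finset.sum_congr rfl fun g _ => ?_
        simp only [AddChar.zero_apply, Complex.add_re, Complex.re_mul_ofReal, Complex.one_re]
        ring
      have e2 : ∀ g n, 0 ≤ V g n * (2 + 2 * (χ g).re) := by
        intro g n
        have h1 := Complex.abs_re_le_norm (χ g)
        rw [AddChar.norm_apply, abs_le] at h1
        exact mul_nonneg (hV _ _) (by linarith)
      refine integral_smoothSum_ne_zero hφ hφc hφ0 (by rw [hφ1]; exact one_ne_zero) hC₀ hC₁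
        (charTwist_one hA1'' 0) (charTwist_one hA1'' χ) (logMul_charTwist hAV 0)
        (logMul_charTwist hAV χ) (fun n => ?_) hn₀ hc₀ fun j hj => ?_
      · rw [e, Complex.zero_le_real]
        exact Finset.sum_nonneg fun g _ => e2 g n
      · rw [e, Complex.real_le_real]
        have := Finset.single_le_sum (f := fun g => V g (n₀ ^ j) * (2 + 2 * (χ g).re))
          (fun g _ => e2 g _) (Finset.mem_univ (0 : G))
        refine le_trans ?_ this
        simp only [AddChar.map_zero_eq_one, Complex.one_re]
        linarith [(hcn j hj).2]
  choose B hB using hB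
  refine ⟨∑ χ, B χ, fun x hx => ?_⟩
  have h1 : ((Fintype.card G * ∑ n ∈ Finset.Icc 1 ⌊Real.exp x⌋₊, V 0 n / n - x : ℝ) : ℂ) =
      ∑ χ : AddChar G ℂ, (∑ n ∈ Finset.Icc 1 ⌊Real.exp x⌋₊, charTwist V χ n / n -
        if χ = 0 then (x : ℂ) else 0) := by
    rw [Finset.sum_sub_distrib, Finset.sum_ite_eq', if_pos (Finset.mem_univ _), Finset.sum_comm]
    push_cast
    rw [Finset.mul_sum]
    congr 1
    refine Finset.sum_congr rfl fun n _ => ?_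
    simp_rw [charTwist_apply]
    rw [← Finset.sum_div, Finset.sum_comm]
    simp_rw [← Finset.sum_mul, AddChar.sum_apply_eq_ite]
    simp [mul_div_assoc]
  rw [← Real.norm_eq_abs, ← Complex.norm_real, h1]
  exact norm_sum_le_of_le _ fun χ _ => hB χ x hx

/-- A Chebyshev type lower bound for the primes in the trivial class. -/
theorem exists_le_sum_primes (A V : G → ArithmeticFunction ℝ) (hA : ∀ g n, 0 ≤ A g n)
    (hV : ∀ g n, 0 ≤ V g n) (hA1 : ∀ g, g ≠ 0 → A g 1 = 0) (hA1' : A 0 1 = 1)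
    (hAV : ∀ g n, A g n * Real.log n =
      ∑ p ∈ n.divisorsAntidiagonal, ∑ h, A h p.1 * V (g - h) p.2)
    {K : ℝ} (hK : ∀ n, ∑ g, V g n ≤ K * ArithmeticFunction.vonMangoldt n)
    (hS : ∀ φ : ℝ → ℝ, ContDiff ℝ ∞ φ → HasCompactSupport φ → ∃ ρ C : ℝ, ∀ g x, 0 ≤ x →
      |∑' n : ℕ, A g n * φ (Real.log n - x) - ρ * Real.exp x| ≤ C * Real.exp (-x))
    {n₀ : ℕ} (hn₀ : 2 ≤ n₀) {c₀ : ℝ} (hc₀ : 0 < c₀)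
    (hcn : ∀ j : ℕ, 1 ≤ j → 1 ≤ A 0 (n₀ ^ j) ∧ c₀ ≤ V 0 (n₀ ^ j)) :
    ∃ c > 0, ∃ X₀, ∀ X : ℝ, X₀ ≤ X →
      c * X ≤ ∑ p ∈ Finset.Icc 1 ⌊X⌋₊ with p.Prime, V 0 p := by
  have hK0 : 0 ≤ K := by
    have h1 := (Finset.sum_nonneg fun g _ => hV g 2).trans (hK 2)
    rw [ArithmeticFunction.vonMangoldt_apply_prime Nat.prime_two] at h1
    exact nonneg_of_mul_nonneg_left h1 (Real.log_pos (by norm_num))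
  have hV0 : ∀ n, V 0 n ≤ K * ArithmeticFunction.vonMangoldt n := fun n =>
    (Finset.single_le_sum (f := fun g => V g n) (fun g _ => hV g n) (Finset.mem_univ 0)).trans
      (hK n)
  obtain ⟨K', hK'⟩ : ∃ K' : ℝ, ∀ X : ℝ, 0 ≤ X →
      ∑ n ∈ Finset.Icc 1 ⌊X⌋₊, ∑ g, V g n ≤ K' * X := by
    refine ⟨K * (Real.log 4 + 4), fun X hX => ?_⟩
    have h1 := Chebyshev.psi_le_const_mul_self hX
    calc ∑ n ∈ Finset.Icc 1 ⌊X⌋₊, ∑ g, V g n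
        ≤ ∑ n ∈ Finset.Icc 1 ⌊X⌋₊, K * ArithmeticFunction.vonMangoldt n :=
          Finset.sum_le_sum fun n _ => hK n
      _ = K * Chebyshev.psi X := by rw [← Finset.mul_sum]; rfl
      _ ≤ K * ((Real.log 4 + 4) * X) := by gcongr
      _ = _ := by ring
  obtain ⟨B, hB⟩ := exists_abs_mertens_le A V hA hV hA1 hA1' hAV hK' hS hn₀ hc₀ hcn
  obtain ⟨B', hB'⟩ : ∃ B' : ℝ, ∀ N : ℕ,
      ∑ n ∈ Finset.Icc 1 N with ¬ n.Prime, V 0 n / n ≤ B' := by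
    have hs := ArithmeticFunction.vonMangoldt.summable_residueClass_non_primes_div (q := 1) 0
    refine ⟨K * ∑' n : ℕ, (if n.Prime then 0 else
      ArithmeticFunction.vonMangoldt.residueClass (0 : ZMod 1) n) / n, fun N => ?_⟩
    · refine le_trans ?_ (mul_le_mul_of_nonneg_left
        (hs.sum_le_tsum (Finset.Icc 1 N) fun n _ => ?_) hK0)
      · rw [Finset.sum_filter, Finset.mul_sum]
        refine Finset.sum_le_sum fun n _ => ?_
        have : ArithmeticFunction.vonMangoldt.residueClass (0 : ZMod 1) n =
            ArithmeticFunction.vonMangoldt n := by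
          rw [ArithmeticFunction.vonMangoldt.residueClass, Set.indicator_of_mem]
          exact Subsingleton.elim _ _
        split_ifs with h
        · simp
        · rw [this, ← mul_div_assoc]
          gcongr
          exact hV0 n
      · split_ifs
        · simp
        · exact div_nonneg (Set.indicator_nonneg
            (fun _ _ => ArithmeticFunction.vonMangoldt_nonneg) _) n.cast_nonneg
  set h : ℝ := (Fintype.card G : ℝ) with hh
  have hpos : 0 < h := by rw [hh]; exact_mod_cast Fintype.card_pos
  have hB0 : 0 ≤ B := (abs_nonneg _).trans (hB 0 le_rfl)
  have hB'0 : 0 ≤ B' := by simpa using hB' 0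
  set D : ℝ := 2 * B + h * B' + h with hD
  have hD0 : 0 < D := by positivity
  refine ⟨Real.exp (-D), Real.exp_pos _, Real.exp D, fun X hX => ?_⟩
  have hX0 : 0 < X := (Real.exp_pos _).trans_le hX
  set x := Real.log X with hx
  have hxD : D ≤ x := (Real.le_log_iff_exp_le hX0).2 hX
  have hXx : Real.exp x = X := Real.exp_log hX0
  have h1 := (abs_le.1 (hB x (hD0.le.trans hxD))).1
  have h2 := (abs_le.1 (hB (x - D) (by linarith))).2
  rw [hXx] at h1
  set Y := Real.exp (x - D) with hY
  have hYX : Y = Real.exp (-D) * X := by rw [hY, ← hXx, ← Real.exp_add]; congr 1; ring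
  have hYle : Y ≤ X := by rw [← hXx, hY]; exact Real.exp_le_exp.2 (by linarith)
  have hsub : Finset.Icc 1 ⌊Y⌋₊ ⊆ Finset.Icc 1 ⌊X⌋₊ :=
    Finset.Icc_subset_Icc_right (Nat.floor_le_floor hYle)
  have h3 : ∑ n ∈ Finset.Icc 1 ⌊X⌋₊ \ Finset.Icc 1 ⌊Y⌋₊, V 0 n / n =
      ∑ n ∈ Finset.Icc 1 ⌊X⌋₊, V 0 n / n - ∑ n ∈ Finset.Icc 1 ⌊Y⌋₊, V 0 n / n := by
    rw [← Finset.sum_sdiff hsub]; ring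
  have h4 : 1 + B' ≤ ∑ n ∈ Finset.Icc 1 ⌊X⌋₊ \ Finset.Icc 1 ⌊Y⌋₊, V 0 n / n := by
    rw [h3]
    refine le_of_mul_le_mul_left ?_ hpos
    rw [mul_sub]
    linarith
  have h5 : ∑ n ∈ Finset.Icc 1 ⌊X⌋₊ \ Finset.Icc 1 ⌊Y⌋₊, V 0 n / n ≤
      (∑ p ∈ Finset.Icc 1 ⌊X⌋₊ with p.Prime, V 0 p) / Y + B' := by
    rw [← Finset.sum_filter_add_sum_filter_not _ Nat.Prime]
    refine add_le_add ?_ ?_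
    · rw [Finset.sum_div]
      calc ∑ n ∈ Finset.Icc 1 ⌊X⌋₊ \ Finset.Icc 1 ⌊Y⌋₊ with n.Prime, V 0 n / n
          ≤ ∑ n ∈ Finset.Icc 1 ⌊X⌋₊ \ Finset.Icc 1 ⌊Y⌋₊ with n.Prime, V 0 n / Y := by
            refine Finset.sum_le_sum fun n hn => ?_
            simp only [Finset.mem_filter, Finset.mem_sdiff, Finset.mem_Icc, not_and, not_le] at hn
            have h6 := hn.1.2 hn.1.1.1
            exact div_le_div_of_nonneg_left (hV _ _) (Real.exp_pos _)
              ((Nat.floor_lt (Real.exp_pos _).le).1 h6).le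
        _ ≤ _ := Finset.sum_le_sum_of_subset_of_nonneg
            (Finset.filter_subset_filter _ Finset.sdiff_subset)
            fun n _ _ => div_nonneg (hV _ _) (Real.exp_pos _).le
    · refine le_trans (Finset.sum_le_sum_of_subset_of_nonneg
            (Finset.filter_subset_filter _ Finset.sdiff_subset)
            fun n _ _ => div_nonneg (hV _ _) n.cast_nonneg) (hB' ⌊X⌋₊)
  have h7 : 1 ≤ (∑ p ∈ Finset.Icc 1 ⌊X⌋₊ with p.Prime, V 0 p) / Y := by linarith
  rw [le_div_iff₀ (Real.exp_pos _), one_mul] at h7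
  rwa [← hYX]

end GroupMertens

section PrincipalPrimes

/-- There are many principal prime ideals of prime norm with a generator congruent to `1`
modulo `M`. -/
theorem exists_le_ncard_principal_primes (L : Type) [Field L] [NumberField L] (M : ℕ)
    [M.AtLeastTwo] : ∃ c : ℝ, 0 < c ∧ ∃ X₀ : ℝ, ∀ X : ℝ, X₀ ≤ X →
      {P : Ideal (𝓞 L) | (Ideal.absNorm P : ℝ) ≤ X ∧ (Ideal.absNorm P).Prime ∧
        ∃ γ : 𝓞 L, redMod L M γ = 1 ∧ P = Ideal.span {γ}}.Finite ∧
      c * X / Real.log X ≤ ({P : Ideal (𝓞 L) | (Ideal.absNorm P : ℝ) ≤ X ∧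
        (Ideal.absNorm P).Prime ∧ ∃ γ : 𝓞 L, redMod L M γ = 1 ∧ P = Ideal.span {γ}}.ncard : ℝ) := by
  classical
  obtain ⟨n₀, hn₀, c₀, hc₀, hcn⟩ := exists_le_rayCount_pow (L := L) (M := M)
  obtain ⟨c, hc, X₀, hX⟩ := exists_le_sum_primes (G := Additive (RayClassGroup L M)) rayCount
    rayVonMangoldt rayCount_nonneg rayVonMangoldt_nonneg rayCount_one rayCount_zero_one
    rayCount_mul_log sum_rayVonMangoldt_le exists_tsum_rayCount_sub_exp_le hn₀ hc₀ hcn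
  refine ⟨c, hc, max X₀ 2, fun X h => ?_⟩
  have hX2 : 2 ≤ X := (le_max_right _ _).trans h
  have hlog : 0 < Real.log X := Real.log_pos (by linarith)
  set S := {P : Ideal (𝓞 L) | (Ideal.absNorm P : ℝ) ≤ X ∧
        (Ideal.absNorm P).Prime ∧ ∃ γ : 𝓞 L, redMod L M γ = 1 ∧ P = Ideal.span {γ}} with hS
  have hfin : S.Finite := by
    refine ((Finset.range (⌊X⌋₊ + 1)).finite_toSet.biUnion fun n _ =>
      Ideal.finite_setOfPred_absNorm_eq (S := 𝓞 L) n).subset fun P hP => ?_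
    simp only [Set.mem_iUnion]
    exact ⟨Ideal.absNorm P, by
      rw [Finset.mem_coe, Finset.mem_range, Nat.lt_succ_iff]; exact Nat.le_floor hP.1, rfl⟩
  refine ⟨hfin, ?_⟩
  have h1 := hX X ((le_max_left _ _).trans h)
  set F := (Finset.Icc 1 ⌊X⌋₊).filter Nat.Prime with hF
  set B : ℕ → Finset (coprimeIdeals L M) := fun p => (normFinset p).filter
    fun a => rayClassAdd a = 0 with hB
  have h2 : ∑ p ∈ F, rayVonMangoldt (0 : Additive (RayClassGroup L M)) p ≤
      ∑ p ∈ F, ((B p).card : ℝ) * Real.log X := by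
    refine Finset.sum_le_sum fun p hp => ?_
    obtain ⟨hp1, hp2⟩ := Finset.mem_filter.1 hp
    rw [Finset.mem_Icc] at hp1
    rw [rayVonMangoldt_prime _ hp2, rayCount_apply, Finset.sum_const, nsmul_eq_mul, mul_one]
    refine mul_le_mul_of_nonneg_left (Real.log_le_log (by exact_mod_cast hp2.pos) ?_)
      (Nat.cast_nonneg _)
    exact (Nat.cast_le.2 hp1.2).trans (Nat.floor_le (by linarith))
  rw [← Finset.sum_mul, ← Nat.cast_sum, ← Finset.card_sigma] at h2
  rw [div_le_iff₀ hlog]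
  refine h1.trans (h2.trans ?_)
  gcongr
  rw [← Set.ncard_coe_finset]
  refine Set.ncard_le_ncard_of_injOn (fun i => (i.2 : Ideal (𝓞 L))) ?_ ?_ hfin
  · rintro ⟨p, a⟩ hi
    simp only [Finset.coe_sigma, Set.mem_sigma_iff, Finset.mem_coe, hB, hF, Finset.mem_filter,
      Finset.mem_Icc, mem_normFinset] at hi
    obtain ⟨⟨⟨-, hpX⟩, hp⟩, hap, ha⟩ := hi
    refine ⟨?_, ?_, rayClass_eq_one_iff.1 ha⟩
    · rw [hap]; exact (Nat.cast_le.2 hpX).trans (Nat.floor_le (by linarith))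
    · rw [hap]; exact hp
  · rintro ⟨p, a⟩ hi ⟨q, b⟩ hj hab
    simp only [Finset.coe_sigma, Set.mem_sigma_iff, Finset.mem_coe, hB, Finset.mem_filter,
      mem_normFinset] at hi hj hab
    obtain rfl : p = q := by rw [← hi.2.1, ← hj.2.1, hab]
    rw [Subtype.ext hab]

end PrincipalPrimes

section Stepanov

variable {K : Type*} [Field K]

/-- The derivation `f · d/dX` twisted by the logarithmic derivative of a power of `f`. -/
noncomputable def twistedDeriv (f : K[X]) (i : ℕ) : K[X] →ₗ[K] K[X] :=
  LinearMap.mulLeft K f ∘ₗ derivative + LinearMap.mulLeft K ((i : K[X]) * derivative f)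

lemma twistedDeriv_apply (f : K[X]) (i : ℕ) (r : K[X]) :
    twistedDeriv f i r = f * derivative r + i * derivative f * r := rfl

lemma natDegree_twistedDeriv_le (f : K[X]) (i : ℕ) (r : K[X]) :
    (twistedDeriv f i r).natDegree ≤ r.natDegree + f.natDegree := by
  rw [twistedDeriv_apply]
  refine (natDegree_add_le _ _).trans (max_le ?_ ?_)
  · refine natDegree_mul_le.trans ?_
    have := natDegree_derivative_le r
    omega
  · refine natDegree_mul_le.trans ?_
    have h1 := natDegree_mul_le (p := (i : K[X])) (q := derivative f)
    have := natDegree_derivative_le f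
    rw [natDegree_natCast] at h1
    omega

lemma natDegree_twistedDeriv_pow_le (f : K[X]) (i k : ℕ) (r : K[X]) :
    ((twistedDeriv f i ^ k) r).natDegree ≤ r.natDegree + k * f.natDegree := by
  induction k with
  | zero => simp
  | succ k ih =>
    rw [pow_succ', Module.End.mul_apply]
    refine (natDegree_twistedDeriv_le _ _ _).trans ?_
    rw [add_mul, one_mul]
    omega

lemma twistedDeriv_zero_mul {f : K[X]} (r : K[X]) {h : K[X]} (hh : derivative h = 0) (i : ℕ) :
    twistedDeriv f 0 (r * h * f ^ i) = twistedDeriv f i r * h * f ^ i := by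
  rw [twistedDeriv_apply, twistedDeriv_apply, derivative_mul, derivative_mul, hh, derivative_pow]
  rcases i with _ | i
  · simp; ring
  · rw [Nat.add_sub_cancel, C_eq_natCast]
    push_cast
    ring

lemma twistedDeriv_zero_pow_mul {f : K[X]} (r : K[X]) {h : K[X]} (hh : derivative h = 0)
    (i k : ℕ) : (twistedDeriv f 0 ^ k) (r * h * f ^ i) = (twistedDeriv f i ^ k) r * h * f ^ i := by
  induction k with
  | zero => simp
  | succ k ih =>
    rw [pow_succ', Module.End.mul_apply, ih, twistedDeriv_zero_mul _ hh, pow_succ',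
      Module.End.mul_apply]

lemma eval_twistedDeriv_zero_pow (f : K[X]) (x : K) (t : ℕ) (u : K[X]) :
    eval x ((twistedDeriv f 0 ^ t) ((X - C x) ^ t * u)) =
      t.factorial * eval x f ^ t * eval x u := by
  induction t generalizing u with
  | zero => simp
  | succ t ih =>
    have h : twistedDeriv f 0 ((X - C x) ^ (t + 1) * u) =
        (X - C x) ^ t * (f * (((t + 1 : ℕ) : K[X]) * u + (X - C x) * derivative u)) := by
      rw [twistedDeriv_apply, derivative_mul, derivative_X_sub_C_pow]
      push_cast
      rw [C_add, C_1, C_eq_natCast]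
      ring
    rw [pow_succ, Module.End.mul_apply, h, ih, Nat.factorial_succ]
    simp
    ring

lemma X_sub_C_pow_dvd_of_eval_twistedDeriv {f R : K[X]} {x : K} (hx : eval x f ≠ 0) {l : ℕ}
    (hl : ∀ t < l, (t.factorial : K) ≠ 0)
    (h : ∀ t < l, eval x ((twistedDeriv f 0 ^ t) R) = 0) : (X - C x) ^ l ∣ R := by
  have : ∀ t ≤ l, (X - C x) ^ t ∣ R := by
    intro t
    induction t with
    | zero => simp
    | succ t ih =>
      intro ht
      obtain ⟨u, hu⟩ := ih (by omega)
      have h1 := h t (by omega)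
      rw [hu, eval_twistedDeriv_zero_pow] at h1
      have h2 : eval x u = 0 :=
        (mul_eq_zero.1 h1).resolve_left (mul_ne_zero (hl t (by omega)) (pow_ne_zero _ hx))
      obtain ⟨w, hw⟩ := dvd_iff_isRoot.2 h2
      exact ⟨w, by rw [hu, hw, pow_succ, mul_assoc]⟩
  exact this l le_rfl

/-- The auxiliary polynomial of the Stepanov method. -/
noncomputable def stepanovPoly (f : K[X]) (α : K) (q e : ℕ) {n J : ℕ}
    (s : Fin n × Fin J → K[X]) : K[X] :=
  ∑ ij, s ij * (X - C α) ^ (q * ij.2) * f ^ (e * ij.1)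

lemma stepanovPoly_ne_zero {f : K[X]} {α : K} (hα : f.rootMultiplicity α = 1) {q e n J : ℕ}
    (hq : n * e ≤ q) {s : Fin n × Fin J → K[X]} (hs : ∀ ij, (s ij).degree < e) (hs0 : s ≠ 0) :
    stepanovPoly f α q e s ≠ 0 := by
  classical
  intro hR
  have hf0 : f ≠ 0 := by rintro rfl; simp at hα
  obtain ⟨g, hg, hgα⟩ := exists_eq_pow_rootMultiplicity_mul_and_not_dvd f hf0 α
  rw [hα, pow_one] at hg
  obtain ⟨ij₀, h0⟩ := Function.ne_iff.1 hs0
  set v : Fin n × Fin J → ℕ := fun ij => q * ij.2 + e * ij.1 with hv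
  obtain ⟨ij, hij, hmin⟩ := Finset.exists_min_image (Finset.univ.filter fun ij => s ij ≠ 0) v
    ⟨ij₀, by simpa using h0⟩
  have hsij : s ij ≠ 0 := (Finset.mem_filter.1 hij).2
  have he : 0 < e := by
    have := hs ij
    by_contra h
    rw [Nat.le_zero.1 (not_lt.1 h)] at this
    exact hsij (degree_eq_bot.1 (Nat.WithBot.lt_zero_iff.1 (by simpa using this)))
  have hgap : ∀ kl, s kl ≠ 0 → kl ≠ ij → v ij + e ≤ v kl := by
    intro kl hkl hne
    have h1 := hmin kl (by simpa using hkl)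
    obtain ⟨i, j⟩ := ij
    obtain ⟨k, l⟩ := kl
    simp only [hv] at h1 ⊢
    have hi : e * (i : ℕ) + e ≤ q := by nlinarith [i.2]
    have hk : e * (k : ℕ) + e ≤ q := by nlinarith [k.2]
    rcases lt_trichotomy (j : ℕ) l with h | h | h
    · have : q * ((j : ℕ) + 1) ≤ q * l := Nat.mul_le_mul_left _ h
      nlinarith
    · rw [h] at h1 ⊢
      have hik : (i : ℕ) < k := by
        have h2 : e * (i : ℕ) ≤ e * k := by omega
        refine lt_of_le_of_ne (Nat.le_of_mul_le_mul_left h2 he) fun h3 => hne ?_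
        exact Prod.ext (Fin.ext h3.symm) (Fin.ext h.symm)
      have : e * ((i : ℕ) + 1) ≤ e * k := Nat.mul_le_mul_left _ hik
      nlinarith
    · exfalso
      have : q * ((l : ℕ) + 1) ≤ q * j := Nat.mul_le_mul_left _ h
      nlinarith
  have hterm : ∀ kl : Fin n × Fin J, s kl * (X - C α) ^ (q * (kl.2 : ℕ)) * f ^ (e * (kl.1 : ℕ)) =
      (X - C α) ^ v kl * (s kl * g ^ (e * (kl.1 : ℕ))) := by
    intro kl
    conv_lhs => rw [hg]
    rw [hv, mul_pow, pow_add]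
    ring
  have hdvd : (X - C α) ^ (v ij + e) ∣ (X - C α) ^ v ij * (s ij * g ^ (e * (ij.1 : ℕ))) := by
    rw [stepanovPoly, ← Finset.add_sum_erase _ _ (Finset.mem_univ ij), hterm] at hR
    rw [eq_neg_of_add_eq_zero_left hR, dvd_neg]
    refine Finset.dvd_sum fun kl hkl => ?_
    rw [hterm]
    by_cases h : s kl = 0
    · rw [h, zero_mul, mul_zero]; exact dvd_zero _
    · exact (pow_dvd_pow _ (hgap kl h (Finset.ne_of_mem_erase hkl))).mul_right _
  rw [pow_add] at hdvd
  have h1 := (mul_dvd_mul_iff_left (pow_ne_zero _ (X_sub_C_ne_zero α))).1 hdvd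
  have hcop : IsCoprime ((X - C α) ^ e) (g ^ (e * (ij.1 : ℕ))) :=
    (((irreducible_X_sub_C α).coprime_iff_not_dvd).2 hgα).pow
  have h2 := hcop.dvd_of_dvd_mul_right h1
  have h3 := degree_le_of_dvd h2 hsij
  rw [degree_pow, degree_X_sub_C, nsmul_eq_mul, mul_one] at h3
  exact absurd (hs ij) (not_lt.2 h3)

lemma exists_stepanov_coefficients (f : K[X]) (β a : K) (e : ℕ) {n J l A : ℕ}
    (h : l * (A + l * f.natDegree + J) < n * J * A) :
    ∃ s : Fin n × Fin J → K[X], s ≠ 0 ∧ (∀ ij, (s ij).degree < A) ∧ ∀ k < l,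
      ∑ ij, C (a ^ (ij.1 : ℕ)) * (X - C β) ^ (ij.2 : ℕ) *
        (twistedDeriv f (e * ij.1) ^ k) (s ij) = 0 := by
  classical
  set B := A + l * f.natDegree + J with hB
  have := Module.Finite.equiv (degreeLTEquiv K A).symm
  have := Module.Free.of_equiv (degreeLTEquiv K A).symm
  let Ψ (k : ℕ) : (Fin n × Fin J → degreeLT K A) →ₗ[K] K[X] :=
    ∑ ij, (LinearMap.mulLeft K (C (a ^ (ij.1 : ℕ)) * (X - C β) ^ (ij.2 : ℕ)) ∘ₗ
      (twistedDeriv f (e * ij.1) ^ k) ∘ₗ (degreeLT K A).subtype ∘ₗ LinearMap.proj ij)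
  let Θ : (Fin n × Fin J → degreeLT K A) →ₗ[K] (Fin l × Fin B → K) :=
    LinearMap.pi fun kb => lcoeff K kb.2 ∘ₗ Ψ kb.1
  have hfr : Module.finrank K (Fin l × Fin B → K) <
      Module.finrank K (Fin n × Fin J → degreeLT K A) := by
    have h1 : Module.finrank K (Fin l × Fin B → K) = l * B := by simp
    have h2 : Module.finrank K (degreeLT K A) = A := by
      rw [(degreeLTEquiv K A).finrank_eq, Module.finrank_fin_fun]
    rw [h1, Module.finrank_pi_fintype, h2]
    simpa using h
  obtain ⟨s, hs, hs0⟩ := (Submodule.ne_bot_iff _).1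
    (LinearMap.ker_ne_bot_of_finrank_lt (f := Θ) hfr)
  refine ⟨fun ij => s ij, fun h0 => hs0 ?_, fun ij => mem_degreeLT.1 (s ij).2, fun k hk => ?_⟩
  · ext1 ij
    exact Subtype.ext (congrFun h0 ij)
  · have hΨ : Ψ k s = ∑ ij, C (a ^ (ij.1 : ℕ)) * (X - C β) ^ (ij.2 : ℕ) *
        (twistedDeriv f (e * ij.1) ^ k) (s ij) := by
      simp [Ψ, mul_assoc]
    rw [← hΨ]
    ext b
    rw [coeff_zero]
    by_cases hb : b < B
    · exact congrFun (LinearMap.mem_ker.1 hs) (⟨k, hk⟩, ⟨b, hb⟩)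
    · rw [hΨ, finsetSum_coeff]
      refine Finset.sum_eq_zero fun ij _ => coeff_eq_zero_of_natDegree_lt ?_
      have hA : 0 < A := by
        rcases Nat.eq_zero_or_pos A with rfl | hA
        · simp at h
        · exact hA
      have h1 : (s ij : K[X]).natDegree < A := by
        rcases eq_or_ne (s ij : K[X]) 0 with h2 | h2
        · rw [h2, natDegree_zero]; exact hA
        · exact (natDegree_lt_iff_degree_lt h2).2 (mem_degreeLT.1 (s ij).2)
      have h2 := natDegree_twistedDeriv_pow_le f (e * ij.1) k (s ij)
      have h3 : ((X - C β) ^ (ij.2 : ℕ)).natDegree ≤ (ij.2 : ℕ) := by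
        rw [natDegree_pow, natDegree_X_sub_C, mul_one]
      have h4 := natDegree_mul_le (p := C (a ^ (ij.1 : ℕ)) * (X - C β) ^ (ij.2 : ℕ))
        (q := (twistedDeriv f (e * ij.1) ^ k) (s ij))
      have h5 := natDegree_C_mul_le (a ^ (ij.1 : ℕ)) ((X - C β) ^ (ij.2 : ℕ))
      have h6 := ij.2.2
      have h7 : k * f.natDegree ≤ l * f.natDegree := Nat.mul_le_mul_right _ hk.le
      omega

/-- Stepanov's bound for the number of points of a finite field at which a power of a polynomial
takes a given value. -/
theorem stepanov_bound {F : Type*} [Field F] [Fintype F] [DecidableEq F] {f : F[X]} [Algebra F K]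
    {α : K} (hα : (f.map (algebraMap F K)).rootMultiplicity α = 1) {p : ℕ} [CharP F p]
    {n e l J A : ℕ} (hn : n * e ≤ Fintype.card F) (hl : l ≤ p) (hAe : A ≤ e)
    (h : l * (A + l * f.natDegree + J) < n * J * A) (a : F) :
    l * (Finset.univ.filter fun x => eval x f ≠ 0 ∧ eval x f ^ e = a).card ≤
      A + n * e * f.natDegree + (J - 1) * Fintype.card F := by
  classical
  obtain ⟨r, hp, hr⟩ := FiniteField.card F p
  have := Fact.mk hp
  have hK : CharP K p := charP_of_injective_algebraMap (algebraMap F K).injective p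
  set q := Fintype.card F with hq
  set g := f.map (algebraMap F K) with hg
  have hgd : g.natDegree = f.natDegree := natDegree_map _
  obtain ⟨s, hs0, hsd, hs⟩ := exists_stepanov_coefficients (n := n) (J := J) g (α ^ q)
    (algebraMap F K a) e (by rwa [hgd])
  have hR := stepanovPoly_ne_zero hα hn (s := s)
    (fun ij => (hsd ij).trans_le (Nat.cast_le.2 hAe)) hs0
  set R := stepanovPoly g α q e s with hRdef
  have hq0 : (q : K) = 0 := by
    rw [hr, Nat.cast_pow, CharP.cast_eq_zero, zero_pow r.ne_zero]
  have hder : ∀ j : ℕ, derivative ((X - C α) ^ (q * j)) = 0 := by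
    intro j
    rw [derivative_X_sub_C_pow, Nat.cast_mul, hq0]
    simp
  have hθ : ∀ k, (twistedDeriv g 0 ^ k) R = ∑ ij : Fin n × Fin J,
      (twistedDeriv g (e * ij.1) ^ k) (s ij) * (X - C α) ^ (q * (ij.2 : ℕ)) *
        g ^ (e * (ij.1 : ℕ)) := by
    intro k
    rw [hRdef, stepanovPoly, map_sum]
    exact Finset.sum_congr rfl fun ij _ => twistedDeriv_zero_pow_mul _ (hder _) _ _
  have hdvd : ∀ x ∈ Finset.univ.filter fun x => eval x f ≠ 0 ∧ eval x f ^ e = a,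
      (X - C (algebraMap F K x)) ^ l ∣ R := by
    intro x hx
    obtain ⟨hx0, hxa⟩ := (Finset.mem_filter.1 hx).2
    have hgx : eval (algebraMap F K x) g = algebraMap F K (eval x f) := by
      rw [hg, eval_map_algebraMap, aeval_algebraMap_apply, coe_aeval_eq_eval]
    refine X_sub_C_pow_dvd_of_eval_twistedDeriv (f := g) ?_ (fun t ht => ?_) fun t ht => ?_
    · rw [hgx]
      exact (_root_.map_ne_zero _).2 hx0
    · intro h0
      rw [CharP.cast_eq_zero_iff K p, hp.dvd_factorial] at h0
      omega
    · rw [hθ, eval_finsetSum]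
      have h1 := congrArg (eval (algebraMap F K x)) (hs t ht)
      rw [eval_finsetSum, eval_zero] at h1
      rw [← h1]
      refine Finset.sum_congr rfl fun ij _ => ?_
      have h2 : (algebraMap F K x - α) ^ q = algebraMap F K x - α ^ q := by
        have h3 := sub_pow_char_pow (p := p) (n := r) (algebraMap F K x) α
        rw [← hr] at h3
        rw [h3, ← map_pow, FiniteField.pow_card]
      simp only [eval_mul, eval_pow, eval_sub, eval_X, eval_C]
      rw [hgx, pow_mul, pow_mul, h2, ← map_pow (algebraMap F K) _ e, hxa]
      ring
  have hprod := Finset.prod_dvd_of_coprime (fun x _ y _ hxy => ?_) hdvd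
  swap
  · exact (isCoprime_X_sub_C_of_isUnit_sub
      (sub_ne_zero.2 ((algebraMap F K).injective.ne hxy)).isUnit).pow
  have hdeg := natDegree_le_of_dvd hprod hR
  rw [natDegree_prod_of_monic _ _ fun x _ => (monic_X_sub_C _).pow l] at hdeg
  simp only [natDegree_pow, natDegree_X_sub_C, mul_one, Finset.sum_const, smul_eq_mul] at hdeg
  rw [mul_comm] at hdeg
  refine hdeg.trans (natDegree_sum_le_of_forall_le _ _ fun ij _ => ?_)
  have h1 : (s ij).natDegree ≤ A := natDegree_le_iff_degree_le.2 (hsd ij).le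
  have h2 : ((X - C α) ^ (q * (ij.2 : ℕ))).natDegree ≤ (J - 1) * q := by
    rw [natDegree_pow, natDegree_X_sub_C, mul_one, mul_comm]
    exact Nat.mul_le_mul_right _ (by omega)
  have h3 : (g ^ (e * (ij.1 : ℕ))).natDegree ≤ n * e * f.natDegree := by
    rw [natDegree_pow, hgd]
    refine Nat.mul_le_mul_right _ ?_
    rw [mul_comm]
    exact Nat.mul_le_mul_right _ ij.1.2.le
  have h4 := natDegree_mul_le (p := s ij * (X - C α) ^ (q * (ij.2 : ℕ)))
    (q := g ^ (e * (ij.1 : ℕ)))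
  have h5 := natDegree_mul_le (p := s ij) (q := (X - C α) ^ (q * (ij.2 : ℕ)))
  omega

lemma exists_eval_pow_eq_of_large {F : Type*} [Field F] [Fintype F] {f : F[X]} (hf : f.Separable)
    (hf0 : 0 < f.natDegree) {p : ℕ} [CharP F p] {n e A : ℕ} (hne : n * e + 1 = Fintype.card F)
    (hA : A = n ^ 2 * f.natDegree * (n * f.natDegree + 1 + n ^ 2 * f.natDegree * f.natDegree) + 1)
    (hAe : A ≤ e) (hp : n ^ 2 * f.natDegree ≤ p)
    (hlarge : n ^ 2 * f.natDegree * f.natDegree + n * A < Fintype.card F) {c : F} (hc : c ≠ 0) :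
    ∃ x, eval x f ≠ 0 ∧ eval x f ^ e = c ^ e := by
  classical
  by_contra! hcon
  set m := f.natDegree with hm
  set q := Fintype.card F with hq
  have hn : 0 < n := by
    rcases Nat.eq_zero_or_pos n with rfl | h
    · have := Fintype.one_lt_card (α := F)
      omega
    · exact h
  have hf00 : f ≠ 0 := by rintro rfl; simp [hm] at hf0
  have hpow : ∀ x : F, x ≠ 0 → (x ^ e) ^ n = 1 := by
    intro x hx
    rw [← pow_mul, mul_comm, show n * e = q - 1 by omega]
    exact FiniteField.pow_card_sub_one_eq_one x hx
  obtain ⟨α, hα⟩ := IsAlgClosed.exists_aeval_eq_zero (AlgebraicClosure F) f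
    (by rw [degree_eq_natDegree hf00]; exact_mod_cast hf0.ne')
  have hα1 : (f.map (algebraMap F (AlgebraicClosure F))).rootMultiplicity α = 1 := by
    refine le_antisymm (rootMultiplicity_le_one_of_separable hf.map α)
      ((rootMultiplicity_pos (by simpa using hf00)).2 ?_)
    rwa [IsRoot, eval_map_algebraMap]
  set Z := nthRootsFinset n (1 : F) with hZ
  set S : F → Finset F := fun a => Finset.univ.filter fun x => eval x f ≠ 0 ∧ eval x f ^ e = a
  have hcZ : c ^ e ∈ Z := (mem_nthRootsFinset hn _).2 (hpow c hc)
  have hcover : (Finset.univ : Finset F) ⊆ f.roots.toFinset ∪ (Z.erase (c ^ e)).biUnion S := by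
    intro x _
    by_cases hx : eval x f = 0
    · exact Finset.mem_union_left _ (by simpa [hf00] using hx)
    · refine Finset.mem_union_right _ (Finset.mem_biUnion.2 ⟨eval x f ^ e, ?_, ?_⟩)
      · exact Finset.mem_erase.2 ⟨hcon x hx, (mem_nthRootsFinset hn _).2 (hpow _ hx)⟩
      · simp [S, hx]
  have hcard : q ≤ m + ∑ a ∈ Z.erase (c ^ e), (S a).card := by
    refine (Finset.card_le_card hcover).trans ((Finset.card_union_le _ _).trans ?_)
    exact add_le_add ((Multiset.toFinset_card_le _).trans (card_roots' f)) Finset.card_biUnion_le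
  have hbound : ∀ a, n ^ 2 * m * (S a).card ≤ A + n * e * m + (n * m + 1 - 1) * q := fun a =>
    stepanov_bound (J := n * m + 1) (A := A) hα1 (by omega) hp hAe (by rw [← hm, hA]; nlinarith) a
  rw [Nat.add_sub_cancel] at hbound
  have hZc : (Z.erase (c ^ e)).card + 1 ≤ n := by
    rw [Finset.card_erase_add_one hcZ]
    exact (Multiset.toFinset_card_le _).trans (card_nthRoots n 1)
  obtain ⟨N, hN⟩ : ∃ N, N + 1 = n := ⟨n - 1, by omega⟩
  have h1 : n ^ 2 * m * q ≤ n ^ 2 * m * m + N * (A + n * e * m + n * m * q) := by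
    calc n ^ 2 * m * q ≤ n ^ 2 * m * (m + ∑ a ∈ Z.erase (c ^ e), (S a).card) :=
          Nat.mul_le_mul_left _ hcard
      _ = n ^ 2 * m * m + ∑ a ∈ Z.erase (c ^ e), n ^ 2 * m * (S a).card := by
          rw [mul_add, Finset.mul_sum]
      _ ≤ n ^ 2 * m * m + (Z.erase (c ^ e)).card * (A + n * e * m + n * m * q) := by
          refine Nat.add_le_add_left ?_ _
          rw [← smul_eq_mul]
          exact Finset.sum_le_card_nsmul _ _ _ fun a _ => hbound a
      _ ≤ _ := Nat.add_le_add_left (Nat.mul_le_mul_right _ (by omega)) _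
  have h2 : n * e * m ≤ q * m := Nat.mul_le_mul_right _ (by omega)
  have h3 : N * (A + n * e * m + n * m * q) ≤ N * (A + q * m + n * m * q) :=
    Nat.mul_le_mul_left _ (by omega)
  have h4 : n ^ 2 * m * q = N * (q * m + n * m * q) + m * q := by
    rw [← hN]; ring
  have h5 : q ≤ m * q := Nat.le_mul_of_pos_left _ hf0
  have h6 : N * A ≤ n * A := Nat.mul_le_mul_right _ (by omega)
  have h7 : N * (A + q * m + n * m * q) = N * A + N * (q * m + n * m * q) := by ring
  omega

lemma IsCyclic.exists_pow_eq_of_pow_eq_one {G : Type*} [Group G] [Finite G] [IsCyclic G] {n e : ℕ}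
    (he : Nat.gcd n (Nat.card G) * e = Nat.card G) {u : G} (hu : u ^ e = 1) : ∃ y, y ^ n = u := by
  obtain ⟨g, hg⟩ := IsCyclic.exists_generator (α := G)
  obtain ⟨i, rfl⟩ := Subgroup.mem_zpowers_iff.1 (hg u)
  have hord : orderOf g = Nat.card G := orderOf_eq_card_of_forall_mem_zpowers hg
  have hpos : 0 < Nat.card G := Nat.card_pos
  have he0 : e ≠ 0 := by rintro rfl; omega
  have h1 : ((Nat.gcd n (Nat.card G) : ℕ) : ℤ) ∣ i := by
    rw [← zpow_natCast, ← zpow_mul, ← orderOf_dvd_iff_zpow_eq_one, hord, ← he,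
      Nat.cast_mul] at hu
    exact Int.dvd_of_mul_dvd_mul_right (by exact_mod_cast he0) hu
  obtain ⟨j, rfl⟩ := h1
  refine ⟨g ^ (Nat.gcdA n (Nat.card G) * j), ?_⟩
  have h2 : g ^ (Nat.card G : ℤ) = 1 := by rw [zpow_natCast, pow_card_eq_one']
  have h3 : ((Nat.gcd n (Nat.card G) : ℕ) : ℤ) * j =
      Nat.gcdA n (Nat.card G) * j * n + Nat.card G * (Nat.gcdB n (Nat.card G) * j) := by
    rw [Nat.gcd_eq_gcd_ab]
    ring
  rw [h3, zpow_add, zpow_mul g (Nat.card G : ℤ), h2, one_zpow, mul_one, ← zpow_natCast, ← zpow_mul]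

/-- Twists of `y ^ n = f(x)` have points with nonzero `y` over finite fields of large
characteristic. -/
theorem exists_forall_exists_mul_pow_eq_eval (n m : ℕ) (hn : 0 < n) (hm : 0 < m) :
    ∃ Q : ℕ, ∀ (F : Type) [Field F] [Finite F] (p : ℕ) [CharP F p], Q ≤ p →
      ∀ f : F[X], f.Separable → f.natDegree = m → ∀ c : F, c ≠ 0 →
        ∃ x y : F, y ≠ 0 ∧ c * y ^ n = eval x f := by
  set A : ℕ → ℕ := fun N => N ^ 2 * m * (N * m + 1 + N ^ 2 * m * m) + 1 with hA
  refine ⟨n ^ 2 * m * m + n * A n + 1, fun F _ _ p _ hp f hf hfm c hc => ?_⟩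
  classical
  have := Fintype.ofFinite F
  have hpq : p ≤ Fintype.card F := by
    obtain ⟨r, hpp, hr⟩ := FiniteField.card F p
    rw [hr]
    exact Nat.le_self_pow r.ne_zero p
  have hcard : Nat.card Fˣ + 1 = Fintype.card F := by
    rw [Nat.card_eq_fintype_card, Fintype.card_units]
    have := Fintype.card_pos (α := F)
    omega
  obtain ⟨e, he⟩ := Nat.gcd_dvd_right n (Nat.card Fˣ)
  set N := Nat.gcd n (Nat.card Fˣ) with hN
  have hNn : N ≤ n := Nat.gcd_le_left _ hn
  have hAN : A N ≤ A n := by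
    simp only [hA]
    gcongr
  have hN0 : 0 < N := Nat.gcd_pos_of_pos_left _ hn
  have h1 : N ^ 2 * m ≤ n ^ 2 * m := by gcongr
  have h2 : N ^ 2 * m * m ≤ n ^ 2 * m * m := by gcongr
  have h3 : N * A N ≤ n * A n := by gcongr
  have h4 : n ^ 2 * m ≤ n ^ 2 * m * m := Nat.le_mul_of_pos_right _ hm
  obtain ⟨x, hx, hxe⟩ := exists_eval_pow_eq_of_large hf (hfm ▸ hm) (p := p) (n := N) (e := e)
    (A := A N) (by omega) (by rw [hfm])
    (Nat.le_of_mul_le_mul_left (by omega : N * A N ≤ N * e) hN0)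
    (by rw [hfm]; omega) (by rw [hfm]; omega) hc
  obtain ⟨y, hy⟩ := IsCyclic.exists_pow_eq_of_pow_eq_one (n := n) he.symm
    (u := Units.mk0 (eval x f) hx * (Units.mk0 c hc)⁻¹) (by
      rw [mul_pow, inv_pow, mul_inv_eq_one]
      exact Units.ext hxe)
  refine ⟨x, y, y.ne_zero, ?_⟩
  rw [← Units.val_pow_eq_pow_val, hy]
  simp
  field_simp

end Stepanov

section Hensel

/-- The closed unit ball of an ultrametric normed field, as a subring. -/
def unitBallSubring (K : Type*) [NormedField K] [IsUltrametricDist K] : Subring K where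
  carrier := {x | ‖x‖ ≤ 1}
  mul_mem' {x y} hx hy := by
    rw [Set.mem_ofPred_eq, norm_mul]
    exact mul_le_one₀ hx (norm_nonneg _) hy
  one_mem' := by simp
  add_mem' {x y} hx hy := (IsUltrametricDist.norm_add_le_max x y).trans (max_le hx hy)
  zero_mem' := by simp
  neg_mem' {x} hx := by simpa using hx

lemma norm_mul_le_of_unitBallSubring {K : Type*} [NormedField K] [IsUltrametricDist K]
    (x y : unitBallSubring K) : ‖x * y‖ ≤ ‖y‖ :=
  (norm_mul_le x y).trans (mul_le_of_le_one_left (norm_nonneg _) x.2)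

lemma norm_sub_le_max_of_unitBallSubring {K : Type*} [NormedField K] [IsUltrametricDist K]
    (x y : unitBallSubring K) : ‖x - y‖ ≤ max ‖x‖ ‖y‖ :=
  (congrArg norm (sub_eq_add_neg (x : K) y)).trans_le
    ((IsUltrametricDist.norm_add_le_max (x : K) (-y)).trans_eq (by rw [norm_neg]; rfl))

lemma exists_eval_eq_zero_of_unitBallSubring {K : Type*} [NormedField K] [IsUltrametricDist K]
    [CompleteSpace K] (g : (unitBallSubring K)[X]) (a : unitBallSubring K)
    (h0 : ‖eval a g‖ < 1) (h1 : ‖eval a (derivative g)‖ = 1) :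
    ∃ z, eval z g = 0 := by
  have hcl : IsClosed (unitBallSubring K : Set K) := isClosed_le continuous_norm continuous_const
  have hcomp : CompleteSpace (unitBallSubring K) := hcl.completeSpace_coe
  obtain ⟨u, hu⟩ : ∃ u : unitBallSubring K, u * eval a (derivative g) = 1 := by
    refine ⟨⟨((eval a (derivative g) : unitBallSubring K) : K)⁻¹, ?_⟩, Subtype.ext ?_⟩
    · change ‖_‖ ≤ 1
      rw [norm_inv]
      exact (congrArg (·⁻¹) h1).trans inv_one |>.le
    · refine inv_mul_cancel₀ fun h => ?_
      rw [show eval a (derivative g) = 0 from Subtype.ext h, norm_zero] at h1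
      exact zero_ne_one h1
  set r := ‖eval a g‖ with hr
  set T : unitBallSubring K → unitBallSubring K := fun x => x - u * eval x g with hT
  have hmaps : Set.MapsTo T (Metric.closedBall a r) (Metric.closedBall a r) := by
    intro x hx
    rw [Metric.mem_closedBall, dist_eq_norm] at hx ⊢
    obtain ⟨z, hz⟩ := evalSubFactor g x a
    have h2 : T x - a = (x - a) - u * (eval a g + z * (x - a)) := by
      rw [← hz, hT]; ring
    rw [h2]
    refine (norm_sub_le_max_of_unitBallSubring _ _).trans (max_le hx ?_)
    refine (norm_mul_le_of_unitBallSubring _ _).trans ?_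
    rw [← sub_neg_eq_add]
    refine (norm_sub_le_max_of_unitBallSubring _ _).trans (max_le le_rfl ?_)
    rw [norm_neg]
    exact (norm_mul_le_of_unitBallSubring _ _).trans hx
  have hlip : ∀ x ∈ Metric.closedBall a r, ∀ y ∈ Metric.closedBall a r,
      ‖T x - T y‖ ≤ r * ‖x - y‖ := by
    intro x hx y hy
    rw [Metric.mem_closedBall, dist_eq_norm] at hx hy
    obtain ⟨k, hk⟩ := binomExpansion g y (x - y)
    obtain ⟨z, hz⟩ := evalSubFactor (derivative g) y a
    rw [add_sub_cancel] at hk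
    have h2 : T x - T y = (-(u * z) * (y - a) - u * k * (x - y)) * (x - y) := by
      have h3 : eval y (derivative g) = eval a (derivative g) + z * (y - a) := by
        rw [← hz]; ring
      simp only [hT]
      rw [hk, h3]
      linear_combination -(x - y) * hu
    rw [h2]
    refine (norm_mul_le _ _).trans (mul_le_mul_of_nonneg_right ?_ (norm_nonneg _))
    refine (norm_sub_le_max_of_unitBallSubring _ _).trans (max_le ?_ ?_)
    · exact (norm_mul_le_of_unitBallSubring _ _).trans hy
    · refine (norm_mul_le_of_unitBallSubring _ _).trans ?_
      rw [← sub_sub_sub_cancel_right x y a]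
      exact (norm_sub_le_max_of_unitBallSubring _ _).trans (max_le hx hy)
  have hcon : ContractingWith ‖eval a g‖₊ (hmaps.restrict T _ _) := by
    refine ⟨h0, LipschitzWith.of_dist_le_mul fun x y => ?_⟩
    exact (dist_eq_norm (T x) (T y)).trans_le ((hlip x x.2 y y.2).trans_eq
      (congrArg _ (dist_eq_norm (x : unitBallSubring K) y).symm))
  obtain ⟨z, -, hz, -⟩ := hcon.exists_fixedPoint' Metric.isClosed_closedBall.isComplete hmaps
    (Metric.mem_closedBall_self (norm_nonneg _)) (edist_ne_top _ _)
  refine ⟨z, ?_⟩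
  have h2 : u * eval z g = 0 := by
    have h3 : z - u * eval z g = z := hz
    simpa using h3
  calc eval z g = (u * eval a (derivative g)) * eval z g := by rw [hu, one_mul]
    _ = eval a (derivative g) * (u * eval z g) := by ring
    _ = 0 := by rw [h2, mul_zero]

/-- Hensel's lemma in the completions of a number field, for polynomials with global integral
coefficients. -/
theorem exists_aeval_adicCompletion_eq_zero {k : Type*} [Field k] [NumberField k]
    (w : HeightOneSpectrum (𝓞 k)) (g : (𝓞 k)[X]) (a : 𝓞 k) (h0 : eval a g ∈ w.asIdeal)
    (h1 : eval a (derivative g) ∉ w.asIdeal) :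
    ∃ z : w.adicCompletion k, aeval z g = 0 := by
  have hult : IsUltrametricDist (w.adicCompletion k) := by
    refine IsUltrametricDist.isUltrametricDist_of_forall_norm_add_le_max_norm fun x y => ?_
    simp only [FinitePlace.norm_def]
    exact_mod_cast (WithZeroMulInt.toNNReal_strictMono
      (HeightOneSpectrum.one_lt_absNorm_nnreal w)).monotone.map_max ▸
        (WithZeroMulInt.toNNReal_strictMono
          (HeightOneSpectrum.one_lt_absNorm_nnreal w)).monotone (Valued.v.map_add x y)
  let φ : 𝓞 k →+* unitBallSubring (w.adicCompletion k) :=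
    (algebraMap (𝓞 k) (w.adicCompletion k)).codRestrict _ fun r =>
      FinitePlace.norm_le_one k w r
  obtain ⟨z, hz⟩ := exists_eval_eq_zero_of_unitBallSubring (g.map φ) (φ a)
    (by
      rw [eval_map, eval₂_at_apply]
      exact (FinitePlace.norm_lt_one_iff_mem k w _).2 h0)
    (by
      rw [derivative_map, eval_map, eval₂_at_apply]
      exact (FinitePlace.norm_eq_one_iff_notMem k w _).2 h1)
  refine ⟨z, ?_⟩
  have h2 := congrArg (unitBallSubring (w.adicCompletion k)).subtype hz
  rw [eval_map, hom_eval₂, map_zero] at h2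
  exact h2

end Hensel

section LocalSolubility

variable {k : Type*} [Field k] [NumberField k] (w : HeightOneSpectrum (𝓞 k))

lemma exists_pow_eq_one_add_sq_mul (n : ℕ) {t : 𝓞 k} (ht : t ∈ w.asIdeal) :
    ∃ z : w.adicCompletion k,
      z ^ n = algebraMap (𝓞 k) (w.adicCompletion k) (1 + n ^ 2 * t) := by
  obtain ⟨h, hh⟩ := powAddExpansion (1 : (𝓞 k)[X]) (C (n : 𝓞 k) * X) n
  obtain ⟨z, hz⟩ := exists_aeval_adicCompletion_eq_zero w (X + X ^ 2 * h - C t) 0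
    (by simpa using ht) (by simpa using w.isPrime.one_notMem)
  refine ⟨1 + n * z, ?_⟩
  have h1 := congrArg (aeval z) hh
  simp only [map_add, map_mul, map_pow, map_one, aeval_X, aeval_C, map_sub, map_natCast] at h1 hz ⊢
  rw [h1]
  linear_combination (n : w.adicCompletion k) ^ 2 * hz

lemma exists_mul_pow_eq_aeval_of_congr {F : (𝓞 k)[X]} {π x y : 𝓞 k} {n : ℕ}
    (hn : (n : 𝓞 k) ∉ w.asIdeal) (hπ : π ∉ w.asIdeal) (hy : y ∉ w.asIdeal)
    (h : π * y ^ n - eval x F ∈ w.asIdeal) :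
    ∃ X Y : w.adicCompletion k,
      algebraMap (𝓞 k) (w.adicCompletion k) π * Y ^ n = aeval X F := by
  obtain ⟨z, hz⟩ := exists_aeval_adicCompletion_eq_zero w (C π * X ^ n - C (eval x F)) y
    (by simpa using h) (by
      have := w.isPrime
      simp only [derivative_sub, derivative_C_mul, derivative_X_pow, derivative_C, sub_zero,
        eval_mul, eval_C, eval_pow, eval_X]
      intro h1
      rcases this.mem_or_mem h1 with h1 | h1
      · exact hπ h1
      · rcases this.mem_or_mem h1 with h1 | h1
        · exact hn h1
        · exact hy (this.mem_of_pow_mem _ h1))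
  refine ⟨algebraMap (𝓞 k) _ x, z, ?_⟩
  rw [aeval_algebraMap_apply, coe_aeval_eq_eval]
  simpa [sub_eq_zero] using hz

lemma exists_mul_pow_eq_aeval_of_root {F : (𝓞 k)[X]} {π x : 𝓞 k} (n : ℕ) (hπ : π ∈ w.asIdeal)
    (hx : eval x F ∈ w.asIdeal) (hx' : eval x (derivative F) ∉ w.asIdeal) :
    ∃ X Y : w.adicCompletion k,
      algebraMap (𝓞 k) (w.adicCompletion k) π * Y ^ n = aeval X F := by
  obtain ⟨z, hz⟩ := exists_aeval_adicCompletion_eq_zero w (F - C π) x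
    (by simpa using sub_mem hx hπ) (by simpa using hx')
  refine ⟨z, 1, ?_⟩
  rw [map_sub, aeval_C, sub_eq_zero] at hz
  rw [one_pow, mul_one, hz]

variable {w} in
lemma exists_mul_pow_eq_aeval_of_map_eq {f : k[X]} {F : (𝓞 k)[X]} {b : 𝓞 k} {n : ℕ} (hb : b ≠ 0)
    (hF : F.map (algebraMap (𝓞 k) k) = C (algebraMap (𝓞 k) k b ^ n) * f) {π : 𝓞 k}
    (h : ∃ X Y : w.adicCompletion k,
      algebraMap (𝓞 k) (w.adicCompletion k) π * Y ^ n = aeval X F) :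
    ∃ X Y : w.adicCompletion k,
      algebraMap k (w.adicCompletion k) (algebraMap (𝓞 k) k π) * Y ^ n = aeval X f := by
  obtain ⟨x, y, hxy⟩ := h
  have hb' : algebraMap (𝓞 k) (w.adicCompletion k) b ≠ 0 := by
    rw [IsScalarTower.algebraMap_apply (𝓞 k) k]
    simpa using hb
  refine ⟨x, y / algebraMap (𝓞 k) (w.adicCompletion k) b, ?_⟩
  rw [← aeval_map_algebraMap k, hF, aeval_mul, aeval_C, map_pow,
    ← IsScalarTower.algebraMap_apply] at hxy
  rw [← IsScalarTower.algebraMap_apply, div_pow]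
  field_simp
  exact hxy

end LocalSolubility

section RelativeNorm

variable {k L : Type*} [Field k] [Field L] [Algebra k L]

/-- If `L` contains a square root of `-1`, the relative norm of a nonzero element is positive at
every real embedding of the base field. -/
lemma norm_pos_of_sq_eq_neg_one [CharZero k] [FiniteDimensional k L] {i : L} (hi : i ^ 2 = -1)
    (σ : k →+* ℝ) {x : L} (hx : x ≠ 0) : 0 < σ (Algebra.norm k x) := by
  classical
  let : Algebra k ℂ := (Complex.ofRealHom.comp σ).toAlgebra
  have hσ : ∀ r : k, algebraMap k ℂ r = (σ r : ℂ) := fun r => rfl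
  let cj : (L →ₐ[k] ℂ) → (L →ₐ[k] ℂ) := fun τ =>
    { toRingHom := (starRingEnd ℂ).comp τ.toRingHom
      commutes' := fun r => by simp [hσ] }
  have hcj : ∀ τ y, cj τ y = starRingEnd ℂ (τ y) := fun τ y => rfl
  have hne : ∀ τ : L →ₐ[k] ℂ, τ x ≠ 0 := fun τ => by simpa using hx
  have h1 : ∏ τ : L →ₐ[k] ℂ, τ x / (‖τ x‖ : ℂ) = 1 := by
    refine Finset.prod_involution (fun τ _ => cj τ) (fun τ _ => ?_) (fun τ _ _ h => ?_)
      (fun _ _ => Finset.mem_univ _) (fun τ _ => ?_)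
    · have := hne τ
      have h2 : (‖τ x‖ : ℂ) ≠ 0 := by simpa using this
      rw [hcj, RCLike.norm_conj, div_mul_div_comm, Complex.mul_conj, Complex.normSq_eq_norm_sq]
      push_cast
      rw [← pow_two, div_self (pow_ne_zero _ h2)]
    · have h2 : starRingEnd ℂ (τ i) = τ i := by rw [← hcj, h]
      obtain ⟨r, hr⟩ := Complex.conj_eq_iff_real.mp h2
      have h3 : τ i ^ 2 = -1 := by rw [← map_pow, hi]; simp
      rw [hr] at h3
      have : r ^ 2 = -1 := by exact_mod_cast h3
      nlinarith [sq_nonneg r]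
    · ext y
      simp [hcj]
  have h2 : (σ (Algebra.norm k x) : ℂ) = ((∏ τ : L →ₐ[k] ℂ, ‖τ x‖ : ℝ) : ℂ) := by
    rw [← hσ, Algebra.norm_eq_prod_embeddings k ℂ]
    rw [Finset.prod_div_distrib, div_eq_one_iff_eq] at h1
    · rw [h1]; push_cast; rfl
    · exact Finset.prod_ne_zero_iff.mpr fun τ _ => by simpa using hne τ
  rw [Complex.ofReal_inj] at h2
  rw [h2]
  exact Finset.prod_pos fun τ _ => norm_pos_iff.mpr (hne τ)

variable [NumberField k] [NumberField L]

/-- The relative norm of an integer congruent to `1` modulo a rational integer `M` is congruent to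
`1` modulo `M`. -/
lemma exists_norm_eq_one_add [IsGalois k L] {M : ℕ} (hM : M ≠ 0) (δ : 𝓞 L) :
    ∃ t : 𝓞 k, RingOfIntegers.norm k (1 + (M : 𝓞 L) * δ) = 1 + M * t := by
  have h : ∀ s : Finset (L ≃ₐ[k] L), ∃ u : 𝓞 L,
      ∏ τ ∈ s, τ ((1 + M * δ : 𝓞 L) : L) = 1 + M * (u : L) := by
    classical
    intro s
    induction s using Finset.induction with
    | empty => exact ⟨0, by simp⟩
    | insert τ s hτ ih =>
      obtain ⟨u, hu⟩ := ih
      refine ⟨RingOfIntegers.mapAlgEquiv τ δ * (1 + M * u) + u, ?_⟩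
      rw [Finset.prod_insert hτ, hu]
      have : ((RingOfIntegers.mapAlgEquiv τ δ : 𝓞 L) : L) = τ δ := rfl
      simp [this]
      ring
  obtain ⟨u, hu⟩ := h Finset.univ
  rw [← Algebra.norm_eq_prod_automorphisms] at hu
  have hM' : (M : k) ≠ 0 := by exact_mod_cast hM
  have hML : (M : L) ≠ 0 := by exact_mod_cast hM
  have ht : algebraMap k L ((Algebra.norm k ((1 + M * δ : 𝓞 L) : L) - 1) / M) = u := by
    rw [map_div₀, map_sub, hu]
    simp [hML]
  have hint : IsIntegral ℤ ((Algebra.norm k ((1 + M * δ : 𝓞 L) : L) - 1) / M) := by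
    rw [← isIntegral_algebraMap_iff (algebraMap k L).injective, ht]
    exact u.isIntegral_coe
  obtain ⟨t, ht⟩ : ∃ t : 𝓞 k, (t : k) = (Algebra.norm k ((1 + M * δ : 𝓞 L) : L) - 1) / M :=
    ⟨⟨_, hint⟩, rfl⟩
  refine ⟨t, RingOfIntegers.ext ?_⟩
  have h1 : ((1 + M * t : 𝓞 k) : k) = 1 + M * (t : k) := by simp
  rw [RingOfIntegers.coe_norm, h1, ht, mul_div_cancel₀ _ hM']
  ring

lemma absNorm_span_norm (γ : 𝓞 L) :
    Ideal.absNorm (Ideal.span {RingOfIntegers.norm k γ}) = Ideal.absNorm (Ideal.span {γ}) := by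
  rw [Ideal.absNorm_span_singleton, Ideal.absNorm_span_singleton]
  congr 1
  have : ((Algebra.norm ℤ (RingOfIntegers.norm k γ) : ℤ) : ℚ) = (Algebra.norm ℤ γ : ℤ) := by
    rw [Algebra.coe_norm_int, Algebra.coe_norm_int, RingOfIntegers.coe_norm, Algebra.norm_norm]
  exact_mod_cast this

end RelativeNorm

/-- At most `[L : ℚ]` prime ideals have the same prime absolute norm. -/
lemma card_le_finrank_of_absNorm_eq {L : Type*} [Field L] [NumberField L] {p : ℕ} (hp : p.Prime)
    (s : Finset (Ideal (𝓞 L)))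
    (hs : ∀ P ∈ s, Ideal.absNorm P = p) : s.card ≤ Module.finrank ℚ L := by
  have h1 : ∏ P ∈ s, P ∣ Ideal.span {(p : 𝓞 L)} := by
    refine Finset.prod_primes_dvd _ (fun P hP => ?_) fun P hP => ?_
    · refine Ideal.prime_of_isPrime ?_ (Ideal.isPrime_of_irreducible_absNorm ?_)
      · rintro rfl
        have := hs _ hP
        simp at this
        exact hp.ne_zero this.symm
      · rw [hs P hP]; exact hp
    · rw [Ideal.dvd_span_singleton]
      have := Ideal.absNorm_mem P
      rwa [hs P hP] at this
  have h2 := Ideal.absNorm_dvd_absNorm_of_le (Ideal.le_of_dvd h1)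
  rw [map_prod, Finset.prod_congr rfl hs, Finset.prod_const, Ideal.absNorm_span_natCast,
    RingOfIntegers.rank] at h2
  exact (Nat.pow_dvd_pow_iff_le_right hp.one_lt).mp h2

section IntegralModel

/-- A polynomial which is separable over the fraction field stays separable of the same degree
after every specialisation to a field not killing a suitable nonzero element. -/
lemma exists_forall_separable_map {R K : Type*} [CommRing R] [IsDomain R] [Field K] [Algebra R K]
    [IsFractionRing R K] (F : R[X]) (hF : (F.map (algebraMap R K)).Separable) :
    ∃ δ : R, δ ≠ 0 ∧ ∀ (E : Type*) [Field E] (φ : R →+* E), φ δ ≠ 0 →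
      φ F.leadingCoeff ≠ 0 ∧ (F.map φ).Separable ∧ (F.map φ).natDegree = F.natDegree := by
  obtain ⟨a, b, hab⟩ := hF
  obtain ⟨c, hc, hc'⟩ := IsLocalization.integerNormalization_spec (nonZeroDivisors R) a
  obtain ⟨d, hd, hd'⟩ := IsLocalization.integerNormalization_spec (nonZeroDivisors R) b
  set A := IsLocalization.integerNormalization (nonZeroDivisors R) a
  set B := IsLocalization.integerNormalization (nonZeroDivisors R) b
  have hinj := IsFractionRing.injective R K
  have hF0 : F ≠ 0 := by
    rintro rfl
    simp at hab
  have hid : C d * A * F + C c * B * derivative F = C (c * d) := by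
    apply map_injective (algebraMap R K) hinj
    have hsmul : ∀ (r : R) (p : K[X]), r • p = C (algebraMap R K r) * p := fun r p => by
      ext; simp [Algebra.smul_def]
    simp only [Polynomial.map_add, Polynomial.map_mul, map_C, hc', hd', derivative_map,
      hsmul, map_mul] at hab ⊢
    linear_combination (C (algebraMap R K c) * C (algebraMap R K d)) * hab
  refine ⟨c * d * F.leadingCoeff, mul_ne_zero (mul_ne_zero (nonZeroDivisors.ne_zero hc)
    (nonZeroDivisors.ne_zero hd)) (leadingCoeff_ne_zero.mpr hF0), fun E _ φ hφ => ?_⟩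
  rw [map_mul] at hφ
  have hcd := left_ne_zero_of_mul hφ
  have hl := right_ne_zero_of_mul hφ
  refine ⟨hl, ⟨C (φ (c * d))⁻¹ * (C d * A).map φ, C (φ (c * d))⁻¹ * (C c * B).map φ, ?_⟩,
    natDegree_map_of_leadingCoeff_ne_zero φ hl⟩
  have := congrArg (Polynomial.map φ) hid
  rw [Polynomial.map_add, Polynomial.map_mul (p := C d * A),
    Polynomial.map_mul (q := derivative F), map_C,
    ← derivative_map] at this
  have h2 : C (φ (c * d))⁻¹ * C (φ (c * d)) = 1 := by
    rw [← C_mul, inv_mul_cancel₀ hcd, C_1]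
  linear_combination C (φ (c * d))⁻¹ * this + h2

lemma exists_map_eq_C_pow_mul (R : Type*) {K : Type*} [CommRing R] [IsDomain R] [Field K]
    [Algebra R K] [IsFractionRing R K] (f : K[X]) {n : ℕ} (hn : 0 < n) :
    ∃ (b : R) (F : R[X]), b ≠ 0 ∧ F.map (algebraMap R K) = C (algebraMap R K b ^ n) * f := by
  obtain ⟨b, hb, h⟩ := IsLocalization.integerNormalization_spec (nonZeroDivisors R) f
  have hsmul : b • f = C (algebraMap R K b) * f := by ext; simp [Algebra.smul_def]
  refine ⟨b, C (b ^ (n - 1)) * IsLocalization.integerNormalization (nonZeroDivisors R) f,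
    nonZeroDivisors.ne_zero hb, ?_⟩
  rw [Polynomial.map_mul, h, hsmul, map_C, ← mul_assoc, ← C_mul, ← map_mul, ← pow_succ,
    Nat.sub_add_cancel hn, map_pow]

variable {k : Type*} [Field k] [NumberField k]

/-- A root of `F` in an extension gives a root modulo every prime with trivial residue extension
not dividing the leading coefficient. -/
lemma exists_eval_mem_of_aeval_eq_zero {L : Type*} [Field L] [NumberField L] [Algebra k L]
    (v : HeightOneSpectrum (𝓞 k)) (P : Ideal (𝓞 L)) [hP : P.IsMaximal]
    (hle : v.asIdeal ≤ P.comap (algebraMap (𝓞 k) (𝓞 L)))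
    (hN : Ideal.absNorm v.asIdeal = Ideal.absNorm P) (hP0 : Ideal.absNorm P ≠ 0)
    {F : (𝓞 k)[X]} (hlc : algebraMap (𝓞 k) (𝓞 L) F.leadingCoeff ∉ P) {β : L}
    (hβ : aeval β F = 0) : ∃ x : 𝓞 k, eval x F ∈ v.asIdeal := by
  let := Ideal.Quotient.field P
  have := v.isPrime
  have := v.isMaximal
  let := Ideal.Quotient.field v.asIdeal
  let ψ := Ideal.quotientMap P (algebraMap (𝓞 k) (𝓞 L)) hle
  have hinj : Function.Injective ψ := ψ.injective
  have hbij : Function.Bijective ψ := by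
    rw [Ideal.absNorm_apply, Ideal.absNorm_apply, Submodule.cardQuot_apply,
      Submodule.cardQuot_apply] at hN
    rw [Ideal.absNorm_apply, Submodule.cardQuot_apply] at hP0
    have : Finite (𝓞 L ⧸ P) := Nat.finite_of_card_ne_zero hP0
    exact hinj.bijective_of_nat_card_le hN.ge
  obtain ⟨γ, hγ⟩ : ∃ γ : 𝓞 L, algebraMap (𝓞 L) L γ = F.leadingCoeff • β :=
    ⟨⟨_, isIntegral_trans _ (isIntegral_leadingCoeff_smul F β hβ)⟩, rfl⟩
  have h1 : aeval γ (F.scaleRoots F.leadingCoeff) = 0 := by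
    apply FaithfulSMul.algebraMap_injective (𝓞 L) L
    rw [map_zero, ← aeval_algebraMap_apply, hγ, Algebra.smul_def]
    exact scaleRoots_aeval_eq_zero hβ
  set φ : 𝓞 k →+* 𝓞 L ⧸ P := (Ideal.Quotient.mk P).comp (algebraMap (𝓞 k) (𝓞 L)) with hφ
  have hl : φ F.leadingCoeff ≠ 0 := by
    rwa [Ne, hφ, RingHom.comp_apply, Ideal.Quotient.eq_zero_iff_mem]
  have h2 : eval₂ φ (Ideal.Quotient.mk P γ) (F.scaleRoots F.leadingCoeff) = 0 := by
    rw [hφ, ← hom_eval₂, ← aeval_def, h1, map_zero]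
  obtain ⟨x', hx'⟩ := hbij.2 ((φ F.leadingCoeff)⁻¹ * Ideal.Quotient.mk P γ)
  obtain ⟨x, rfl⟩ := Ideal.Quotient.mk_surjective x'
  have h3 : φ F.leadingCoeff * φ x = Ideal.Quotient.mk P γ := by
    rw [show φ x = _ from hx', mul_inv_cancel_left₀ hl]
  rw [← h3, scaleRoots_eval₂_mul, mul_eq_zero, or_iff_right (pow_ne_zero _ hl),
    eval₂_at_apply] at h2
  refine ⟨x, ?_⟩
  rw [← Ideal.Quotient.eq_zero_iff_mem]
  exact hinj (h2.trans (map_zero ψ).symm)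

end IntegralModel

section TwistSolubility

/-- Away from a suitable integer, all twists of `y ^ n = F(x)` by units have smooth points
modulo the prime. -/
lemma exists_forall_exists_twist_congr (k : Type) [Field k] [NumberField k] (F : (𝓞 k)[X])
    (hF : (F.map (algebraMap (𝓞 k) k)).Separable) (hF0 : 0 < F.natDegree) {n : ℕ} (hn : 0 < n) :
    ∃ D : ℕ, D ≠ 0 ∧ ∀ w : HeightOneSpectrum (𝓞 k), (D : 𝓞 k) ∉ w.asIdeal →
      (n : 𝓞 k) ∉ w.asIdeal ∧ F.leadingCoeff ∉ w.asIdeal ∧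
      (F.map (Ideal.Quotient.mk w.asIdeal)).Separable ∧
      ∀ c ∉ w.asIdeal, ∃ x y : 𝓞 k, y ∉ w.asIdeal ∧ c * y ^ n - eval x F ∈ w.asIdeal := by
  obtain ⟨δ, hδ, h⟩ := exists_forall_separable_map F hF
  obtain ⟨Q, hQ⟩ := exists_forall_exists_mul_pow_eq_eval n F.natDegree hn hF0
  refine ⟨Ideal.absNorm (Ideal.span {δ}) * Q.factorial * n, ?_, fun w hw => ?_⟩
  · refine mul_ne_zero (mul_ne_zero ?_ Q.factorial_ne_zero) hn.ne'
    rw [Ideal.absNorm_ne_zero_iff]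
    exact Ideal.finiteQuotientOfFreeOfNeBot _ (by simpa using hδ)
  have hδm : (Ideal.absNorm (Ideal.span {δ}) : 𝓞 k) ∈ Ideal.span {δ} := Ideal.absNorm_mem _
  obtain ⟨e, he⟩ := Ideal.mem_span_singleton.mp hδm
  push_cast at hw
  rw [he] at hw
  have hmax := w.isMaximal
  let := Ideal.Quotient.field w.asIdeal
  have hδw : Ideal.Quotient.mk w.asIdeal δ ≠ 0 := fun h0 => hw (by
    rw [Ideal.Quotient.eq_zero_iff_mem] at h0
    exact Ideal.mul_mem_right _ _ (Ideal.mul_mem_right _ _ (Ideal.mul_mem_right _ _ h0)))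
  have hQw : (Q.factorial : 𝓞 k) ∉ w.asIdeal := fun h0 =>
    hw (Ideal.mul_mem_right _ _ (Ideal.mul_mem_left _ _ h0))
  have hnw : (n : 𝓞 k) ∉ w.asIdeal := fun h0 => hw (Ideal.mul_mem_left _ _ h0)
  obtain ⟨h1, h2, h3⟩ := h (𝓞 k ⧸ w.asIdeal) (Ideal.Quotient.mk w.asIdeal) hδw
  rw [Ne, Ideal.Quotient.eq_zero_iff_mem] at h1
  refine ⟨hnw, h1, h2, fun c hc => ?_⟩
  have : Finite (𝓞 k ⧸ w.asIdeal) := Ideal.finiteQuotientOfFreeOfNeBot _ w.ne_bot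
  obtain ⟨p, hp⟩ := CharP.exists (𝓞 k ⧸ w.asIdeal)
  have hp0 : p ≠ 0 := CharP.char_ne_zero_of_finite (𝓞 k ⧸ w.asIdeal) p
  have hQp : Q ≤ p := by
    by_contra! hlt
    apply hQw
    rw [← Ideal.Quotient.eq_zero_iff_mem, map_natCast, CharP.cast_eq_zero_iff _ p]
    exact Nat.dvd_factorial (Nat.pos_of_ne_zero hp0) hlt.le
  obtain ⟨x, y, hy, hxy⟩ := hQ (𝓞 k ⧸ w.asIdeal) p hQp _ h2 h3 (Ideal.Quotient.mk _ c)
    (by rwa [Ne, Ideal.Quotient.eq_zero_iff_mem])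
  obtain ⟨x, rfl⟩ := Ideal.Quotient.mk_surjective x
  obtain ⟨y, rfl⟩ := Ideal.Quotient.mk_surjective y
  refine ⟨x, y, by rwa [Ne, Ideal.Quotient.eq_zero_iff_mem] at hy, ?_⟩
  rw [← Ideal.Quotient.eq_zero_iff_mem, map_sub, map_mul, map_pow, hxy, eval_map, eval₂_at_apply,
    sub_self]

/-- The total positivity and local solubility conditions of the twist by `π`. -/
def IsSolubleTwist {k : Type} [Field k] [NumberField k] (n : ℕ) (f : k[X]) (π : 𝓞 k) : Prop :=
  (∀ σ : k →+* ℝ, 0 < σ (algebraMap (𝓞 k) k π)) ∧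
    (∀ w : HeightOneSpectrum (𝓞 k), ∃ x y : w.adicCompletion k,
      algebraMap k (w.adicCompletion k) (algebraMap (𝓞 k) k π) * y ^ n = aeval x f) ∧
    (∀ σ : k →+* ℝ, ∃ x y : ℝ, σ (algebraMap (𝓞 k) k π) * y ^ n = eval₂ σ x f)

lemma exists_real_twist {k : Type} [Field k] {n : ℕ} (hn : 0 < n) {f : k[X]} {σ : k →+* ℝ}
    (h : ∃ x y : ℝ, y ^ n = eval₂ σ x f) {a : k} (ha : 0 < σ a) :
    ∃ x y : ℝ, σ a * y ^ n = eval₂ σ x f := by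
  obtain ⟨x, y, hxy⟩ := h
  refine ⟨x, y / (σ a) ^ ((n : ℝ)⁻¹), ?_⟩
  rw [div_pow, Real.rpow_inv_natCast_pow ha.le hn.ne', mul_div_cancel₀ _ ha.ne', hxy]

/-- The norm of a generator, congruent to `1`, of a prime ideal of prime norm in an extension
containing `√-1` and a root of `f` gives a soluble twist. -/
lemma exists_isSolubleTwist {k L : Type} [Field k] [NumberField k] [Field L] [NumberField L]
    [Algebra k L] [IsGalois k L] {n : ℕ} (hn : 0 < n) {f : k[X]} {F : (𝓞 k)[X]} {b : 𝓞 k}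
    (hb : b ≠ 0) (hF : F.map (algebraMap (𝓞 k) k) = C (algebraMap (𝓞 k) k b ^ n) * f)
    {D : ℕ} (hD0 : D ≠ 0) (hD : ∀ w : HeightOneSpectrum (𝓞 k), (D : 𝓞 k) ∉ w.asIdeal →
      (n : 𝓞 k) ∉ w.asIdeal ∧ F.leadingCoeff ∉ w.asIdeal ∧
      (F.map (Ideal.Quotient.mk w.asIdeal)).Separable ∧
      ∀ c ∉ w.asIdeal, ∃ x y : 𝓞 k, y ∉ w.asIdeal ∧ c * y ^ n - eval x F ∈ w.asIdeal)
    (hloc : ∀ v : HeightOneSpectrum (𝓞 k), ∃ x y : v.adicCompletion k, y ^ n = aeval x f)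
    (hreal : ∀ σ : k →+* ℝ, ∃ x y : ℝ, y ^ n = eval₂ σ x f)
    {i β : L} (hi : i ^ 2 = -1) (hβ : aeval β f = 0)
    {γ δ : 𝓞 L} (hγ : γ = 1 + ((n ^ 2 * D : ℕ) : 𝓞 L) * δ)
    (hp : (Ideal.absNorm (Ideal.span {γ})).Prime) :
    ∃ v : HeightOneSpectrum (𝓞 k),
      Ideal.absNorm v.asIdeal = Ideal.absNorm (Ideal.span {γ}) ∧
      ∃ π : 𝓞 k, v.asIdeal = Ideal.span {π} ∧ IsSolubleTwist n f π := by
  obtain ⟨t, ht⟩ := exists_norm_eq_one_add (k := k)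
    (mul_ne_zero (pow_ne_zero 2 hn.ne') hD0 : n ^ 2 * D ≠ 0) δ
  rw [← hγ] at ht
  have hN := absNorm_span_norm (k := k) γ
  have hdvd := RingOfIntegers.dvd_norm k γ
  have hpos : ∀ σ : k →+* ℝ, 0 < σ (algebraMap (𝓞 k) k (RingOfIntegers.norm k γ)) := fun σ => by
    rw [show algebraMap (𝓞 k) k (RingOfIntegers.norm k γ) = Algebra.norm k (γ : L) from
      RingOfIntegers.coe_norm k γ]
    refine norm_pos_of_sq_eq_neg_one hi σ ?_
    rw [Ne, RingOfIntegers.coe_eq_zero_iff]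
    rintro rfl
    simp at hp
    exact Nat.not_prime_zero hp
  set π := RingOfIntegers.norm k γ with hπ
  have hPprime : (Ideal.span {γ}).IsPrime := Ideal.isPrime_of_irreducible_absNorm hp
  have hPmax : (Ideal.span {γ}).IsMaximal := hPprime.isMaximal fun h => by
    rw [h, Ideal.absNorm_bot] at hp; exact Nat.not_prime_zero hp
  let v : HeightOneSpectrum (𝓞 k) :=
    ⟨Ideal.span {π}, Ideal.isPrime_of_irreducible_absNorm (by rw [hN]; exact hp), fun h => by
      rw [h, Ideal.absNorm_bot] at hN
      rw [← hN] at hp; exact Nat.not_prime_zero hp⟩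
  have hv : v.asIdeal = Ideal.span {π} := rfl
  have hπv : π ∈ v.asIdeal := Ideal.mem_span_singleton_self π
  have hDv : (D : 𝓞 k) ∉ v.asIdeal := fun h => by
    refine v.isPrime.one_notMem ?_
    have : (1 : 𝓞 k) = π - D * (n ^ 2 * t) := by rw [ht]; push_cast; ring
    rw [this]
    exact Ideal.sub_mem _ hπv (Ideal.mul_mem_right _ _ h)
  have hle : v.asIdeal ≤ (Ideal.span {γ}).comap (algebraMap (𝓞 k) (𝓞 L)) := by
    rw [hv, Ideal.span_singleton_le_iff_mem, Ideal.mem_comap, Ideal.mem_span_singleton]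
    exact hdvd
  refine ⟨v, hN, π, hv, hpos, fun w => ?_, fun σ => exists_real_twist hn (hreal σ) (hpos σ)⟩
  by_cases hDw : (D : 𝓞 k) ∈ w.asIdeal
  · obtain ⟨z, hz⟩ := exists_pow_eq_one_add_sq_mul w n (Ideal.mul_mem_right t _ hDw)
    obtain ⟨x, y, hxy⟩ := hloc w
    have hz' : algebraMap k (w.adicCompletion k) (algebraMap (𝓞 k) k π) = z ^ n := by
      rw [hz, ht, ← IsScalarTower.algebraMap_apply]
      congr 1
      push_cast; ring
    have hz0 : z ^ n ≠ 0 := by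
      rw [← hz']
      simp only [Ne, FaithfulSMul.algebraMap_eq_zero_iff]
      intro h0
      exact v.ne_bot (by rw [hv, h0, Ideal.span_singleton_eq_bot])
    exact ⟨x, y / z, by rw [hz', div_pow, mul_div_cancel₀ _ hz0, hxy]⟩
  obtain ⟨hnw, hlw, hsep, hgood⟩ := hD w hDw
  apply exists_mul_pow_eq_aeval_of_map_eq hb hF
  by_cases hπw : π ∈ w.asIdeal
  · have hwv : v = w := by
      refine HeightOneSpectrum.ext (v.isMaximal.eq_of_le w.isPrime.ne_top ?_)
      rwa [hv, Ideal.span_singleton_le_iff_mem]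
    subst hwv
    have hβF : aeval β F = 0 := by
      rw [← aeval_map_algebraMap k, hF, map_mul, hβ, mul_zero]
    have hlP : algebraMap (𝓞 k) (𝓞 L) F.leadingCoeff ∉ Ideal.span {γ} := by
      rw [v.isMaximal.eq_of_le (Ideal.comap_ne_top _ hPprime.ne_top) hle] at hlw
      exact hlw
    obtain ⟨x, hx⟩ := exists_eval_mem_of_aeval_eq_zero v (Ideal.span {γ}) hle hN hp.ne_zero hlP hβF
    refine exists_mul_pow_eq_aeval_of_root v n hπw hx fun hx' => ?_
    obtain ⟨A, B, hAB⟩ := hsep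
    have := congrArg (eval (Ideal.Quotient.mk v.asIdeal x)) hAB
    rw [← Ideal.Quotient.eq_zero_iff_mem] at hx hx'
    rw [derivative_map, eval_add, eval_mul, eval_mul, eval_map_apply, eval_map_apply, hx, hx',
      mul_zero, mul_zero, add_zero, eval_one] at this
    exact v.isPrime.one_notMem (Ideal.Quotient.eq_zero_iff_mem.mp (by rw [map_one, ← this]))
  · obtain ⟨x, y, hy, hxy⟩ := hgood π hπw
    exact exists_mul_pow_eq_aeval_of_congr w hnw hπw hy hxy

end TwistSolubility

section Counting

/-- Matching primes of `L` of prime norm with primes of `k` of the same norm is at most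
`[L : ℚ]`-to-one. -/
lemma ncard_le_finrank_mul_ncard {k L : Type*} [Field k] [NumberField k] [Field L] [NumberField L]
    {S : Set (Ideal (𝓞 L))} (hS : S.Finite) {T : Set (HeightOneSpectrum (𝓞 k))} (hT : T.Finite)
    (h : ∀ P ∈ S, (Ideal.absNorm P).Prime ∧ ∃ v ∈ T, Ideal.absNorm v.asIdeal = Ideal.absNorm P) :
    S.ncard ≤ Module.finrank ℚ L * T.ncard := by
  classical
  obtain rfl | ⟨P₀, hP₀⟩ := S.eq_empty_or_nonempty
  · simp
  have : Nonempty (HeightOneSpectrum (𝓞 k)) := ⟨(h P₀ hP₀).2.choose⟩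
  choose! hp g hgT hg using h
  rw [Set.ncard_eq_toFinset_card S hS, Set.ncard_eq_toFinset_card T hT]
  refine Finset.card_le_mul_card_image_of_maps_to (f := g) (fun P hP => ?_) _ fun v hv => ?_
  · simpa using hgT P (by simpa using hP)
  obtain h0 | ⟨P, hP⟩ := Finset.eq_empty_or_nonempty (hS.toFinset.filter (g · = v))
  · simp [h0]
  simp only [Finset.mem_filter, Set.Finite.mem_toFinset] at hP
  refine card_le_finrank_of_absNorm_eq (hp P hP.1) _ fun P' hP' => ?_
  simp only [Finset.mem_filter, Set.Finite.mem_toFinset] at hP'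
  rw [← hg P' hP'.1, ← hg P hP.1, hP'.2, hP.2]

lemma finite_setOf_absNorm_le (k : Type*) [Field k] [NumberField k] (X : ℝ) :
    {v : HeightOneSpectrum (𝓞 k) | (Ideal.absNorm v.asIdeal : ℝ) ≤ X}.Finite := by
  have h : {I : Ideal (𝓞 k) | Ideal.absNorm I ≤ ⌊X⌋₊}.Finite := Ideal.finite_setOfPred_absNorm_le _
  refine (h.preimage (f := HeightOneSpectrum.asIdeal)
    fun v _ w _ hvw => HeightOneSpectrum.ext hvw).subset fun v hv => ?_
  exact Nat.le_floor hv

end Counting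

section SplittingExtension

/-- A number field has a Galois extension containing `√-1` and a root of a given polynomial. -/
lemma exists_isGalois_exists_root {k : Type} [Field k] [NumberField k] {f : k[X]}
    (hf : f.natDegree ≠ 0) :
    ∃ (L : Type) (_ : Field L) (_ : NumberField L) (_ : Algebra k L), IsGalois k L ∧
      (∃ i : L, i ^ 2 = -1) ∧ ∃ β : L, aeval β f = 0 := by
  have hroot : ∀ (L : Type) [Field L] [Algebra k L] [IsSplittingField k L (f * (X ^ 2 + 1))],
      ∃ _ : NumberField L, IsGalois k L ∧ (∃ i : L, i ^ 2 = -1) ∧ ∃ β : L, aeval β f = 0 := by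
    intro L _ _ _
    have hX : (X ^ 2 + 1 : k[X]).degree = 2 := by compute_degree!
    have hX0 : (X ^ 2 + 1 : k[X]) ≠ 0 := by rintro h; simp [h] at hX
    have hf0 : f ≠ 0 := by rintro rfl; simp at hf
    have hs := IsSplittingField.splits L (f * (X ^ 2 + 1))
    have : FiniteDimensional k L := IsSplittingField.finiteDimensional L (f * (X ^ 2 + 1))
    have : Normal k L := Normal.of_isSplittingField (f * (X ^ 2 + 1))
    have hex : ∀ q : k[X], q ∣ f * (X ^ 2 + 1) → q.degree ≠ 0 → ∃ x : L, aeval x q = 0 := by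
      intro q hq hd
      have h1 : (q.map (algebraMap k L)).Splits :=
        hs.of_dvd (Polynomial.map_ne_zero (mul_ne_zero hf0 hX0)) (Polynomial.map_dvd _ hq)
      obtain ⟨x, hx⟩ := h1.exists_eval_eq_zero (by rwa [degree_map])
      exact ⟨x, by rwa [aeval_def, ← eval_map]⟩
    have : CharZero L := charZero_of_injective_algebraMap (algebraMap k L).injective
    refine ⟨NumberField.of_module_finite k L, ⟨⟩, ?_, hex f (dvd_mul_right _ _) fun h => ?_⟩
    · obtain ⟨i, hi⟩ := hex (X ^ 2 + 1) (dvd_mul_left _ _) (by rw [hX]; norm_num)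
      exact ⟨i, eq_neg_of_add_eq_zero_left (by simpa using hi)⟩
    · exact hf (natDegree_eq_of_degree_eq_some h)
  obtain ⟨h, h'⟩ := hroot (SplittingField (f * (X ^ 2 + 1)))
  exact ⟨_, _, h, _, h'⟩

end SplittingExtension

/-- If `y^n = f(x)` is everywhere locally soluble over a number field `k`,
then `≫ X / log X` prime ideals of norm at most `X` admit a totally positive
generator `π` whose twist `π·y^n = f(x)` is everywhere locally soluble. -/
theorem stmt_4 (k : Type) [Field k] [NumberField k] (n : ℕ) (hn : 2 ≤ n)
    (f : Polynomial k) (hsf : Squarefree f) (hdeg : 3 ≤ f.natDegree)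
    (hloc : ∀ v : HeightOneSpectrum (𝓞 k),
      ∃ x y : v.adicCompletion k, y ^ n = Polynomial.aeval x f)
    (hreal : ∀ σ : k →+* ℝ, ∃ x y : ℝ, y ^ n = Polynomial.eval₂ σ x f) :
    ∃ c : ℝ, 0 < c ∧ ∃ X₀ : ℝ, ∀ X : ℝ, X₀ ≤ X →
      c * X / Real.log X ≤
        ({v : HeightOneSpectrum (𝓞 k) |
            (Ideal.absNorm v.asIdeal : ℝ) ≤ X ∧
            ∃ π : 𝓞 k, v.asIdeal = Ideal.span {π} ∧
              (∀ σ : k →+* ℝ, 0 < σ (algebraMap (𝓞 k) k π)) ∧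
              (∀ w : HeightOneSpectrum (𝓞 k),
                ∃ x y : w.adicCompletion k,
                  algebraMap k (w.adicCompletion k) (algebraMap (𝓞 k) k π) * y ^ n
                    = Polynomial.aeval x f) ∧
              (∀ σ : k →+* ℝ, ∃ x y : ℝ,
                σ (algebraMap (𝓞 k) k π) * y ^ n = Polynomial.eval₂ σ x f)}.ncard : ℝ) := by
  have hn0 : 0 < n := by lia
  obtain ⟨b, F, hb, hF⟩ := exists_map_eq_C_pow_mul (𝓞 k) f hn0
  have hc : algebraMap (𝓞 k) k b ^ n ≠ 0 := pow_ne_zero _ (by simpa using hb)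
  have hsep : (F.map (algebraMap (𝓞 k) k)).Separable := by
    rw [hF]
    exact Separable.unit_mul (isUnit_C.mpr hc.isUnit)
      (PerfectField.separable_iff_squarefree.mpr hsf)
  have hFdeg : F.natDegree = f.natDegree := by
    rw [← natDegree_map_eq_of_injective (FaithfulSMul.algebraMap_injective (𝓞 k) k), hF,
      natDegree_C_mul hc]
  obtain ⟨D, hD0, hD⟩ := exists_forall_exists_twist_congr k F hsep (by lia) hn0
  obtain ⟨L, _, _, _, _, ⟨i, hi⟩, β, hβ⟩ := exists_isGalois_exists_root (f := f) (by lia)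
  have : (n ^ 2 * D).AtLeastTwo := ⟨by nlinarith [Nat.pos_of_ne_zero hD0, Nat.pow_le_pow_left hn 2]⟩
  obtain ⟨c, hc, X₀, hX⟩ := exists_le_ncard_principal_primes L (n ^ 2 * D)
  have hr : (0 : ℝ) < Module.finrank ℚ L := by exact_mod_cast Module.finrank_pos
  refine ⟨c / Module.finrank ℚ L, by positivity, X₀, fun X hX' => ?_⟩
  obtain ⟨hfin, hle⟩ := hX X hX'
  have hT : {v : HeightOneSpectrum (𝓞 k) | (Ideal.absNorm v.asIdeal : ℝ) ≤ X ∧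
      ∃ π : 𝓞 k, v.asIdeal = Ideal.span {π} ∧ IsSolubleTwist n f π}.Finite :=
    (finite_setOf_absNorm_le k X).subset fun _ => And.left
  have key := ncard_le_finrank_mul_ncard hfin hT ?_
  · rw [div_mul_eq_mul_div, div_right_comm, div_le_iff₀' hr]
    exact hle.trans (by exact_mod_cast key)
  · rintro P ⟨hPX, hp, γ, hγ, rfl⟩
    refine ⟨hp, ?_⟩
    rw [redMod, ← map_one (Ideal.Quotient.mk _), Ideal.Quotient.eq,
      Ideal.mem_span_singleton] at hγ
    obtain ⟨δ, hδ⟩ := hγ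
    obtain ⟨v, hv, hπ⟩ := exists_isSolubleTwist hn0 hb hF hD0 hD hloc hreal hi hβ
      (eq_add_of_sub_eq' hδ) hp
    exact ⟨v, ⟨by rwa [hv], hπ⟩, hv⟩
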